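/- Let ℓ ≥ 2 be an integer. There exists a constant C > 0 such that for every weight w and every continuous compactly supported f : ℝ → ℂ, ∫_ℝ |(e^{i(·)^ℓ} * f)(x)|² w(x) dx ≤ C ∫_ℝ |f(x)|² (M² 𝓜̃_ℓ M⁴ w)(x) dx, where (e^{i(·)^ℓ} * f)(x) = ∫_ℝ e^{i(x−y)^ℓ} f(y) dy. -/

import Mathlib

open MeasureTheory Real Set
open scoped ENNReal NNReal

noncomputable section

/-- The centred Hardy–Littlewood maximal operator on the line. -/
def HLM (u : ℝ → ℝ≥0∞) : ℝ → ℝ≥0∞ := fun x =>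
  ⨆ (r : ℝ) (_ : 0 < r),
    (ENNReal.ofReal (2 * r))⁻¹ * ∫⁻ y in {y : ℝ | |x - y| < r}, u y

/-- The maximal operator `𝓜̃_ℓ`:
`𝓜̃_ℓ w(x) = sup_{(y,r) ∈ Γ_ℓ(x)} r^{-1/(ℓ-1)} ∫_{|y−y'| ≤ r} w(y') dy'` where
`Γ_ℓ(x) = {(y,r) : 0 < r ≤ 1, |y − x| ≤ r^{-1/(ℓ-1)}}`. -/
def MoscT (ℓ : ℕ) (u : ℝ → ℝ≥0∞) : ℝ → ℝ≥0∞ := fun x =>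
  ⨆ (yr : ℝ × ℝ) (_ : 0 < yr.2 ∧ yr.2 ≤ 1 ∧
      |yr.1 - x| ≤ yr.2 ^ (-1 / ((ℓ : ℝ) - 1))),
    ENNReal.ofReal (yr.2 ^ (-1 / ((ℓ : ℝ) - 1))) *
      ∫⁻ y' in {y' : ℝ | |yr.1 - y'| ≤ yr.2}, u y'

def dI (n : ℕ) (x : ℝ) : Set ℝ := {y : ℝ | ⌊(2:ℝ)^n * y⌋ = ⌊(2:ℝ)^n * x⌋}

def EE (n : ℕ) (u : ℝ → ℝ≥0∞) (x : ℝ) : ℝ≥0∞ := 2^n * ∫⁻ y in dI n x, u y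

def EG (n : ℕ) (G : ℝ → ℂ) (x : ℝ) : ℂ := (2:ℂ)^n * ∫ y in dI n x, G y

def Lev {α : Type*} (n : ℕ) (φ : ℝ → α) : Prop :=
  ∀ x y : ℝ, ⌊(2:ℝ)^n * y⌋ = ⌊(2:ℝ)^n * x⌋ → φ y = φ x

lemma mem_dI_self (n : ℕ) (x : ℝ) : x ∈ dI n x := rfl

lemma dI_eq_Ico (n : ℕ) (x : ℝ) :
    dI n x = Ico ((⌊(2:ℝ)^n * x⌋ : ℝ) / 2^n) ((⌊(2:ℝ)^n * x⌋ + 1 : ℝ) / 2^n) := by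
  ext y
  have h2 : (0:ℝ) < 2^n := by positivity
  simp only [dI, mem_ofPred_eq, mem_Ico, div_le_iff₀ h2, lt_div_iff₀ h2, Int.floor_eq_iff]
  rw [mul_comm y]

lemma measurableSet_dI (n : ℕ) (x : ℝ) : MeasurableSet (dI n x) := by
  rw [dI_eq_Ico]; exact measurableSet_Ico

lemma volume_dI (n : ℕ) (x : ℝ) : volume (dI n x) = (2^n)⁻¹ := by
  rw [dI_eq_Ico, Real.volume_Ico]
  have : ((⌊(2:ℝ)^n * x⌋ + 1 : ℝ) / 2^n) - ((⌊(2:ℝ)^n * x⌋ : ℝ) / 2^n) = (2^n)⁻¹ := by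
    field_simp; ring
  rw [this, ENNReal.ofReal_inv_of_pos (by positivity), ENNReal.ofReal_pow (by norm_num)]
  simp

lemma two_pow_mul_inv (n : ℕ) : (2:ℝ≥0∞)^n * (2^n)⁻¹ = 1 :=
  ENNReal.mul_inv_cancel (by positivity) (by finiteness)

lemma dI_eq_of_mem {n : ℕ} {x y : ℝ} (h : y ∈ dI n x) : dI n y = dI n x := by
  have h' : ⌊(2:ℝ)^n * y⌋ = ⌊(2:ℝ)^n * x⌋ := h
  ext z; simp [dI, h']

lemma abs_lt_of_mem_dI {n : ℕ} {x y : ℝ} (h : y ∈ dI n x) : |x - y| < (2^n)⁻¹ := by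
  have h' : ⌊(2:ℝ)^n * y⌋ = ⌊(2:ℝ)^n * x⌋ := h
  have h2 : (0:ℝ) < 2^n := by positivity
  have := Int.abs_sub_lt_one_of_floor_eq_floor h'
  rw [← mul_sub, abs_mul, abs_of_pos h2, abs_sub_comm] at this
  rw [← one_div, lt_div_iff₀ h2, mul_comm]; exact this

lemma floor_half (n : ℕ) (x : ℝ) : ⌊(2:ℝ)^n * x⌋ = ⌊(2:ℝ)^(n+1) * x⌋ / 2 := by
  have := Int.floor_div_natCast ((2:ℝ)^(n+1) * x) 2
  have h : (2:ℝ)^(n+1) * x / (2:ℕ) = 2^n * x := by push_cast; ring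
  rw [h] at this
  simpa using this

lemma Lev.succ {α : Type*} {n : ℕ} {φ : ℝ → α} (h : Lev n φ) : Lev (n+1) φ := by
  intro x y hxy
  apply h
  rw [floor_half n, floor_half n, hxy]

lemma Lev.mono {α : Type*} {n m : ℕ} {φ : ℝ → α} (h : Lev n φ) (hnm : n ≤ m) : Lev m φ := by
  induction hnm with
  | refl => exact h
  | step _ ih => exact ih.succ

lemma Lev.measurable {α : Type*} [MeasurableSpace α] {n : ℕ} {φ : ℝ → α} (h : Lev n φ) :
    Measurable φ := by
  have : φ = (fun q : ℤ => φ ((q:ℝ) / 2^n)) ∘ (fun x : ℝ => ⌊(2:ℝ)^n * x⌋) := by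
    ext x
    simp only [Function.comp]
    apply h
    have : (2:ℝ)^n * ((⌊(2:ℝ)^n * x⌋ : ℝ) / 2^n) = (⌊(2:ℝ)^n * x⌋ : ℝ) := by field_simp
    rw [this, Int.floor_intCast]
  rw [this]
  exact (measurable_of_countable _).comp (Int.measurable_floor.comp (measurable_const_mul _))

lemma Lev.dI {n : ℕ} {x : ℝ} : Lev n (dI n x) := by
  intro a b h
  change (⌊(2:ℝ)^n * b⌋ = _) = (⌊(2:ℝ)^n * a⌋ = _)
  rw [h]

lemma Lev.EE {n : ℕ} {u : ℝ → ℝ≥0∞} : Lev n (EE n u) := by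
  intro a b h
  simp only [_root_.EE]
  rw [dI_eq_of_mem h]

lemma Lev.EG {n : ℕ} {u : ℝ → ℂ} : Lev n (EG n u) := by
  intro a b h
  simp only [_root_.EG]
  rw [dI_eq_of_mem h]

lemma dI_succ_subset (n : ℕ) (x : ℝ) : dI (n+1) x ⊆ dI n x := by
  intro y hy
  have h' : ⌊(2:ℝ)^(n+1) * y⌋ = ⌊(2:ℝ)^(n+1) * x⌋ := hy
  change ⌊(2:ℝ)^n * y⌋ = ⌊(2:ℝ)^n * x⌋
  rw [floor_half n, floor_half n, h']

lemma dI_mono {n m : ℕ} (h : n ≤ m) (x : ℝ) : dI m x ⊆ dI n x := by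
  induction h with
  | refl => exact subset_rfl
  | step _ ih => exact (dI_succ_subset _ _).trans ih

/-- left and right child representatives -/
def xl (n : ℕ) (x : ℝ) : ℝ := (⌊(2:ℝ)^n * x⌋ : ℝ) / 2^n
def xr (n : ℕ) (x : ℝ) : ℝ := (2 * ⌊(2:ℝ)^n * x⌋ + 1 : ℝ) / 2^(n+1)

lemma floor_xl (n : ℕ) (x : ℝ) : ⌊(2:ℝ)^(n+1) * xl n x⌋ = 2 * ⌊(2:ℝ)^n * x⌋ := by
  have : (2:ℝ)^(n+1) * xl n x = ((2 * ⌊(2:ℝ)^n * x⌋ : ℤ) : ℝ) := by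
    rw [xl, pow_succ]; push_cast; field_simp
  rw [this, Int.floor_intCast]

lemma floor_xr (n : ℕ) (x : ℝ) : ⌊(2:ℝ)^(n+1) * xr n x⌋ = 2 * ⌊(2:ℝ)^n * x⌋ + 1 := by
  have : (2:ℝ)^(n+1) * xr n x = ((2 * ⌊(2:ℝ)^n * x⌋ + 1 : ℤ) : ℝ) := by
    rw [xr]; push_cast; field_simp
  rw [this, Int.floor_intCast]

lemma dI_split (n : ℕ) (x : ℝ) : dI n x = dI (n+1) (xl n x) ∪ dI (n+1) (xr n x) := by
  ext y
  simp only [dI, mem_union, mem_ofPred_eq, floor_xl, floor_xr]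
  rw [floor_half n y]
  omega

lemma dI_disj (n : ℕ) (x : ℝ) : Disjoint (dI (n+1) (xl n x)) (dI (n+1) (xr n x)) := by
  rw [Set.disjoint_left]
  intro y
  simp only [dI, mem_ofPred_eq, floor_xl, floor_xr]
  omega

lemma xl_mem (n : ℕ) (x : ℝ) : xl n x ∈ dI n x := by
  rw [dI_split]; exact Or.inl rfl

lemma xr_mem (n : ℕ) (x : ℝ) : xr n x ∈ dI n x := by
  rw [dI_split]; exact Or.inr rfl

lemma lintegral_split (n : ℕ) (x : ℝ) (u : ℝ → ℝ≥0∞) :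
    ∫⁻ y in dI n x, u y = (∫⁻ y in dI (n+1) (xl n x), u y) + ∫⁻ y in dI (n+1) (xr n x), u y := by
  rw [dI_split, lintegral_union (measurableSet_dI _ _) (dI_disj _ _)]

lemma lintegral_tsum_dI (n : ℕ) (u : ℝ → ℝ≥0∞) :
    ∫⁻ y, u y = ∑' q : ℤ, ∫⁻ y in dI n ((q:ℝ) / 2^n), u y := by
  have hq : ∀ q : ℤ, ⌊(2:ℝ)^n * ((q:ℝ)/2^n)⌋ = q := by
    intro q
    have : (2:ℝ)^n * ((q:ℝ)/2^n) = q := by field_simp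
    rw [this, Int.floor_intCast]
  rw [← lintegral_iUnion (fun q => measurableSet_dI _ _)]
  · have : (⋃ q : ℤ, dI n ((q:ℝ) / 2^n)) = univ := by
      ext y
      simp only [mem_iUnion, mem_univ, iff_true]
      exact ⟨⌊(2:ℝ)^n * y⌋, by simp [dI, hq]⟩
    rw [this, Measure.restrict_univ]
  · intro p q hpq
    rw [Function.onFun, Set.disjoint_left]
    intro y h1 h2
    simp only [dI, mem_ofPred_eq, hq] at h1 h2
    exact hpq (h1.symm.trans h2)

lemma lintegral_le_of_dI (n : ℕ) (u v : ℝ → ℝ≥0∞)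
    (h : ∀ x, ∫⁻ y in dI n x, u y ≤ ∫⁻ y in dI n x, v y) : ∫⁻ y, u y ≤ ∫⁻ y, v y := by
  rw [lintegral_tsum_dI n, lintegral_tsum_dI n]
  exact ENNReal.tsum_le_tsum fun q => h _

lemma lintegral_eq_of_dI (n : ℕ) (u v : ℝ → ℝ≥0∞)
    (h : ∀ x, ∫⁻ y in dI n x, u y = ∫⁻ y in dI n x, v y) : ∫⁻ y, u y = ∫⁻ y, v y := by
  rw [lintegral_tsum_dI n, lintegral_tsum_dI n]
  exact tsum_congr fun q => h _

lemma setLIntegral_dI_eq (n : ℕ) (x : ℝ) (u : ℝ → ℝ≥0∞) :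
    ∫⁻ y in dI n x, u y = (2^n)⁻¹ * EE n u x := by
  rw [EE, ← mul_assoc, mul_comm _ (2^n : ℝ≥0∞), two_pow_mul_inv, one_mul]

lemma setLIntegral_Lev (n : ℕ) (x : ℝ) {φ : ℝ → ℝ≥0∞} (h : Lev n φ) :
    ∫⁻ y in dI n x, φ y = (2^n)⁻¹ * φ x := by
  have : ∫⁻ y in dI n x, φ y = ∫⁻ y in dI n x, φ x :=
    setLIntegral_congr_fun (measurableSet_dI _ _) (fun y hy => h x y hy)
  rw [this, setLIntegral_const, volume_dI, mul_comm]

lemma EE_of_Lev (n : ℕ) {φ : ℝ → ℝ≥0∞} (h : Lev n φ) : EE n φ = φ := by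
  ext x
  rw [EE, setLIntegral_Lev n x h, ← mul_assoc, two_pow_mul_inv, one_mul]

lemma lintegral_Lev_mul (n : ℕ) {φ u : ℝ → ℝ≥0∞} (h : Lev n φ) (hu : AEMeasurable u) :
    ∫⁻ y, φ y * u y = ∫⁻ y, φ y * EE n u y := by
  apply lintegral_eq_of_dI n
  intro x
  have h1 : ∫⁻ y in dI n x, φ y * u y = ∫⁻ y in dI n x, φ x * u y :=
    setLIntegral_congr_fun (measurableSet_dI _ _) (fun y hy => by
      simp only [h x y hy])
  have h2 : Lev n (fun y => φ y * EE n u y) := by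
    intro a b hab; simp only [h a b hab, Lev.EE a b hab]
  rw [h1, lintegral_const_mul'' _ hu.restrict, setLIntegral_Lev n x h2, setLIntegral_dI_eq]
  ring

lemma setLIntegral_EE {n m : ℕ} (hnm : n ≤ m) (x : ℝ) {u : ℝ → ℝ≥0∞} (hu : AEMeasurable u) :
    ∫⁻ y in dI n x, EE m u y = ∫⁻ y in dI n x, u y := by
  rw [← lintegral_indicator (measurableSet_dI _ _), ← lintegral_indicator (measurableSet_dI _ _)]
  have hL : Lev m ((dI n x).indicator (fun _ => (1:ℝ≥0∞))) := by
    intro a b hab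
    have := (Lev.dI (n := n) (x := x)).mono hnm a b hab
    have h2 : b ∈ dI n x ↔ a ∈ dI n x := Eq.to_iff this
    by_cases hb : a ∈ dI n x
    · simp [hb, h2.2 hb]
    · simp [hb, mt h2.1 hb]
  have := lintegral_Lev_mul m hL hu
  have e : ∀ v : ℝ → ℝ≥0∞, (dI n x).indicator v
      = fun y => (dI n x).indicator (fun _ => (1:ℝ≥0∞)) y * v y := by
    intro v; ext y; by_cases hy : y ∈ dI n x <;> simp [hy]
  rw [e (EE m u), e u]; exact this.symm

lemma EE_EE {n m : ℕ} (hnm : n ≤ m) {u : ℝ → ℝ≥0∞} (hu : AEMeasurable u) :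
    EE n (EE m u) = EE n u := by
  ext x; rw [EE, setLIntegral_EE hnm x hu, EE]

lemma EE_mono (n : ℕ) {u v : ℝ → ℝ≥0∞} (h : ∀ x, u x ≤ v x) (x : ℝ) : EE n u x ≤ EE n v x := by
  rw [EE, EE]; gcongr; exact h _

lemma EE_succ_le (n : ℕ) (u : ℝ → ℝ≥0∞) (x : ℝ) : EE (n+1) u x ≤ 2 * EE n u x := by
  rw [EE, EE, pow_succ, mul_comm _ (2:ℝ≥0∞), mul_assoc]
  gcongr
  exact dI_succ_subset _ _

lemma EE_le_pow (n m : ℕ) (h : n ≤ m) (u : ℝ → ℝ≥0∞) (x : ℝ) :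
    EE m u x ≤ 2^(m-n) * EE n u x := by
  rw [EE, EE, ← mul_assoc, ← pow_add, Nat.sub_add_cancel h]
  gcongr
  exact dI_mono h _

lemma EE_le_of_le (n : ℕ) (u : ℝ → ℝ≥0∞) (x : ℝ) (c : ℝ≥0∞) (h : ∀ y ∈ dI n x, u y ≤ c) :
    EE n u x ≤ c := by
  rw [EE]
  calc 2^n * ∫⁻ y in dI n x, u y ≤ 2^n * ∫⁻ y in dI n x, c := by
        gcongr 2^n * ?_
        exact setLIntegral_mono' (measurableSet_dI _ _) h
    _ = c := by
        rw [setLIntegral_const, volume_dI, mul_comm c, ← mul_assoc, two_pow_mul_inv, one_mul]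

def Mx (N : ℕ) (u : ℝ → ℝ≥0∞) (x : ℝ) : ℝ≥0∞ := (Finset.range (N+1)).sup (fun n => EE n u x)

lemma EE_le_Mx {n N : ℕ} (h : n ≤ N) (u : ℝ → ℝ≥0∞) (x : ℝ) : EE n u x ≤ Mx N u x :=
  Finset.le_sup (f := fun n => EE n u x) (Finset.mem_range.2 (Nat.lt_succ_of_le h))

lemma Mx_le {N : ℕ} {u : ℝ → ℝ≥0∞} {x : ℝ} {c : ℝ≥0∞} (h : ∀ n ≤ N, EE n u x ≤ c) :
    Mx N u x ≤ c :=
  Finset.sup_le fun n hn => h n (Nat.le_of_lt_succ (Finset.mem_range.1 hn))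

lemma Lev.Mx {N : ℕ} {u : ℝ → ℝ≥0∞} : Lev N (Mx N u) := by
  intro a b h
  unfold _root_.Mx
  apply Finset.sup_congr rfl
  intro n hn
  exact (Lev.EE (n := n)).mono (Nat.le_of_lt_succ (Finset.mem_range.1 hn)) a b h

lemma le_Mx {N : ℕ} {u : ℝ → ℝ≥0∞} (h : Lev N u) (x : ℝ) : u x ≤ Mx N u x := by
  have := EE_le_Mx (le_refl N) u x
  rwa [EE_of_Lev N h] at this

lemma Mx_mono_n {n N : ℕ} (h : n ≤ N) (u : ℝ → ℝ≥0∞) (x : ℝ) : Mx n u x ≤ Mx N u x :=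
  Mx_le fun _ hk => EE_le_Mx (hk.trans h) u x

lemma Lev.ind {N : ℕ} {U : ℝ → ℝ≥0∞} (hU : Lev N U) (t : ℝ≥0∞) (f : ℝ → ℝ≥0∞) (hf : Lev N f) :
    Lev N (fun y => if t ≤ U y then f y else 0) := by
  intro a b h
  simp only [hU a b h, hf a b h]

lemma weak_rev {N : ℕ} {U : ℝ → ℝ≥0∞} (hU : Lev N U) (t : ℝ≥0∞) :
    ∀ d n, n + d = N → ∀ x, EE n U x ≤ 2 * t →
      ∫⁻ y in dI n x, (if t ≤ U y then U y else 0) ≤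
        2 * t * ∫⁻ y in dI n x, (if t ≤ Mx N U y then 1 else 0) := by
  intro d
  induction d with
  | zero =>
    intro n hn x hx
    obtain rfl : n = N := by omega
    rw [setLIntegral_Lev n x (hU.ind t U hU),
      setLIntegral_Lev n x ((Lev.Mx (N := n) (u := U)).ind t (fun _ => 1) (fun _ _ _ => rfl))]
    rw [EE_of_Lev n hU] at hx
    by_cases h : t ≤ U x
    · have h2 : t ≤ Mx n U x := h.trans (le_Mx hU x)
      simp only [h, h2, if_true]
      rw [mul_one, mul_comm]
      gcongr
    · simp [h]
  | succ d ih =>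
    intro n hn x hx
    by_cases h : t ≤ EE n U x
    · have h2 : ∀ y ∈ dI n x, t ≤ Mx N U y := by
        intro y hy
        refine h.trans ?_
        rw [← Lev.EE x y hy]
        exact EE_le_Mx (by omega) U y
      have e : ∫⁻ y in dI n x, (if t ≤ Mx N U y then (1:ℝ≥0∞) else 0) = ∫⁻ y in dI n x, 1 :=
        setLIntegral_congr_fun (measurableSet_dI _ _) (fun y hy => by simp [h2 y hy])
      rw [e, setLIntegral_const, volume_dI, one_mul]
      calc ∫⁻ y in dI n x, (if t ≤ U y then U y else 0) ≤ ∫⁻ y in dI n x, U y := by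
            apply lintegral_mono; intro y; dsimp only; split_ifs <;> simp
        _ = (2^n)⁻¹ * EE n U x := setLIntegral_dI_eq _ _ _
        _ ≤ _ := by rw [mul_comm]; gcongr
    · push Not at h
      have hc : ∀ z ∈ dI n x, EE (n+1) U z ≤ 2 * t := by
        intro z hz
        refine (EE_succ_le n U z).trans ?_
        rw [Lev.EE x z hz]
        gcongr
      rw [lintegral_split, lintegral_split n x (fun y => if t ≤ Mx N U y then (1:ℝ≥0∞) else 0), mul_add]
      exact add_le_add (ih (n+1) (by omega) _ (hc _ (xl_mem n x)))
        (ih (n+1) (by omega) _ (hc _ (xr_mem n x)))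

lemma geom_sum (lam : ℝ≥0∞) (K : ℕ) : ∑ p ∈ Finset.range K, 2^p * lam ≤ 2^K * lam := by
  induction K with
  | zero => simp
  | succ K ih =>
    rw [Finset.sum_range_succ, pow_succ, mul_two, add_mul]
    gcongr

lemma layer1 (lam y : ℝ≥0∞) : ∑' p : ℕ, (if 2^p * lam ≤ y then 2^p * lam else 0) ≤ 2 * y := by
  apply ENNReal.tsum_le_of_sum_range_le
  intro K
  induction K with
  | zero => simp
  | succ K ih =>
    rw [Finset.sum_range_succ]
    split_ifs with h
    · calc _ ≤ ∑ p ∈ Finset.range K, 2^p * lam + 2^K * lam := by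
            gcongr with p hp
            split_ifs <;> simp
        _ ≤ 2^K * lam + 2^K * lam := by gcongr; exact geom_sum lam K
        _ ≤ y + y := by gcongr
        _ = 2 * y := (two_mul y).symm
    · simpa using ih

lemma layer2 (lam y : ℝ≥0∞) :
    ∑' p : ℕ, (2 * p + 1 : ℝ≥0∞) * (if 2^p * lam ≤ y then 2^p * lam else 0) ≤
      4 * ∑' p : ℕ, (if 2^p * lam ≤ y then y else 0) := by
  have key : ∀ K : ℕ, ∑ p ∈ Finset.range K,
      (2 * p + 1 : ℝ≥0∞) * (if 2^p * lam ≤ y then 2^p * lam else 0) ≤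
      4 * ∑ p ∈ Finset.range K, (if 2^p * lam ≤ y then y else 0) := by
    intro K
    induction K with
    | zero => simp
    | succ K ih =>
      by_cases h : 2^K * lam ≤ y
      · have hp : ∀ p ∈ Finset.range (K+1), 2^p * lam ≤ y := by
          intro p hp
          refine le_trans ?_ h
          gcongr
          · norm_num
          · exact Nat.le_of_lt_succ (Finset.mem_range.1 hp)
        calc _ ≤ ∑ p ∈ Finset.range (K+1), (2 * K + 1 : ℝ≥0∞) * (2^p * lam) := by
              apply Finset.sum_le_sum
              intro p hp'
              have : p ≤ K := Nat.le_of_lt_succ (Finset.mem_range.1 hp')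
              rw [if_pos (hp p hp')]
              gcongr
          _ = (2 * K + 1 : ℝ≥0∞) * ∑ p ∈ Finset.range (K+1), (2^p * lam) := by
              rw [Finset.mul_sum]
          _ ≤ (2 * K + 1 : ℝ≥0∞) * (2^(K+1) * lam) := by gcongr; exact geom_sum _ _
          _ = (2 * (2 * K + 1) : ℝ≥0∞) * (2^K * lam) := by ring
          _ ≤ (4 * (K + 1) : ℝ≥0∞) * y := by
              have h3 : (2 * (2 * K + 1) : ℝ≥0∞) ≤ 4 * (K + 1) := by
                have : (2 * (2 * K + 1) : ℝ≥0∞) = 4 * K + 2 := by ring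
                rw [this, mul_add]
                gcongr; norm_num
              exact mul_le_mul' h3 h
          _ = 4 * ∑ p ∈ Finset.range (K+1), (if 2^p * lam ≤ y then y else 0) := by
              rw [Finset.sum_congr rfl (fun p hp' => if_pos (hp p hp'))]
              simp [mul_assoc]
      · rw [Finset.sum_range_succ, Finset.sum_range_succ]
        simpa [h] using ih
  apply ENNReal.tsum_le_of_sum_range_le
  intro K
  refine (key K).trans ?_
  gcongr
  exact ENNReal.sum_le_tsum _

lemma llog {N n : ℕ} (hn : n ≤ N) {W : ℝ → ℝ≥0∞} (hW : Lev N W) (lam : ℝ≥0∞) (x : ℝ)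
    (h : EE n (Mx N (Mx N W)) x ≤ lam) :
    EE n (fun y => ∑' p : ℕ, (2 * p + 1 : ℝ≥0∞) * (if 2^p * lam ≤ W y then W y else 0)) x
      ≤ 32 * lam := by
  have hM : Lev N (Mx N W) := Lev.Mx
  have hMM : Lev N (Mx N (Mx N W)) := Lev.Mx
  have h1 : EE n (Mx N W) x ≤ lam := (EE_mono n (le_Mx hM) x).trans h
  have h0 : EE n W x ≤ lam := (EE_mono n (le_Mx hW) x).trans h1
  have hp : ∀ p : ℕ, lam ≤ 2 * (2^p * lam) := by
    intro p
    calc lam = 1 * (1 * lam) := by simp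
      _ ≤ 2 * (2^p * lam) := by
        gcongr
        · norm_num
        · exact one_le_pow₀ (by norm_num)
  have meas : ∀ {U V : ℝ → ℝ≥0∞}, Lev N U → Lev N V → ∀ (t c : ℝ≥0∞),
      Measurable (fun y => c * (if t ≤ U y then V y else 0)) := by
    intro U V hU hV t c
    exact (hU.ind t V hV).measurable.const_mul c
  have step1 : ∫⁻ y in dI n x, ∑' p : ℕ, (2 * p + 1 : ℝ≥0∞) * (if 2^p * lam ≤ W y then W y else 0)
      ≤ ∫⁻ y in dI n x, 8 * ∑' p : ℕ, (if 2^p * lam ≤ Mx N W y then Mx N W y else 0) := by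
    rw [lintegral_tsum (fun p => (meas hW hW _ _).aemeasurable)]
    calc _ ≤ ∑' p : ℕ, ∫⁻ y in dI n x, (2 * p + 1 : ℝ≥0∞) * (2 * (2^p * lam)) *
              (if 2^p * lam ≤ Mx N W y then 1 else 0) := by
          apply ENNReal.tsum_le_tsum
          intro p
          rw [lintegral_const_mul _ (hW.ind _ W hW).measurable,
            lintegral_const_mul _ (hM.ind _ (fun _ => (1:ℝ≥0∞)) (fun _ _ _ => rfl)).measurable, mul_assoc]
          gcongr
          exact weak_rev hW _ (N - n) n (by omega) x (h0.trans (hp p))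
      _ = ∫⁻ y in dI n x, ∑' p : ℕ, (2 * p + 1 : ℝ≥0∞) * (2 * (2^p * lam)) *
              (if 2^p * lam ≤ Mx N W y then 1 else 0) :=
          (lintegral_tsum (fun p => (meas hM (fun _ _ _ => rfl) _ _).aemeasurable)).symm
      _ ≤ _ := by
          apply lintegral_mono
          intro y
          have := layer2 lam (Mx N W y)
          calc _ = 2 * ∑' p : ℕ, (2 * p + 1 : ℝ≥0∞) *
                  (if 2^p * lam ≤ Mx N W y then 2^p * lam else 0) := by
                rw [← ENNReal.tsum_mul_left]
                apply tsum_congr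
                intro p
                split_ifs <;> ring
            _ ≤ 2 * (4 * ∑' p : ℕ, (if 2^p * lam ≤ Mx N W y then Mx N W y else 0)) := by gcongr
            _ = _ := by ring
  have step2 : ∫⁻ y in dI n x, 8 * ∑' p : ℕ, (if 2^p * lam ≤ Mx N W y then Mx N W y else 0)
      ≤ ∫⁻ y in dI n x, 32 * Mx N (Mx N W) y := by
    rw [lintegral_const_mul _ (Measurable.tsum (fun p => (hM.ind _ _ hM).measurable)),
      lintegral_tsum (fun p => (hM.ind _ _ hM).measurable.aemeasurable)]
    calc _ ≤ 8 * ∑' p : ℕ, ∫⁻ y in dI n x, (2 * (2^p * lam)) *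
              (if 2^p * lam ≤ Mx N (Mx N W) y then 1 else 0) := by
          gcongr 8 * ?_
          apply ENNReal.tsum_le_tsum
          intro p
          rw [lintegral_const_mul _ (hMM.ind _ (fun _ => (1:ℝ≥0∞)) (fun _ _ _ => rfl)).measurable]
          exact weak_rev hM _ (N - n) n (by omega) x (h1.trans (hp p))
      _ = 8 * ∫⁻ y in dI n x, ∑' p : ℕ, (2 * (2^p * lam)) *
              (if 2^p * lam ≤ Mx N (Mx N W) y then 1 else 0) := by
          rw [lintegral_tsum (fun p => (meas hMM (fun _ _ _ => rfl) _ _).aemeasurable)]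
      _ ≤ 8 * ∫⁻ y in dI n x, 4 * Mx N (Mx N W) y := by
          gcongr with y
          have := layer1 lam (Mx N (Mx N W) y)
          calc _ = 2 * ∑' p : ℕ, (if 2^p * lam ≤ Mx N (Mx N W) y then 2^p * lam else 0) := by
                rw [← ENNReal.tsum_mul_left]
                apply tsum_congr
                intro p
                split_ifs <;> ring
            _ ≤ 2 * (2 * Mx N (Mx N W) y) := by gcongr
            _ = _ := by ring
      _ = _ := by
          rw [lintegral_const_mul _ hMM.measurable, lintegral_const_mul _ hMM.measurable]; ring
  rw [EE]
  calc _ ≤ 2^n * ∫⁻ y in dI n x, 32 * Mx N (Mx N W) y := by gcongr 2^n * ?_; exact step1.trans step2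
    _ = 32 * EE n (Mx N (Mx N W)) x := by
        rw [lintegral_const_mul _ hMM.measurable, EE]; ring
    _ ≤ _ := by gcongr

/-- Cauchy–Schwarz weights -/
def cZ : ℝ := ∑' p : ℤ, ((1 + |(p:ℝ)|)^2)⁻¹

lemma summable_cZ : Summable (fun p : ℤ => ((1 + |(p:ℝ)|)^2)⁻¹) := by
  have h : Summable (fun p : ℕ => ((1 + (p:ℝ))^2)⁻¹) := by
    have := (summable_nat_add_iff 1).2 (Real.summable_nat_pow_inv (p := 2) |>.2 (by norm_num))
    refine this.congr ?_
    intro p; push_cast; ring_nf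
  apply Summable.of_nat_of_neg
  · simpa using h
  · simpa using h

lemma cZ_pos : 0 < cZ := by
  have := summable_cZ.sum_le_tsum {0} (fun i _ => by positivity)
  simp at this
  unfold cZ
  linarith

lemma CS {ι : Type*} (S : Finset ι) (z : ι → ℂ) (idx : ι → ℤ) (hinj : Set.InjOn idx S) (j : ℤ) :
    ‖∑ i ∈ S, z i‖ₑ^2 ≤ ENNReal.ofReal cZ *
      ∑ i ∈ S, ENNReal.ofReal ((1 + |((idx i - j : ℤ) : ℝ)|)^2) * ‖z i‖ₑ^2 := by
  have h1 : ‖∑ i ∈ S, z i‖^2 ≤ cZ * ∑ i ∈ S, (1 + |((idx i - j : ℤ) : ℝ)|)^2 * ‖z i‖^2 := by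
    calc ‖∑ i ∈ S, z i‖^2 ≤ (∑ i ∈ S, ‖z i‖)^2 := by gcongr; exact norm_sum_le _ _
      _ ≤ (∑ i ∈ S, ((1 + |((idx i - j : ℤ) : ℝ)|)^2)⁻¹) *
            ∑ i ∈ S, (1 + |((idx i - j : ℤ) : ℝ)|)^2 * ‖z i‖^2 := by
          apply Finset.sum_sq_le_sum_mul_sum_of_sq_le_mul
          · intro i _; positivity
          · intro i _; positivity
          · intro i _
            have : (1 + |((idx i - j : ℤ) : ℝ)|)^2 ≠ 0 := by positivity
            apply le_of_eq
            field_simp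
      _ ≤ _ := by
          gcongr
          have hinj' : Set.InjOn (fun i => idx i - j) S := by
            intro a ha b hb hab
            exact hinj ha hb (by simpa using hab)
          have := Finset.sum_image (s := S) (g := fun i => idx i - j)
            (f := fun p : ℤ => ((1 + |(p:ℝ)|)^2)⁻¹) hinj'
          rw [← this]
          exact summable_cZ.sum_le_tsum _ (fun i _ => by positivity)
  have e : ∀ w : ℂ, ‖w‖ₑ^2 = ENNReal.ofReal (‖w‖^2) := by
    intro w; rw [ENNReal.ofReal_pow (norm_nonneg _), ofReal_norm]
  simp only [e]
  calc _ ≤ _ := ENNReal.ofReal_le_ofReal h1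
    _ = _ := by
      rw [ENNReal.ofReal_mul cZ_pos.le, ENNReal.ofReal_sum_of_nonneg (fun i _ => by positivity)]
      congr 1
      apply Finset.sum_congr rfl
      intro i _
      rw [ENNReal.ofReal_mul (by positivity)]

def DD (G : ℝ → ℂ) : ℕ → ℝ → ℂ
  | 0 => EG 0 G
  | (n+1) => fun x => EG (n+1) G x - EG n G x

lemma Lev.DD {G : ℝ → ℂ} : ∀ {n : ℕ}, Lev n (DD G n)
  | 0 => Lev.EG
  | (n+1) => fun a b h => by
      simp only [_root_.DD]
      rw [Lev.EG a b h, (Lev.EG (n := n)).succ a b h]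

lemma EG_split {G : ℝ → ℂ} (hG : LocallyIntegrable G) (n : ℕ) (x : ℝ) :
    EG n G x = (EG (n+1) G (xl n x) + EG (n+1) G (xr n x)) / 2 := by
  have hi : ∀ m y, IntegrableOn G (dI m y) := by
    intro m y
    refine (hG.integrableOn_isCompact (k := Icc ((⌊(2:ℝ)^m * y⌋ : ℝ) / 2^m)
      ((⌊(2:ℝ)^m * y⌋ + 1 : ℝ) / 2^m)) isCompact_Icc).mono_set ?_
    rw [dI_eq_Ico]; exact Ico_subset_Icc_self
  simp only [EG]
  rw [dI_split n x, setIntegral_union (dI_disj _ _) (measurableSet_dI _ _) (hi _ _) (hi _ _)]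
  ring

def th (v : ℝ → ℝ≥0∞) (lam : ℝ≥0∞) (n : ℕ) (x : ℝ) : Prop := lam ≤ Mx n v x ∧ Mx n v x < 2 * lam

lemma Lev.th {v : ℝ → ℝ≥0∞} {lam : ℝ≥0∞} {n : ℕ} : Lev n (th v lam n) := by
  intro a b h
  simp only [_root_.th]
  rw [Lev.Mx a b h]

open Classical in
def HH (G : ℝ → ℂ) (v : ℝ → ℝ≥0∞) (lam : ℝ≥0∞) : ℕ → ℝ → ℂ
  | 0 => fun x => if th v lam 0 x then DD G 0 x else 0
  | (n+1) => fun x => HH G v lam n x + if th v lam n x then DD G (n+1) x else 0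

lemma Lev.HH {G : ℝ → ℂ} {v : ℝ → ℝ≥0∞} {lam : ℝ≥0∞} : ∀ {n : ℕ}, Lev n (HH G v lam n)
  | 0 => fun a b h => by
      simp only [_root_.HH]
      rw [Lev.th a b h, Lev.DD a b h]
  | (n+1) => fun a b h => by
      have ih := (Lev.HH (G := G) (v := v) (lam := lam) (n := n)).succ a b h
      have ih2 := (Lev.th (v := v) (lam := lam) (n := n)).succ a b h
      have ih3 := (Lev.DD (G := G) (n := n+1)) a b h
      simp only [_root_.HH]
      rw [ih, ih2, ih3]

lemma enorm_sq_eq (w : ℂ) : ‖w‖ₑ^2 = ENNReal.ofReal (‖w‖^2) := by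
  rw [ENNReal.ofReal_pow (norm_nonneg _), ofReal_norm]

lemma par_id (t d : ℂ) : ‖t + d‖ₑ^2 + ‖t + -d‖ₑ^2 = (‖t‖ₑ^2 + ‖d‖ₑ^2) + (‖t‖ₑ^2 + ‖-d‖ₑ^2) := by
  simp only [enorm_sq_eq]
  rw [← ENNReal.ofReal_add (by positivity) (by positivity), ← ENNReal.ofReal_add (by positivity) (by positivity),
    ← ENNReal.ofReal_add (by positivity) (by positivity), ← ENNReal.ofReal_add (by positivity) (by positivity)]
  congr 1
  have := parallelogram_law_with_norm ℝ t d
  rw [norm_neg, ← sub_eq_add_neg]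
  nlinarith

open Classical in
lemma HH_orth {G : ℝ → ℂ} (hG : LocallyIntegrable G) (v : ℝ → ℝ≥0∞) (lam : ℝ≥0∞) (n : ℕ) :
    ∫⁻ x, ‖HH G v lam (n+1) x‖ₑ^2 = (∫⁻ x, ‖HH G v lam n x‖ₑ^2) +
      ∫⁻ x, (if th v lam n x then ‖DD G (n+1) x‖ₑ^2 else 0) := by
  have hm1 : Lev n (fun x => ‖HH G v lam n x‖ₑ^2) := fun a b h => by
    simp only [(Lev.HH (n := n)) a b h]
  have hm2 : Lev (n+1) (fun x => if th v lam n x then ‖DD G (n+1) x‖ₑ^2 else 0) := fun a b h => by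
    simp only [(Lev.DD (n := n+1)) a b h, (Lev.th (n := n)).succ a b h]
  have hm3 : Lev (n+1) (fun x => ‖HH G v lam (n+1) x‖ₑ^2) := fun a b h => by
    simp only [(Lev.HH (n := n+1)) a b h]
  rw [← lintegral_add_left hm1.measurable]
  apply lintegral_eq_of_dI n
  intro x
  have hm4 : Lev (n+1) (fun x => ‖HH G v lam n x‖ₑ^2 +
      if th v lam n x then ‖DD G (n+1) x‖ₑ^2 else 0) := fun a b h => by
    have e1 := hm1.succ a b h
    have e2 := hm2 a b h
    simp only at e1 e2 ⊢
    rw [e1, e2]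
  rw [lintegral_split, lintegral_split n x (fun x => ‖HH G v lam n x‖ₑ^2 +
      if th v lam n x then ‖DD G (n+1) x‖ₑ^2 else 0), setLIntegral_Lev _ _ hm3,
      setLIntegral_Lev _ _ hm3, setLIntegral_Lev _ _ hm4, setLIntegral_Lev _ _ hm4,
      ← mul_add, ← mul_add]
  congr 1
  have tl := Lev.th (v := v) (lam := lam) (n := n) x (xl n x) (xl_mem n x)
  have tr := Lev.th (v := v) (lam := lam) (n := n) x (xr n x) (xr_mem n x)
  have hl := Lev.HH (G := G) (v := v) (lam := lam) (n := n) x (xl n x) (xl_mem n x)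
  have hr := Lev.HH (G := G) (v := v) (lam := lam) (n := n) x (xr n x) (xr_mem n x)
  have dd : DD G (n+1) (xr n x) = - DD G (n+1) (xl n x) := by
    simp only [DD]
    rw [Lev.EG (n := n) x (xl n x) (xl_mem n x), Lev.EG (n := n) x (xr n x) (xr_mem n x),
      EG_split hG n x]
    ring
  simp only [HH, tl, tr, hl, hr, dd]
  split_ifs
  · exact par_id _ _
  · simp

open Classical in
lemma HH_total {G : ℝ → ℂ} (hG : LocallyIntegrable G) (v : ℝ → ℝ≥0∞) (lam : ℝ≥0∞) (N : ℕ) :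
    ∫⁻ x, ‖HH G v lam N x‖ₑ^2 = ∑ n ∈ Finset.range (N+1),
      ∫⁻ x, (if th v lam (n-1) x then ‖DD G n x‖ₑ^2 else 0) := by
  induction N with
  | zero =>
    simp only [zero_add, Finset.sum_range_one]
    apply lintegral_congr
    intro x
    simp only [HH]
    split_ifs <;> simp_all
  | succ N ih =>
    rw [HH_orth hG, ih, Finset.sum_range_succ _ (N+1)]
    simp

lemma HH_frozen {G : ℝ → ℂ} {v : ℝ → ℝ≥0∞} {lam : ℝ≥0∞} {n : ℕ} {x : ℝ}
    (h : 2 * lam ≤ Mx n v x) {m : ℕ} (hm : n ≤ m) : HH G v lam m x = HH G v lam n x := by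
  induction hm with
  | refl => rfl
  | @step m hm ih =>
    have : ¬ th v lam m x := fun h' => absurd (h.trans (Mx_mono_n hm v x)) (not_le.2 h'.2)
    simp only [HH, ih, if_neg this, add_zero]

lemma HH_key {G : ℝ → ℂ} {v u : ℝ → ℝ≥0∞} {lam K : ℝ≥0∞} {N : ℕ} (hu : Lev N u)
    (huK : ∀ n ≤ N, ∀ x, EE n v x ≤ 4 * lam → EE n u x ≤ K) :
    ∀ d n, n + d = N → ∀ x, EE n v x ≤ 4 * lam →
      ∫⁻ y in dI n x, ‖HH G v lam N y‖ₑ^2 * u y ≤ K * ∫⁻ y in dI n x, ‖HH G v lam N y‖ₑ^2 := by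
  have cst : ∀ n ≤ N, ∀ x, EE n v x ≤ 4 * lam → (∀ y ∈ dI n x, HH G v lam N y = HH G v lam n x) →
      ∫⁻ y in dI n x, ‖HH G v lam N y‖ₑ^2 * u y ≤ K * ∫⁻ y in dI n x, ‖HH G v lam N y‖ₑ^2 := by
    intro n hn x hx hc
    have e1 : ∫⁻ y in dI n x, ‖HH G v lam N y‖ₑ^2 * u y = ∫⁻ y in dI n x, ‖HH G v lam n x‖ₑ^2 * u y :=
      setLIntegral_congr_fun (measurableSet_dI _ _) (fun y hy => by simp only [hc y hy])
    have e2 : ∫⁻ y in dI n x, ‖HH G v lam N y‖ₑ^2 = ∫⁻ y in dI n x, ‖HH G v lam n x‖ₑ^2 :=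
      setLIntegral_congr_fun (measurableSet_dI _ _) (fun y hy => by simp only [hc y hy])
    rw [e1, e2, lintegral_const_mul _ hu.measurable, setLIntegral_const, volume_dI,
      setLIntegral_dI_eq]
    calc _ ≤ ‖HH G v lam n x‖ₑ^2 * ((2^n)⁻¹ * K) := by gcongr; exact huK n hn x hx
      _ = _ := by ring
  intro d
  induction d with
  | zero =>
    intro n hn x hx
    obtain rfl : n = N := by omega
    exact cst n le_rfl x hx (fun y hy => Lev.HH x y hy)
  | succ d ih =>
    intro n hn x hx
    by_cases h : 2 * lam ≤ Mx n v x
    · apply cst n (by omega) x hx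
      intro y hy
      rw [HH_frozen (n := n) (by rwa [Lev.Mx x y hy]) (by omega)]
      exact Lev.HH x y hy
    · push Not at h
      have hc : ∀ z ∈ dI n x, EE (n+1) v z ≤ 4 * lam := by
        intro z hz
        refine (EE_succ_le n v z).trans ?_
        rw [Lev.EE x z hz]
        calc 2 * EE n v x ≤ 2 * (2 * lam) := by
              gcongr; exact (EE_le_Mx le_rfl v x).trans h.le
          _ = _ := by rw [← mul_assoc]; norm_num
      rw [lintegral_split, lintegral_split n x (fun y => ‖HH G v lam N y‖ₑ^2), mul_add]
      exact add_le_add (ih (n+1) (by omega) _ (hc _ (xl_mem n x)))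
        (ih (n+1) (by omega) _ (hc _ (xr_mem n x)))

lemma HH_glob {G : ℝ → ℂ} {v u : ℝ → ℝ≥0∞} {lam K : ℝ≥0∞} {N : ℕ} (hu : Lev N u)
    (huK : ∀ n ≤ N, ∀ x, EE n v x ≤ 4 * lam → EE n u x ≤ K) :
    ∫⁻ y, ‖HH G v lam N y‖ₑ^2 * u y ≤ K * ∫⁻ y, ‖HH G v lam N y‖ₑ^2 := by
  have hm : Measurable (fun y => ‖HH G v lam N y‖ₑ^2) := (Lev.HH (n := N)).measurable.enorm.pow_const 2
  rw [← lintegral_const_mul _ hm]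
  apply lintegral_le_of_dI 0
  intro x
  by_cases h : EE 0 v x ≤ 4 * lam
  · rw [lintegral_const_mul _ hm]
    exact HH_key hu huK N 0 (by omega) x h
  · push Not at h
    have hz : ∀ y ∈ dI 0 x, ‖HH G v lam N y‖ₑ^2 * u y = 0 := by
      intro y hy
      have h2 : 2 * lam ≤ Mx 0 v y := by
        rw [Lev.Mx x y hy]
        refine le_trans ?_ (EE_le_Mx le_rfl v x)
        refine le_trans ?_ h.le
        gcongr; norm_num
      have : ¬ th v lam 0 y := fun h' => absurd h2 (not_le.2 h'.2)
      rw [HH_frozen (n := 0) h2 (by omega)]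
      simp [HH, this]
    rw [setLIntegral_congr_fun (measurableSet_dI _ _) hz]
    simp

/-- powers of two in `ℝ≥0∞` with integer exponent -/
def lz (i : ℤ) : ℝ≥0∞ := ENNReal.ofReal ((2:ℝ)^i)

lemma lz_succ (i : ℤ) : lz (i+1) = 2 * lz i := by
  rw [lz, lz, zpow_add₀ (by norm_num), zpow_one, mul_comm, ENNReal.ofReal_mul (by norm_num)]
  simp

lemma lz_mono {i j : ℤ} (h : i ≤ j) : lz i ≤ lz j :=
  ENNReal.ofReal_le_ofReal (zpow_le_zpow_right₀ (by norm_num) h)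

lemma lz_add_nat (i : ℤ) (p : ℕ) : lz (i + p) = 2^p * lz i := by
  induction p with
  | zero => simp
  | succ p ih =>
    have : i + ((p+1 : ℕ) : ℤ) = (i + p) + 1 := by push_cast; ring
    rw [this, lz_succ, ih, pow_succ]; ring

lemma lz_pos (i : ℤ) : 0 < lz i := ENNReal.ofReal_pos.2 (by positivity)

lemma lz_unique {y : ℝ≥0∞} {i j : ℤ} (hi : lz i ≤ y ∧ y < 2 * lz i) (hj : lz j ≤ y ∧ y < 2 * lz j) :
    i = j := by
  rw [← lz_succ] at hi hj
  by_contra hne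
  rcases lt_or_gt_of_ne hne with h | h
  · exact absurd (hi.2.trans_le ((lz_mono (by omega : i + 1 ≤ j)).trans hj.1)) (lt_irrefl _)
  · exact absurd (hj.2.trans_le ((lz_mono (by omega : j + 1 ≤ i)).trans hi.1)) (lt_irrefl _)

lemma lz_log {y : ℝ≥0∞} (h0 : y ≠ 0) (ht : y ≠ ∞) :
    lz (Int.log 2 y.toReal) ≤ y ∧ y < 2 * lz (Int.log 2 y.toReal) := by
  have hp : 0 < y.toReal := ENNReal.toReal_pos h0 ht
  have h1 := Int.zpow_log_le_self (b := 2) (by norm_num) hp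
  have h2 := Int.lt_zpow_succ_log_self (b := 2) (by norm_num) y.toReal
  rw [← lz_succ]
  constructor
  · exact ENNReal.ofReal_le_of_le_toReal (by exact_mod_cast h1)
  · exact (ENNReal.lt_ofReal_iff_toReal_lt ht).2 (by exact_mod_cast h2)

open Classical in
lemma tsum_lz_le (y : ℝ≥0∞) :
    ∑' i : ℤ, (if lz i ≤ y ∧ y < 2 * lz i then lz i else 0) ≤ y := by
  by_cases h : ∃ i, lz i ≤ y ∧ y < 2 * lz i
  · obtain ⟨i, hi⟩ := h
    rw [tsum_eq_single i, if_pos hi]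
    · exact hi.1
    · intro j hj
      exact if_neg fun hj' => hj (lz_unique hj' hi)
  · push Not at h
    have : ∀ i, (if lz i ≤ y ∧ y < 2 * lz i then lz i else 0) = 0 := fun i =>
      if_neg fun h' => absurd h'.2 (not_lt.2 (h i h'.1))
    simp [this]

lemma EE_add (n : ℕ) {f : ℝ → ℝ≥0∞} (hf : Measurable f) (g : ℝ → ℝ≥0∞) (x : ℝ) :
    EE n (fun y => f y + g y) x = EE n f x + EE n g x := by
  rw [EE, lintegral_add_left hf, mul_add, EE, EE]

lemma EE_const_mul (n : ℕ) (c : ℝ≥0∞) {f : ℝ → ℝ≥0∞} (hf : Measurable f) (x : ℝ) :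
    EE n (fun y => c * f y) x = c * EE n f x := by
  rw [EE, lintegral_const_mul _ hf, EE]; ring

lemma sq_le_two_pow (d : ℕ) : (1 + d)^2 ≤ 3 * 2^d := by
  induction d with
  | zero => norm_num
  | succ d ih =>
    rcases Nat.lt_or_ge d 2 with h | h
    · interval_cases d <;> norm_num
    · have : (1 + (d+1))^2 ≤ 2 * (1+d)^2 := by nlinarith
      calc _ ≤ 2 * (1+d)^2 := this
        _ ≤ 2 * (3 * 2^d) := by omega
        _ = _ := by ring

lemma sum_odd (e : ℕ) : ∑ p ∈ Finset.range e, (2 * p + 1 : ℝ≥0∞) = (e:ℝ≥0∞)^2 := by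
  induction e with
  | zero => simp
  | succ e ih => rw [Finset.sum_range_succ, ih]; push_cast; ring

def cw (W : ℝ → ℝ≥0∞) (i : ℤ) (x : ℝ) : ℝ≥0∞ :=
  ENNReal.ofReal ((1 + |((i - Int.log 2 (W x).toReal : ℤ) : ℝ)|)^2)

lemma cw_bound {W : ℝ → ℝ≥0∞} (i : ℤ) {x : ℝ} (ht : W x ≠ ∞) :
    cw W i x * W x ≤ 6 * lz i + 9 * (W x +
      ∑' p : ℕ, (2 * p + 1 : ℝ≥0∞) * (if 2^p * (4 * lz i) ≤ W x then W x else 0)) := by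
  by_cases h0 : W x = 0
  · simp [h0]
  obtain ⟨h1, h2⟩ := lz_log h0 ht
  unfold cw
  set j := Int.log 2 (W x).toReal
  rcases le_or_gt j i with h | h
  · refine le_trans ?_ le_self_add
    obtain ⟨d, hd⟩ := Int.eq_ofNat_of_zero_le (sub_nonneg.2 h)
    have hi : i = j + d := by omega
    rw [hd, hi, lz_add_nat]
    have e : ENNReal.ofReal ((1 + |(((d:ℕ):ℤ):ℝ)|)^2) = (((1+d)^2 : ℕ) : ℝ≥0∞) := by
      rw [Int.cast_natCast, abs_of_nonneg (by positivity), ← ENNReal.ofReal_natCast]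
      congr 1; push_cast; ring
    rw [e]
    calc (((1+d)^2 : ℕ) : ℝ≥0∞) * W x ≤ ((3 * 2^d : ℕ) : ℝ≥0∞) * (2 * lz j) := by
          gcongr
          exact_mod_cast sq_le_two_pow d
      _ = _ := by push_cast; ring
  · refine le_trans ?_ le_add_self
    obtain ⟨e, he⟩ := Int.eq_ofNat_of_zero_le (by omega : 0 ≤ j - i - 1)
    have hj : j = i + (e+1 : ℕ) := by push_cast; omega
    have e1 : ENNReal.ofReal ((1 + |((i - j : ℤ):ℝ)|)^2) = (((e+2)^2 : ℕ) : ℝ≥0∞) := by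
      rw [hj, ← ENNReal.ofReal_natCast]
      congr 1
      push_cast
      rw [show (i:ℝ) - (i + (e+1)) = -(e+1) by ring, abs_neg, abs_of_nonneg (by positivity)]
      ring
    have e2 : (e:ℝ≥0∞)^2 * W x ≤
        ∑' p : ℕ, (2 * p + 1 : ℝ≥0∞) * (if 2^p * (4 * lz i) ≤ W x then W x else 0) := by
      refine le_trans ?_ (ENNReal.sum_le_tsum (Finset.range e))
      rw [← sum_odd, Finset.sum_mul]
      apply Finset.sum_le_sum
      intro p hp
      rw [if_pos]
      refine le_trans ?_ h1
      rw [hj, lz_add_nat]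
      calc (2:ℝ≥0∞)^p * (4 * lz i) = 2^(p+2) * lz i := by rw [pow_add]; ring
        _ ≤ 2^(e+1) * lz i := by
          gcongr 2^?_ * _
          · norm_num
          · have := Finset.mem_range.1 hp; omega
    rw [e1]
    calc (((e+2)^2 : ℕ) : ℝ≥0∞) * W x ≤ ((9 * (1 + e^2) : ℕ) : ℝ≥0∞) * W x := by
          gcongr
          nlinarith [sq_nonneg ((e:ℤ) - 1)]
      _ = 9 * (W x + (e:ℝ≥0∞)^2 * W x) := by push_cast; ring
      _ ≤ _ := by gcongr

lemma cw_EE {N n : ℕ} (hn : n ≤ N) {W : ℝ → ℝ≥0∞} (hW : Lev N W) (ht : ∀ x, W x ≠ ∞) (i : ℤ) (x : ℝ)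
    (h : EE n (Mx N (Mx N W)) x ≤ 4 * lz i) :
    EE n (fun y => cw W i y * W y) x ≤ 1200 * lz i := by
  have hM : Lev N (Mx N W) := Lev.Mx
  have h1 : EE n (Mx N W) x ≤ 4 * lz i := (EE_mono n (le_Mx hM) x).trans h
  have h0 : EE n W x ≤ 4 * lz i := (EE_mono n (le_Mx hW) x).trans h1
  have hl := llog hn hW (4 * lz i) x h
  have hmt : Measurable (fun y => ∑' p : ℕ, (2 * p + 1 : ℝ≥0∞) * (if 2^p * (4 * lz i) ≤ W y then W y else 0)) :=
    Measurable.tsum fun p => ((hW.ind _ W hW).measurable.const_mul _)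
  have hmm : Measurable (fun y => W y + ∑' p : ℕ, (2 * p + 1 : ℝ≥0∞) *
      (if 2^p * (4 * lz i) ≤ W y then W y else 0)) := hW.measurable.add hmt
  calc _ ≤ EE n (fun y => 6 * lz i + 9 * (W y +
      ∑' p : ℕ, (2 * p + 1 : ℝ≥0∞) * (if 2^p * (4 * lz i) ≤ W y then W y else 0))) x :=
        EE_mono n (fun y => cw_bound i (ht y)) x
    _ = EE n (fun _ => 6 * lz i) x + 9 * (EE n W x + EE n (fun y =>
      ∑' p : ℕ, (2 * p + 1 : ℝ≥0∞) * (if 2^p * (4 * lz i) ≤ W y then W y else 0)) x) := by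
        rw [EE_add n measurable_const, EE_const_mul n _ hmm, EE_add n hW.measurable]
    _ ≤ 6 * lz i + 9 * (4 * lz i + 32 * (4 * lz i)) := by
        gcongr
        exact EE_le_of_le _ _ _ _ (fun y _ => le_rfl)
    _ = 1194 * lz i := by ring
    _ ≤ _ := by gcongr; norm_num

lemma EE_Mx_ne_top {N : ℕ} {U : ℝ → ℝ≥0∞} (hm : AEMeasurable U) (h : ∀ x, EE 0 U x ≠ ∞) (x : ℝ) :
    EE 0 (Mx N U) x ≠ ∞ := by
  have h1 : EE 0 (Mx N U) x ≤ ∑ n ∈ Finset.range (N+1), EE 0 U x := by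
    calc _ ≤ EE 0 (fun y => ∑ n ∈ Finset.range (N+1), EE n U y) x := by
          apply EE_mono
          intro y
          apply Mx_le
          intro n hn
          exact Finset.single_le_sum (f := fun n => EE n U y) (fun _ _ => zero_le)
            (Finset.mem_range.2 (Nat.lt_succ_of_le hn))
      _ = ∑ n ∈ Finset.range (N+1), EE 0 (EE n U) x := by
          simp only [EE.eq_1 0]
          rw [lintegral_finsetSum _ (fun n _ => (Lev.EE (n := n)).measurable), Finset.mul_sum]
      _ = _ := Finset.sum_congr rfl (fun n _ => by rw [EE_EE (Nat.zero_le _) hm])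
  refine ne_top_of_le_ne_top ?_ h1
  exact (ENNReal.sum_lt_top.2 (fun n _ => (h x).lt_top)).ne

lemma EG_eq_sum (G : ℝ → ℂ) (v : ℝ → ℝ≥0∞) (N : ℕ) (x : ℝ)
    (hv0 : ∀ n ≤ N, Mx n v x ≠ 0) (hvt : ∀ n ≤ N, Mx n v x ≠ ∞) (S : Finset ℤ)
    (hS : ∀ n ≤ N, Int.log 2 (Mx n v x).toReal ∈ S) :
    ∀ n ≤ N, ∑ i ∈ S, HH G v (lz i) n x = EG n G x := by
  have key : ∀ n ≤ N, ∀ z : ℂ, ∀ [∀ i, Decidable (th v (lz i) n x)],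
      ∑ i ∈ S, (if th v (lz i) n x then z else 0) = z := by
    intro n hn z _
    rw [Finset.sum_eq_single_of_mem _ (hS n hn)]
    · exact if_pos (lz_log (hv0 n hn) (hvt n hn))
    · intro j _ hj
      exact if_neg fun h => hj (lz_unique h (lz_log (hv0 n hn) (hvt n hn)))
  intro n
  induction n with
  | zero =>
    intro h
    simp only [HH, DD]
    classical exact key 0 h _
  | succ n ih =>
    intro h
    simp only [HH, DD, Finset.sum_add_distrib]
    classical rw [ih (by omega), key n (by omega)]
    ring

open Classical in
theorem reverse_ineq {G : ℝ → ℂ} (hG : LocallyIntegrable G) {w : ℝ → ℝ≥0∞} (hw : AEMeasurable w)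
    (hwt : ∀ x, EE 0 w x ≠ ∞) (N : ℕ) :
    ∫⁻ x, ‖EG N G x‖ₑ^2 * w x ≤ ENNReal.ofReal cZ * 1200 * ∑ n ∈ Finset.range (N+1),
      ∫⁻ x, ‖DD G n x‖ₑ^2 * Mx (n-1) (Mx N (Mx N (EE N w))) x := by
  have hL : Lev N (fun x => ‖EG N G x‖ₑ^2) := fun a b h => by simp only [(Lev.EG (n := N)) a b h]
  rw [lintegral_Lev_mul N hL hw]
  set W := EE N w with hWdef
  have hW : Lev N W := Lev.EE
  set v := Mx N (Mx N W) with hv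
  have hvL : Lev N v := Lev.Mx
  have hWt0 : ∀ x, EE 0 W x ≠ ∞ := by
    intro x; rw [hWdef, EE_EE (Nat.zero_le _) hw]; exact hwt x
  have hvt0 : ∀ x, EE 0 v x ≠ ∞ := fun x =>
    EE_Mx_ne_top (Lev.Mx (N := N)).measurable.aemeasurable
      (EE_Mx_ne_top hW.measurable.aemeasurable hWt0) x
  have hEt : ∀ n x, EE n v x ≠ ∞ := fun n x =>
    ne_top_of_le_ne_top (ENNReal.mul_ne_top (by finiteness) (hvt0 x)) (EE_le_pow 0 n (Nat.zero_le _) v x)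
  have hWt : ∀ x, W x ≠ ∞ := fun x =>
    ne_top_of_le_ne_top (ENNReal.mul_ne_top (by finiteness) (hwt x)) (EE_le_pow 0 N (Nat.zero_le _) w x)
  have hWv : ∀ x, W x ≤ v x := fun x => (le_Mx hW x).trans (le_Mx Lev.Mx x)
  have hMt : ∀ n x, Mx n v x ≠ ∞ := by
    intro n x
    refine (lt_of_le_of_lt (Mx_le (c := ∑ k ∈ Finset.range (n+1), EE k v x) ?_)
      (ENNReal.sum_lt_top.2 (fun k _ => (hEt k x).lt_top))).ne
    intro k hk
    exact Finset.single_le_sum (f := fun n => EE n v x) (fun _ _ => zero_le)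
            (Finset.mem_range.2 (Nat.lt_succ_of_le hk))
  have hM0 : ∀ n ≤ N, ∀ x, W x ≠ 0 → Mx n v x ≠ 0 := by
    intro n hn x hx h0
    have h1 : EE n v x = 0 := le_antisymm ((EE_le_Mx le_rfl v x).trans h0.le) zero_le
    have h2 := EE_le_pow n N hn v x
    rw [h1, mul_zero, EE_of_Lev N hvL] at h2
    exact hx (le_antisymm ((hWv x).trans h2) zero_le)
  have huL : ∀ i, Lev N (fun x => cw W i x * W x) := fun i a b h => by
    simp only [cw, hW a b h]
  have pt : ∀ x, ‖EG N G x‖ₑ^2 * W x ≤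
      ENNReal.ofReal cZ * ∑' i : ℤ, ‖HH G v (lz i) N x‖ₑ^2 * (cw W i x * W x) := by
    intro x
    by_cases h0 : W x = 0
    · simp [h0]
    let S : Finset ℤ := (Finset.range (N+1)).image (fun n => Int.log 2 (Mx n v x).toReal)
    have hS : ∀ n ≤ N, Int.log 2 (Mx n v x).toReal ∈ S := fun n hn =>
      Finset.mem_image_of_mem _ (Finset.mem_range.2 (Nat.lt_succ_of_le hn))
    rw [← EG_eq_sum G v N x (fun n hn => hM0 n hn x h0) (fun n _ => hMt n x) S hS N le_rfl]
    calc _ ≤ (ENNReal.ofReal cZ * ∑ i ∈ S, cw W i x * ‖HH G v (lz i) N x‖ₑ^2) * W x := by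
          gcongr
          exact CS S _ id (Function.injective_id.injOn) (Int.log 2 (W x).toReal)
      _ = ENNReal.ofReal cZ * ∑ i ∈ S, ‖HH G v (lz i) N x‖ₑ^2 * (cw W i x * W x) := by
          rw [mul_assoc, Finset.sum_mul]
          congr 1
          exact Finset.sum_congr rfl fun i _ => by ring
      _ ≤ _ := by
          gcongr
          exact ENNReal.sum_le_tsum S
  have hHm : ∀ i, Measurable (fun x => ‖HH G v (lz i) N x‖ₑ^2) := fun i =>
    (Lev.HH (n := N)).measurable.enorm.pow_const 2
  have hDm : ∀ n, Measurable (fun x => ‖DD G n x‖ₑ^2) := fun n =>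
    (Lev.DD (n := n)).measurable.enorm.pow_const 2
  have hTm : ∀ i n, Measurable (fun x => if th v (lz i) (n-1) x then ‖DD G n x‖ₑ^2 else 0) := by
    intro i n
    have : Lev n (fun x => if th v (lz i) (n-1) x then ‖DD G n x‖ₑ^2 else 0) := fun a b h => by
      simp only [(Lev.th (v := v) (lam := lz i) (n := n-1)).mono (Nat.sub_le _ _) a b h,
        (Lev.DD (n := n)) a b h]
    exact this.measurable
  have hPm : ∀ i, Measurable (fun x => ‖HH G v (lz i) N x‖ₑ^2 * (cw W i x * W x)) := fun i =>
    (hHm i).mul (huL i).measurable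
  calc _ ≤ ∫⁻ x, ENNReal.ofReal cZ * ∑' i : ℤ, ‖HH G v (lz i) N x‖ₑ^2 * (cw W i x * W x) :=
        lintegral_mono pt
    _ = ENNReal.ofReal cZ * ∑' i : ℤ, ∫⁻ x, ‖HH G v (lz i) N x‖ₑ^2 * (cw W i x * W x) := by
        rw [lintegral_const_mul _ (Measurable.tsum hPm),
          lintegral_tsum (fun i => (hPm i).aemeasurable)]
    _ ≤ ENNReal.ofReal cZ * ∑' i : ℤ, 1200 * lz i * ∑ n ∈ Finset.range (N+1),
          ∫⁻ x, (if th v (lz i) (n-1) x then ‖DD G n x‖ₑ^2 else 0) := by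
        gcongr ENNReal.ofReal cZ * ?_
        apply ENNReal.tsum_le_tsum
        intro i
        rw [← HH_total hG]
        exact HH_glob (huL i) (fun n hn x hx => cw_EE hn hW hWt i x hx)
    _ = ENNReal.ofReal cZ * 1200 * ∑ n ∈ Finset.range (N+1),
          ∫⁻ x, ∑' i : ℤ, lz i * (if th v (lz i) (n-1) x then ‖DD G n x‖ₑ^2 else 0) := by
        rw [mul_assoc]
        congr 1
        have : ∀ n, ∫⁻ x, ∑' i : ℤ, lz i * (if th v (lz i) (n-1) x then ‖DD G n x‖ₑ^2 else 0) =
            ∑' i : ℤ, lz i * ∫⁻ x, (if th v (lz i) (n-1) x then ‖DD G n x‖ₑ^2 else 0) := by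
          intro n
          rw [lintegral_tsum (fun i => ((hTm i n).const_mul _).aemeasurable)]
          exact tsum_congr fun i => lintegral_const_mul _ (hTm i n)
        simp only [this, mul_assoc, ENNReal.tsum_mul_left]
        congr 1
        rw [← Summable.tsum_finsetSum (fun _ _ => ENNReal.summable)]
        exact tsum_congr fun i => by rw [Finset.mul_sum]
    _ ≤ _ := by
        gcongr ENNReal.ofReal cZ * 1200 * ?_
        apply Finset.sum_le_sum
        intro n _
        apply lintegral_mono
        intro x
        dsimp only
        calc _ = ‖DD G n x‖ₑ^2 * ∑' i : ℤ, (if lz i ≤ Mx (n-1) v x ∧ Mx (n-1) v x < 2 * lz i then lz i else 0) := by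
              rw [← ENNReal.tsum_mul_left]
              apply tsum_congr
              intro i
              by_cases h : th v (lz i) (n-1) x
              · rw [if_pos h, if_pos (show _ ∧ _ from h), mul_comm]
              · rw [if_neg h, if_neg (show ¬ (_ ∧ _) from h), mul_zero, mul_zero]
          _ ≤ _ := by gcongr; exact tsum_lz_le _

lemma sq_add_le (a b : ℝ≥0∞) : (a + b)^2 ≤ 4 * (a^2 + b^2) := by
  rcases le_total a b with h | h
  · calc (a+b)^2 ≤ (b+b)^2 := by gcongr
      _ = 4 * b^2 := by ring
      _ ≤ _ := by gcongr; exact le_add_self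
  · calc (a+b)^2 ≤ (a+a)^2 := by gcongr
      _ = 4 * a^2 := by ring
      _ ≤ _ := by gcongr; exact le_self_add

lemma lint_sq_le {s : Set ℝ} {f : ℝ → ℝ≥0∞} (hf : AEMeasurable f (volume.restrict s)) :
    (∫⁻ y in s, f y)^2 ≤ volume s * ∫⁻ y in s, f y^2 := by
  have h := ENNReal.lintegral_mul_le_Lp_mul_Lq (volume.restrict s) Real.HolderConjugate.two_two
    (aemeasurable_const (b := (1:ℝ≥0∞))) hf
  simp only [Pi.mul_apply, one_mul, ENNReal.one_rpow, lintegral_const, Measure.restrict_apply,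
    MeasurableSet.univ, univ_inter] at h
  have e : ∀ a : ℝ≥0∞, (a ^ (1/2:ℝ))^2 = a := by
    intro a
    rw [← ENNReal.rpow_natCast, ← ENNReal.rpow_mul]; norm_num
  calc _ ≤ _ := pow_le_pow_left₀ zero_le h 2
    _ = _ := by
      rw [mul_pow, e, e]
      simp

lemma osc_le {g g' : ℝ → ℂ} (hg : ∀ x, HasDerivAt g (g' x) x) (hc : Continuous g') {s : Set ℝ}
    {y z : ℝ} (hs : uIoc y z ⊆ s) : ‖g z - g y‖ₑ ≤ ∫⁻ t in s, ‖g' t‖ₑ := by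
  rw [← intervalIntegral.integral_eq_sub_of_hasDerivAt (fun x _ => hg x) (hc.intervalIntegrable _ _)]
  have : ‖∫ t in y..z, g' t‖ₑ = ‖∫ t in uIoc y z, g' t‖ₑ := by
    rw [← ofReal_norm, intervalIntegral.norm_intervalIntegral_eq, ofReal_norm]
  rw [this]
  exact (enorm_integral_le_lintegral_enorm _).trans (lintegral_mono_set hs)

lemma integrableOn_dI {g : ℝ → ℂ} (hg : LocallyIntegrable g) (m : ℕ) (y : ℝ) : IntegrableOn g (dI m y) := by
  refine (hg.integrableOn_isCompact (k := Icc ((⌊(2:ℝ)^m * y⌋ : ℝ) / 2^m)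
      ((⌊(2:ℝ)^m * y⌋ + 1 : ℝ) / 2^m)) isCompact_Icc).mono_set ?_
  rw [dI_eq_Ico]; exact Ico_subset_Icc_self

lemma volume_real_dI (n : ℕ) (x : ℝ) : volume.real (dI n x) = (2^n)⁻¹ := by
  rw [Measure.real, volume_dI]; simp

lemma EG_sub_const {g : ℝ → ℂ} (hg : LocallyIntegrable g) (n : ℕ) (x : ℝ) (c : ℂ) :
    EG n g x - c = EG n (fun y => g y - c) x := by
  rw [EG, EG, integral_sub (integrableOn_dI hg n x) (integrableOn_const (by rw [volume_dI]; finiteness)),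
    setIntegral_const, volume_real_dI, mul_sub, Complex.real_smul, ← mul_assoc]
  push_cast
  rw [mul_inv_cancel₀ (by simp), one_mul]

lemma enorm_EG_le (n : ℕ) (g : ℝ → ℂ) (x : ℝ) : ‖EG n g x‖ₑ ≤ EE n (fun y => ‖g y‖ₑ) x := by
  rw [EG, EE, enorm_mul]
  have : ‖(2:ℂ)^n‖ₑ = 2^n := by
    rw [enorm_pow]
    congr 1
    rw [← ofReal_norm]; simp
  rw [this]
  gcongr
  exact enorm_integral_le_lintegral_enorm _

lemma EE_sq_le (n : ℕ) {u : ℝ → ℝ≥0∞} (hu : AEMeasurable u) (x : ℝ) :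
    (EE n u x)^2 ≤ EE n (fun y => u y ^ 2) x := by
  rw [EE, EE, mul_pow]
  calc _ ≤ (2^n)^2 * ((2^n)⁻¹ * ∫⁻ y in dI n x, u y^2) := by
        gcongr
        rw [← volume_dI n x]
        exact lint_sq_le hu.restrict
    _ = _ := by rw [sq, mul_assoc, ← mul_assoc (2^n) (2^n)⁻¹, two_pow_mul_inv, one_mul]

/-- (L0) -/
lemma L0 {g : ℝ → ℂ} (hg : AEMeasurable g) (n : ℕ) :
    ∫⁻ x, ‖EG n g x‖ₑ^2 ≤ ∫⁻ x, ‖g x‖ₑ^2 := by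
  calc _ ≤ ∫⁻ x, EE n (fun y => ‖g y‖ₑ^2) x := by
        apply lintegral_mono
        intro x
        refine (pow_le_pow_left₀ zero_le (enorm_EG_le n g x) 2).trans (EE_sq_le n hg.enorm x)
    _ ≤ _ := by
        apply lintegral_le_of_dI n
        intro x
        rw [setLIntegral_EE le_rfl x (hg.enorm.pow_const 2)]

lemma uIoc_subset_dI {n : ℕ} {x y z : ℝ} (hy : y ∈ dI n x) (hz : z ∈ dI n x) : uIoc y z ⊆ dI n x := by
  rw [dI_eq_Ico] at *
  exact uIoc_subset_uIcc.trans (ordConnected_Ico.uIcc_subset hy hz)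

lemma EG_near {g g' : ℝ → ℂ} (hg : ∀ x, HasDerivAt g (g' x) x) (hc : Continuous g') (n : ℕ) (x : ℝ) :
    ‖EG n g x - g x‖ₑ ≤ ∫⁻ t in dI n x, ‖g' t‖ₑ := by
  have hgc : Continuous g := continuous_iff_continuousAt.2 fun x => (hg x).continuousAt
  rw [EG_sub_const hgc.locallyIntegrable]
  refine (enorm_EG_le _ _ _).trans (EE_le_of_le _ _ _ _ ?_)
  intro y hy
  exact osc_le hg hc (uIoc_subset_dI (mem_dI_self n x) hy)

/-- (L1) -/
lemma L1 {g g' : ℝ → ℂ} (hg : ∀ x, HasDerivAt g (g' x) x) (hc : Continuous g') (n : ℕ) :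
    ∫⁻ x, ‖DD g (n+1) x‖ₑ^2 ≤ 4 * ((2^n)⁻¹)^2 * ∫⁻ x, ‖g' x‖ₑ^2 := by
  have hm : Measurable (fun x => ‖g' x‖ₑ^2) := hc.measurable.enorm.pow_const 2
  rw [← lintegral_const_mul _ hm]
  apply lintegral_le_of_dI n
  intro x
  rw [lintegral_const_mul _ hm]
  have pt : ∀ y ∈ dI n x, ‖DD g (n+1) y‖ₑ^2 ≤ 4 * (2^n)⁻¹ * ∫⁻ t in dI n x, ‖g' t‖ₑ^2 := by
    intro y hy
    have h1 := EG_near hg hc n y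
    have h2 := (EG_near hg hc (n+1) y).trans (lintegral_mono_set (dI_succ_subset n y))
    rw [dI_eq_of_mem hy] at h1 h2
    have h3 : ‖DD g (n+1) y‖ₑ ≤ 2 * ∫⁻ t in dI n x, ‖g' t‖ₑ := by
      have : DD g (n+1) y = (EG (n+1) g y - g y) - (EG n g y - g y) := by simp only [DD]; ring
      rw [this, two_mul]
      exact enorm_sub_le.trans (add_le_add h2 h1)
    calc _ ≤ (2 * ∫⁻ t in dI n x, ‖g' t‖ₑ)^2 := pow_le_pow_left₀ zero_le h3 2
      _ = 4 * (∫⁻ t in dI n x, ‖g' t‖ₑ)^2 := by ring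
      _ ≤ 4 * ((2^n)⁻¹ * ∫⁻ t in dI n x, ‖g' t‖ₑ^2) := by
          gcongr
          rw [← volume_dI n x]
          exact lint_sq_le hc.measurable.enorm.aemeasurable
      _ = _ := by ring
  calc _ ≤ ∫⁻ y in dI n x, 4 * (2^n)⁻¹ * ∫⁻ t in dI n x, ‖g' t‖ₑ^2 :=
        setLIntegral_mono' (measurableSet_dI _ _) pt
    _ = _ := by rw [setLIntegral_const, volume_dI]; ring

lemma end_le {h h' : ℝ → ℂ} (hh : ∀ x, HasDerivAt h (h' x) x) (hc : Continuous h') {c d t : ℝ}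
    (hcd : c < d) (ht : t ∈ Icc c d) :
    ‖h t‖ₑ^2 ≤ 4 * ((ENNReal.ofReal (d-c))⁻¹ * (∫⁻ y in Ioc c d, ‖h y‖ₑ^2) +
      ENNReal.ofReal (d-c) * ∫⁻ y in Ioc c d, ‖h' y‖ₑ^2) := by
  set s := ENNReal.ofReal (d-c) with hs
  have hs0 : s ≠ 0 := by simpa [hs] using hcd
  have hst : s ≠ ∞ := ENNReal.ofReal_ne_top
  have hhc : Continuous h := continuous_iff_continuousAt.2 fun x => (hh x).continuousAt
  have pt : ∀ y ∈ Ioc c d, ‖h t‖ₑ^2 ≤ 4 * (‖h y‖ₑ^2 + s * ∫⁻ y in Ioc c d, ‖h' y‖ₑ^2) := by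
    intro y hy
    have h1 : ‖h t - h y‖ₑ ≤ ∫⁻ t in Ioc c d, ‖h' t‖ₑ := by
      apply osc_le hh hc
      rw [uIoc]
      exact Ioc_subset_Ioc (le_min hy.1.le ht.1) (max_le hy.2 ht.2)
    calc ‖h t‖ₑ^2 = ‖h y + (h t - h y)‖ₑ^2 := by congr 2; ring
      _ ≤ (‖h y‖ₑ + ‖h t - h y‖ₑ)^2 := by gcongr; exact enorm_add_le _ _
      _ ≤ 4 * (‖h y‖ₑ^2 + ‖h t - h y‖ₑ^2) := sq_add_le _ _
      _ ≤ 4 * (‖h y‖ₑ^2 + (∫⁻ t in Ioc c d, ‖h' t‖ₑ)^2) := by gcongr 4 * (_ + ?_^2)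
      _ ≤ _ := by
        gcongr 4 * (_ + ?_)
        rw [hs, ← Real.volume_Ioc]
        exact lint_sq_le hc.measurable.enorm.aemeasurable
  have int : ∫⁻ y in Ioc c d, ‖h t‖ₑ^2 ≤
      ∫⁻ y in Ioc c d, 4 * (‖h y‖ₑ^2 + s * ∫⁻ y in Ioc c d, ‖h' y‖ₑ^2) :=
    setLIntegral_mono' measurableSet_Ioc pt
  have hm2 : Measurable (fun y => ‖h y‖ₑ^2) := hhc.measurable.enorm.pow_const 2
  have hm3 : Measurable (fun y => ‖h y‖ₑ^2 + s * ∫⁻ y in Ioc c d, ‖h' y‖ₑ^2) := hm2.add measurable_const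
  rw [lintegral_const_mul _ hm3, lintegral_add_left hm2,
    setLIntegral_const, setLIntegral_const, Real.volume_Ioc, ← hs] at int
  calc ‖h t‖ₑ^2 = s⁻¹ * (‖h t‖ₑ^2 * s) := by
        rw [mul_comm (‖h t‖ₑ^2), ← mul_assoc, ENNReal.inv_mul_cancel hs0 hst, one_mul]
    _ ≤ s⁻¹ * _ := by gcongr s⁻¹ * ?_
    _ = 4 * (s⁻¹ * (∫⁻ y in Ioc c d, ‖h y‖ₑ^2) + (s⁻¹ * s) * (s * ∫⁻ y in Ioc c d, ‖h' y‖ₑ^2)) := by ring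
    _ = _ := by rw [ENNReal.inv_mul_cancel hs0 hst, one_mul]

/-- (L2) -/
lemma L2 {h h' : ℝ → ℂ} (hh : ∀ x, HasDerivAt h (h' x) x) (hc : Continuous h') {n κ : ℕ} (hn : n ≤ κ) :
    ∫⁻ x, ‖EG n h' x‖ₑ^2 ≤ 32 * 2^(n+κ) * ((∫⁻ x, ‖h x‖ₑ^2) + ((2^κ)⁻¹)^2 * ∫⁻ x, ‖h' x‖ₑ^2) := by
  have hhc : Continuous h := continuous_iff_continuousAt.2 fun x => (hh x).continuousAt
  have hm1 : Measurable (fun x => ‖h x‖ₑ^2) := hhc.measurable.enorm.pow_const 2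
  have hm2 : Measurable (fun x => ‖h' x‖ₑ^2) := hc.measurable.enorm.pow_const 2
  have hm3 : Measurable (fun x => ‖h x‖ₑ^2 + ((2^κ)⁻¹)^2 * ‖h' x‖ₑ^2) := hm1.add (hm2.const_mul _)
  rw [← lintegral_const_mul _ hm2, ← lintegral_add_left hm1, ← lintegral_const_mul _ hm3]
  apply lintegral_le_of_dI n
  intro x
  have hL : Lev n (fun x => ‖EG n h' x‖ₑ^2) := fun a b h => by simp only [(Lev.EG (n := n)) a b h]
  rw [setLIntegral_Lev n x hL, lintegral_const_mul _ hm3, lintegral_add_left hm1, lintegral_const_mul _ hm2]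
  set a : ℝ := (⌊(2:ℝ)^n * x⌋ : ℝ) / 2^n with ha
  have hdI : dI n x = Ico a (a + (2^n)⁻¹) := by rw [dI_eq_Ico, ha, add_div, one_div]
  have hpos : (0:ℝ) < (2^n)⁻¹ := by positivity
  have hposκ : (0:ℝ) < (2^κ)⁻¹ := by positivity
  have hle : ((2:ℝ)^κ)⁻¹ ≤ (2^n)⁻¹ := by gcongr; norm_num
  have hIoc : ∀ u : ℝ → ℝ≥0∞, ∫⁻ y in dI n x, u y = ∫⁻ y in Ioc a (a + (2^n)⁻¹), u y := by
    intro u; rw [hdI]; exact setLIntegral_congr Ico_ae_eq_Ioc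
  have hE : EG n h' x = 2^n * (h (a + (2^n)⁻¹) - h a) := by
    rw [EG, hdI, integral_Ico_eq_integral_Ioc, ← intervalIntegral.integral_of_le (by linarith),
      intervalIntegral.integral_eq_sub_of_hasDerivAt (fun x _ => hh x) (hc.intervalIntegrable _ _)]
  set B := 4 * (2^κ * (∫⁻ y in dI n x, ‖h y‖ₑ^2) + (2^κ)⁻¹ * ∫⁻ y in dI n x, ‖h' y‖ₑ^2) with hB
  have e1 : ENNReal.ofReal ((2^κ)⁻¹) = (2^κ)⁻¹ := by
    rw [ENNReal.ofReal_inv_of_pos (by positivity), ENNReal.ofReal_pow (by norm_num)]; norm_num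
  have end1 : ‖h a‖ₑ^2 ≤ B := by
    have := end_le hh hc (c := a) (d := a + (2^κ)⁻¹) (t := a) (by linarith) ⟨le_rfl, by linarith⟩
    rw [add_sub_cancel_left, e1, inv_inv] at this
    refine this.trans ?_
    rw [hB, hIoc, hIoc]
    have hsub : Ioc a (a + (2^κ)⁻¹) ⊆ Ioc a (a + (2^n)⁻¹) := Ioc_subset_Ioc le_rfl (by linarith)
    have i1 := lintegral_mono_set (μ := volume) hsub (f := fun y => ‖h y‖ₑ^2)
    have i2 := lintegral_mono_set (μ := volume) hsub (f := fun y => ‖h' y‖ₑ^2)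
    gcongr 4 * (_ * ?_ + _ * ?_)
  have end2 : ‖h (a + (2^n)⁻¹)‖ₑ^2 ≤ B := by
    have := end_le hh hc (c := a + (2^n)⁻¹ - (2^κ)⁻¹) (d := a + (2^n)⁻¹) (t := a + (2^n)⁻¹)
      (by linarith) ⟨by linarith, le_rfl⟩
    rw [sub_sub_cancel, e1, inv_inv] at this
    refine this.trans ?_
    rw [hB, hIoc, hIoc]
    have hsub : Ioc (a + (2^n)⁻¹ - (2^κ)⁻¹) (a + (2^n)⁻¹) ⊆ Ioc a (a + (2^n)⁻¹) :=
      Ioc_subset_Ioc (by linarith) le_rfl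
    have i1 := lintegral_mono_set (μ := volume) hsub (f := fun y => ‖h y‖ₑ^2)
    have i2 := lintegral_mono_set (μ := volume) hsub (f := fun y => ‖h' y‖ₑ^2)
    gcongr 4 * (_ * ?_ + _ * ?_)
  have e2 : ‖(2:ℂ)^n‖ₑ = 2^n := by
    rw [enorm_pow]
    congr 1
    rw [← ofReal_norm]; simp
  have e3 : (2:ℝ≥0∞)^κ * (2^κ)⁻¹ = 1 := two_pow_mul_inv κ
  calc (2^n)⁻¹ * ‖EG n h' x‖ₑ^2 ≤ (2^n)⁻¹ * ((2^n)^2 * (4 * (B + B))) := by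
        rw [hE, enorm_mul, e2, mul_pow]
        gcongr
        refine (pow_le_pow_left₀ zero_le enorm_sub_le 2).trans ((sq_add_le _ _).trans ?_)
        gcongr
    _ = ((2^n) * (2^n)⁻¹) * 2^n * 8 * B := by ring
    _ = 32 * 2^n * (2^κ * (∫⁻ y in dI n x, ‖h y‖ₑ^2) +
          (2^κ * (2^κ)⁻¹) * (2^κ)⁻¹ * ∫⁻ y in dI n x, ‖h' y‖ₑ^2) := by
        rw [two_pow_mul_inv, e3, hB]; ring
    _ = 32 * 2^(n+κ) * ((∫⁻ y in dI n x, ‖h y‖ₑ^2) + ((2^κ)⁻¹)^2 * ∫⁻ y in dI n x, ‖h' y‖ₑ^2) := by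
        rw [pow_add]; ring

open scoped FourierTransform ContDiff

/-- convolution -/
def cv (F A : ℝ → ℂ) (x : ℝ) : ℂ := ∫ t, F t * A (x - t)

lemma eLp_sq (f : ℝ → ℂ) : eLpNorm f 2 volume ^ 2 = ∫⁻ x, ‖f x‖ₑ^2 := by
  rw [eLpNorm_eq_lintegral_rpow_enorm_toReal two_ne_zero ENNReal.ofNat_ne_top, ← ENNReal.rpow_natCast,
    ← ENNReal.rpow_mul]
  simp

lemma planch (g : SchwartzMap ℝ ℂ) : ∫⁻ x, ‖𝓕 g x‖ₑ^2 = ∫⁻ x, ‖g x‖ₑ^2 := by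
  have h := SchwartzMap.integral_norm_sq_fourier g
  have key : ∀ f : SchwartzMap ℝ ℂ, ∫⁻ x, ‖f x‖ₑ^2 = ENNReal.ofReal (∫ x, ‖f x‖^2) := by
    intro f
    rw [ofReal_integral_eq_lintegral_ofReal]
    · exact lintegral_congr fun x => enorm_sq_eq _
    · exact (f.memLp 2 volume).integrable_norm_pow two_ne_zero
    · exact Filter.Eventually.of_forall fun x => by positivity
  rw [key, key, h]

lemma planch_cv {A : ℝ → ℂ} (hA : HasCompactSupport A) (hA' : ContDiff ℝ ∞ A) (S : SchwartzMap ℝ ℂ) :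
    ∫⁻ x, ‖cv S A x‖ₑ^2 = ∫⁻ ξ, ‖𝓕 A ξ‖ₑ^2 * ‖𝓕 S ξ‖ₑ^2 := by
  set T := hA.toSchwartzMap hA' with hT
  have e1 : ∀ x, cv S A x = SchwartzMap.convolution (ContinuousLinearMap.mul ℂ ℂ) S T x := by
    intro x; rw [SchwartzMap.convolution_apply]; rfl
  simp only [e1]
  rw [← planch]
  apply lintegral_congr
  intro ξ
  rw [SchwartzMap.fourier_convolution_apply, Real.fourier_mul_convolution_eq S.integrable T.integrable]
  rw [enorm_mul, mul_pow, mul_comm]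
  rw [SchwartzMap.fourier_coe]
  rfl

lemma cv_sub_le {F S A : ℝ → ℂ} (hF : MemLp F 2) (hS : MemLp S 2) (hA : Continuous A) (hAc : HasCompactSupport A)
    (x : ℝ) : ‖cv F A x - cv S A x‖ₑ ≤ eLpNorm (F - S) 2 * eLpNorm A 2 := by
  have hA2 : MemLp (fun t => A (x - t)) 2 := by
    have h1 : Continuous (fun t => A (x - t)) := by fun_prop
    have h2 : HasCompactSupport (fun t => A (x - t)) :=
      hAc.comp_homeomorph (Homeomorph.subLeft x)
    exact h1.memLp_of_hasCompactSupport h2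
  have i1 : Integrable (fun t => F t * A (x - t)) := hF.integrable_mul hA2
  have i2 : Integrable (fun t => S t * A (x - t)) := hS.integrable_mul hA2
  rw [cv, cv, ← integral_sub i1 i2]
  refine (enorm_integral_le_lintegral_enorm _).trans ?_
  have e : eLpNorm A 2 volume = eLpNorm (fun t => A (x - t)) 2 volume := by
    have := (Measure.measurePreserving_sub_left (volume : Measure ℝ) x)
    exact (eLpNorm_comp_measurePreserving hA.aestronglyMeasurable this).symm
  rw [e, ← eLpNorm_one_eq_lintegral_enorm]
  have : (fun t => F t * A (x - t) - S t * A (x - t)) = (F - S) • (fun t => A (x - t)) := by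
    ext t; simp [sub_mul]
  rw [this]
  exact eLpNorm_smul_le_mul_eLpNorm (p := 2) (q := 2) (r := 1) hA2.1 (hF.sub hS).1

open Filter Topology in
theorem mult {ι : Type*} (T : Finset ι) (A : ι → ℝ → ℂ) (hA : ∀ i ∈ T, HasCompactSupport (A i))
    (hA' : ∀ i ∈ T, ContDiff ℝ ∞ (A i)) (c : ι → ℝ≥0∞) (hc : ∀ i, c i ≠ ⊤) (C : ℝ≥0∞) (hCt : C ≠ ⊤)
    (hC : ∀ ξ, ∑ i ∈ T, c i * ‖𝓕 (A i) ξ‖ₑ^2 ≤ C) (F : ℝ → ℂ) (hF : MemLp F 2) :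
    ∑ i ∈ T, c i * ∫⁻ x, ‖cv F (A i) x‖ₑ^2 ≤ C * ∫⁻ x, ‖F x‖ₑ^2 := by
  have hcvm : ∀ (S : SchwartzMap ℝ ℂ), ∀ i ∈ T, Measurable (fun x => ‖cv S (A i) x‖ₑ^2) := by
    intro S i hi
    have : ∀ x, cv S (A i) x = SchwartzMap.convolution (ContinuousLinearMap.mul ℂ ℂ) S
        ((hA i hi).toSchwartzMap (hA' i hi)) x := by
      intro x; rw [SchwartzMap.convolution_apply]; rfl
    simp only [this]
    exact (SchwartzMap.continuous _).measurable.enorm.pow_const 2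
  have hS : ∀ S : SchwartzMap ℝ ℂ, ∫⁻ x, ∑ i ∈ T, c i * ‖cv S (A i) x‖ₑ^2 ≤ C * ∫⁻ x, ‖S x‖ₑ^2 := by
    intro S
    have hfm : ∀ i ∈ T, Measurable (fun ξ => c i * (‖𝓕 (A i) ξ‖ₑ^2 * ‖𝓕 S ξ‖ₑ^2)) := by
      intro i hi
      have h1 : Continuous (𝓕 (A i)) := by
        have := SchwartzMap.fourier_coe ((hA i hi).toSchwartzMap (hA' i hi))
        have h2 : (((hA i hi).toSchwartzMap (hA' i hi)) : ℝ → ℂ) = A i := rfl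
        rw [h2] at this
        rw [← this]
        exact SchwartzMap.continuous _
      exact ((h1.measurable.enorm.pow_const 2).mul
        ((SchwartzMap.continuous _).measurable.enorm.pow_const 2)).const_mul _
    rw [lintegral_finsetSum _ (fun i hi => (hcvm S i hi).const_mul _)]
    calc _ = ∑ i ∈ T, ∫⁻ ξ, c i * (‖𝓕 (A i) ξ‖ₑ^2 * ‖𝓕 S ξ‖ₑ^2) := by
          apply Finset.sum_congr rfl
          intro i hi
          rw [lintegral_const_mul' _ _ (hc i), lintegral_const_mul' _ _ (hc i), planch_cv (hA i hi) (hA' i hi)]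
      _ = ∫⁻ ξ, ∑ i ∈ T, c i * (‖𝓕 (A i) ξ‖ₑ^2 * ‖𝓕 S ξ‖ₑ^2) := (lintegral_finsetSum _ hfm).symm
      _ ≤ ∫⁻ ξ, C * ‖𝓕 S ξ‖ₑ^2 := by
          apply lintegral_mono
          intro ξ
          calc _ = (∑ i ∈ T, c i * ‖𝓕 (A i) ξ‖ₑ^2) * ‖𝓕 S ξ‖ₑ^2 := by
                rw [Finset.sum_mul]; exact Finset.sum_congr rfl fun i _ => by ring
            _ ≤ C * ‖𝓕 S ξ‖ₑ^2 := mul_le_mul_left (hC ξ) _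
      _ = _ := by rw [lintegral_const_mul' _ _ hCt, planch]
  have hex : ∀ j : ℕ, ∃ S : SchwartzMap ℝ ℂ, eLpNorm (F - ⇑S) 2 volume ≤ ENNReal.ofReal (1 / ((j:ℝ)+1)) := by
    intro j
    obtain ⟨g, hg₁, hg₂, hg₃⟩ := MemLp.exist_eLpNorm_sub_le (p := 2) (by simp) (by simp) hF
      (ε := 1 / ((j:ℝ)+1)) (by positivity)
    exact ⟨hg₁.toSchwartzMap hg₂, hg₃⟩
  choose S hSj using hex
  have ht0 : Tendsto (fun j : ℕ => ENNReal.ofReal (1 / ((j:ℝ)+1))) atTop (𝓝 0) := by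
    have := ENNReal.tendsto_ofReal (tendsto_one_div_add_atTop_nhds_zero_nat (𝕜 := ℝ))
    simpa using this
  have hpt : ∀ x, ∀ i ∈ T, Tendsto (fun j => cv (S j) (A i) x) atTop (𝓝 (cv F (A i) x)) := by
    intro x i hi
    rw [tendsto_iff_edist_tendsto_0]
    have hb : Tendsto (fun j : ℕ => ENNReal.ofReal (1 / ((j:ℝ)+1)) * eLpNorm (A i) 2) atTop (𝓝 0) := by
      have hfin : eLpNorm (A i) 2 volume ≠ ⊤ :=
        ((hA' i hi).continuous.memLp_of_hasCompactSupport (hA i hi)).2.ne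
      simpa using ENNReal.Tendsto.mul_const ht0 (Or.inr hfin)
    refine tendsto_of_tendsto_of_tendsto_of_le_of_le tendsto_const_nhds hb (fun _ => zero_le) ?_
    intro j
    dsimp only
    rw [edist_comm, edist_eq_enorm_sub]
    refine (cv_sub_le hF ((S j).memLp 2 volume) (hA' i hi).continuous (hA i hi) x).trans ?_
    gcongr
    exact hSj j
  have hpt2 : ∀ x, Tendsto (fun j => ∑ i ∈ T, c i * ‖cv (S j) (A i) x‖ₑ^2) atTop
      (𝓝 (∑ i ∈ T, c i * ‖cv F (A i) x‖ₑ^2)) := by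
    intro x
    apply tendsto_finsetSum
    intro i hi
    exact ENNReal.Tendsto.const_mul (ENNReal.Tendsto.pow ((hpt x i hi).enorm)) (Or.inr (hc i))
  have hSn : Tendsto (fun j : ℕ => C * (eLpNorm F 2 volume + ENNReal.ofReal (1 / ((j:ℝ)+1)))^2) atTop
      (𝓝 (C * ∫⁻ x, ‖F x‖ₑ^2)) := by
    rw [← eLp_sq]
    apply ENNReal.Tendsto.const_mul _ (Or.inr hCt)
    apply ENNReal.Tendsto.pow
    simpa using (tendsto_const_nhds (x := eLpNorm F 2 volume)).add ht0
  have hSb : ∀ j, ∫⁻ x, ∑ i ∈ T, c i * ‖cv (S j) (A i) x‖ₑ^2 ≤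
      C * (eLpNorm F 2 volume + ENNReal.ofReal (1 / ((j:ℝ)+1)))^2 := by
    intro j
    refine (hS (S j)).trans ?_
    rw [← eLp_sq]
    gcongr
    have : (S j : ℝ → ℂ) = F - (F - ⇑(S j)) := by simp
    calc eLpNorm (S j) 2 volume = eLpNorm (F - (F - ⇑(S j))) 2 volume := by rw [← this]
      _ ≤ eLpNorm F 2 volume + eLpNorm (F - ⇑(S j)) 2 volume :=
        eLpNorm_sub_le hF.1 (hF.sub ((S j).memLp 2 volume)).1 (by simp)
      _ ≤ _ := by gcongr; exact hSj j
  calc ∑ i ∈ T, c i * ∫⁻ x, ‖cv F (A i) x‖ₑ^2 = ∑ i ∈ T, ∫⁻ x, c i * ‖cv F (A i) x‖ₑ^2 :=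
        Finset.sum_congr rfl fun i _ => (lintegral_const_mul' _ _ (hc i)).symm
    _ = ∫⁻ x, ∑ i ∈ T, c i * ‖cv F (A i) x‖ₑ^2 := by
        refine (lintegral_finsetSum _ fun i hi => ?_).symm
        have : Measurable (fun x => ‖cv F (A i) x‖ₑ^2) := by
          refine measurable_of_tendsto_metrizable (fun j => hcvm (S j) i hi) ?_
          rw [tendsto_pi_nhds]
          intro x
          exact ENNReal.Tendsto.pow ((hpt x i hi).enorm)
        exact this.const_mul _
    _ = ∫⁻ x, liminf (fun j => ∑ i ∈ T, c i * ‖cv (S j) (A i) x‖ₑ^2) atTop :=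
        lintegral_congr fun x => (hpt2 x).liminf_eq.symm
    _ ≤ liminf (fun j => ∫⁻ x, ∑ i ∈ T, c i * ‖cv (S j) (A i) x‖ₑ^2) atTop :=
        lintegral_liminf_le fun j => Finset.measurable_fun_sum _ fun i hi => (hcvm (S j) i hi).const_mul _
    _ ≤ liminf (fun j : ℕ => C * (eLpNorm F 2 volume + ENNReal.ofReal (1 / ((j:ℝ)+1)))^2) atTop :=
        liminf_le_liminf (Eventually.of_forall hSb)
    _ = _ := hSn.liminf_eq

open scoped FourierTransform ContDiff

/-- the oscillating kernel -/
def kern (ℓ : ℕ) (β : ℝ → ℂ) (R : ℝ) (x : ℝ) : ℂ := Complex.exp (Complex.I * (x:ℂ)^ℓ) * β (x / R)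

/-- annular bump -/
def Ann (β : ℝ → ℂ) : Prop :=
  ContDiff ℝ ∞ β ∧ (∀ s, |s| ≤ 1/2 → β s = 0) ∧ (∀ s, 2 ≤ |s| → β s = 0)

/-- the auxiliary integrand -/
def PP (ℓ : ℕ) (σ Λ τ s : ℝ) : ℝ := (1/Λ + (σ * ℓ * s^(ℓ-1) - τ)^2)⁻¹

lemma PP_pos {ℓ : ℕ} {σ Λ τ s : ℝ} (hΛ : 0 < Λ) : 0 < 1/Λ + (σ * ℓ * s^(ℓ-1) - τ)^2 := by positivity

lemma PP_cont {ℓ : ℕ} {σ Λ τ : ℝ} (hΛ : 0 < Λ) : Continuous (PP ℓ σ Λ τ) := by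
  unfold PP
  refine Continuous.inv₀ (by fun_prop) (fun s => (PP_pos hΛ).ne')

lemma J_all {ℓ : ℕ} (hℓ : 2 ≤ ℓ) {σ Λ τ : ℝ} (hσ : σ^2 = 1) (hΛ : 0 < Λ) :
    ∫ s in (1/2:ℝ)..2, PP ℓ σ Λ τ s ≤ 2^ℓ * (π * √Λ) := by
  have hd : ∀ s : ℝ, HasDerivAt (fun s => σ * √Λ * arctan (√Λ * (σ * ℓ * s^(ℓ-1) - τ)))
      ((ℓ * ((ℓ-1:ℕ):ℝ) * s^(ℓ-1-1)) * PP ℓ σ Λ τ s) s := by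
    intro s
    have h1 : HasDerivAt (fun s : ℝ => √Λ * (σ * ℓ * s^(ℓ-1) - τ)) (√Λ * (σ * ℓ * (((ℓ-1:ℕ):ℝ) * s^(ℓ-1-1)))) s := by
      have := (((hasDerivAt_pow (ℓ-1) s).const_mul (σ * ℓ)).sub_const τ).const_mul (√Λ)
      exact this
    have h2 := (h1.arctan).const_mul (σ * √Λ)
    refine h2.congr_deriv ?_
    have hs : √Λ ^ 2 = Λ := Real.sq_sqrt hΛ.le
    unfold PP
    have hp := PP_pos (ℓ := ℓ) (σ := σ) (τ := τ) (s := s) hΛ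
    rw [mul_pow, hs]
    set t := σ * ℓ * s^(ℓ-1) - τ
    have h3 : 1 + Λ * t^2 = Λ * (1/Λ + t^2) := by field_simp
    rw [h3]
    field_simp
    rw [hs, hσ]
    ring
  have hcont : Continuous (fun s : ℝ => (ℓ * ((ℓ-1:ℕ):ℝ) * s^(ℓ-1-1)) * PP ℓ σ Λ τ s) := by
    have := PP_cont (ℓ := ℓ) (σ := σ) (τ := τ) hΛ
    fun_prop
  have hI := intervalIntegral.integral_eq_sub_of_hasDerivAt (a := 1/2) (b := 2) (fun s _ => hd s)
    (hcont.intervalIntegrable _ _)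
  have hle : ∫ s in (1/2:ℝ)..2, PP ℓ σ Λ τ s ≤
      ∫ s in (1/2:ℝ)..2, 2^ℓ * ((ℓ * ((ℓ-1:ℕ):ℝ) * s^(ℓ-1-1)) * PP ℓ σ Λ τ s) := by
    apply intervalIntegral.integral_mono_on (by norm_num) ((PP_cont hΛ).intervalIntegrable _ _)
      ((hcont.const_mul _).intervalIntegrable _ _)
    intro s hs
    have hP : 0 ≤ PP ℓ σ Λ τ s := (inv_pos.2 (PP_pos hΛ)).le
    have h1 : (1:ℝ) ≤ ℓ := by exact_mod_cast (by omega : 1 ≤ ℓ)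
    have h2 : (1:ℝ) ≤ ((ℓ-1:ℕ):ℝ) := by exact_mod_cast (by omega : 1 ≤ ℓ-1)
    have h3 : (1/2:ℝ)^(ℓ-1-1) ≤ s^(ℓ-1-1) := pow_le_pow_left₀ (by norm_num) hs.1 _
    have h4 : (1:ℝ) ≤ 2^ℓ * (1/2:ℝ)^(ℓ-1-1) := by
      have : (2:ℝ)^ℓ = 4 * 2^(ℓ-1-1) := by
        obtain ⟨m, rfl⟩ := Nat.exists_eq_add_of_le hℓ
        have : 2 + m - 1 - 1 = m := by omega
        rw [this, pow_add]; norm_num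
      rw [this, mul_assoc, ← mul_pow]; norm_num
    have h5 : (1:ℝ) ≤ 2^ℓ * (ℓ * ((ℓ-1:ℕ):ℝ) * s^(ℓ-1-1)) := by
      calc (1:ℝ) ≤ 2^ℓ * (1/2:ℝ)^(ℓ-1-1) := h4
        _ ≤ 2^ℓ * s^(ℓ-1-1) := by gcongr
        _ = 2^ℓ * (1 * 1 * s^(ℓ-1-1)) := by ring
        _ ≤ _ := by
          have : 0 ≤ s^(ℓ-1-1) := pow_nonneg (by linarith [hs.1]) _
          gcongr
    calc PP ℓ σ Λ τ s = 1 * PP ℓ σ Λ τ s := by ring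
      _ ≤ (2^ℓ * (ℓ * ((ℓ-1:ℕ):ℝ) * s^(ℓ-1-1))) * PP ℓ σ Λ τ s := by gcongr
      _ = _ := by ring
  rw [intervalIntegral.integral_const_mul, hI] at hle
  refine hle.trans ?_
  gcongr
  have hσ1 : |σ| = 1 := by
    have : |σ|^2 = 1 := by rw [sq_abs]; exact hσ
    nlinarith [abs_nonneg σ]
  set a := arctan (√Λ * (σ * ℓ * 2^(ℓ-1) - τ))
  set b := arctan (√Λ * (σ * ℓ * (1/2)^(ℓ-1) - τ))
  have hab : |a - b| ≤ π := by
    have h1 := arctan_lt_pi_div_two (√Λ * (σ * ℓ * 2^(ℓ-1) - τ))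
    have h2 := neg_pi_div_two_lt_arctan (√Λ * (σ * ℓ * 2^(ℓ-1) - τ))
    have h3 := arctan_lt_pi_div_two (√Λ * (σ * ℓ * (1/2)^(ℓ-1) - τ))
    have h4 := neg_pi_div_two_lt_arctan (√Λ * (σ * ℓ * (1/2)^(ℓ-1) - τ))
    rw [abs_le]; constructor <;> linarith
  calc σ * √Λ * a - σ * √Λ * b ≤ |σ * √Λ * a - σ * √Λ * b| := le_abs_self _
    _ = |σ| * √Λ * |a - b| := by
        rw [← mul_sub, abs_mul, abs_mul, abs_of_nonneg (Real.sqrt_nonneg Λ)]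
    _ ≤ π * √Λ := by rw [hσ1]; nlinarith [Real.sqrt_nonneg Λ]

lemma J_off {ℓ : ℕ} (hℓ : 2 ≤ ℓ) {σ Λ τ : ℝ} (hσ : |σ| = 1) (hΛ : 0 < Λ)
    (hτ : |τ| ≤ ℓ * (1/2)^ℓ ∨ ℓ * 2^ℓ ≤ |τ|) :
    ∫ s in (1/2:ℝ)..2, PP ℓ σ Λ τ s ≤ 2 * 4^ℓ := by
  have h1 : (1:ℝ) ≤ ℓ := by exact_mod_cast (by omega : 1 ≤ ℓ)
  have key : ∀ s ∈ Icc (1/2:ℝ) 2, PP ℓ σ Λ τ s ≤ 4^ℓ := by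
    intro s hs
    have hlow : (1/2:ℝ)^ℓ ≤ |σ * ℓ * s^(ℓ-1) - τ| := by
      have hs0 : 0 ≤ s := by linarith [hs.1]
      have habs : |σ * ℓ * s^(ℓ-1)| = ℓ * s^(ℓ-1) := by
        rw [abs_mul, abs_mul, hσ, abs_of_nonneg (pow_nonneg hs0 _)]; simp
      obtain ⟨m, rfl⟩ : ∃ m, ℓ = m + 1 := ⟨ℓ-1, by omega⟩
      rw [Nat.add_sub_cancel] at habs ⊢
      rcases hτ with h | h
      · have h2 := abs_sub_abs_le_abs_sub (σ * ((m+1:ℕ):ℝ) * s^m) τ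
        rw [habs] at h2
        have h3 : (1/2:ℝ)^m ≤ s^m := pow_le_pow_left₀ (by norm_num) hs.1 _
        have h4 : (0:ℝ) < (1/2)^m := by positivity
        rw [pow_succ] at h ⊢
        nlinarith
      · have h2 := abs_sub_abs_le_abs_sub τ (σ * ((m+1:ℕ):ℝ) * s^m)
        rw [habs, abs_sub_comm] at h2
        have h3 : s^m ≤ 2^m := pow_le_pow_left₀ hs0 hs.2 _
        have h4 : (1:ℝ) ≤ 2^m := one_le_pow₀ (by norm_num)
        have h5 : (1/2:ℝ)^(m+1) ≤ 1 := pow_le_one₀ (by norm_num) (by norm_num)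
        rw [pow_succ] at h
        nlinarith
    unfold PP
    rw [inv_le_comm₀ (PP_pos hΛ) (by positivity)]
    have : ((4:ℝ)^ℓ)⁻¹ = ((1/2:ℝ)^ℓ)^2 := by
      rw [← pow_mul, mul_comm, pow_mul, ← inv_pow]; norm_num
    rw [this, ← sq_abs (σ * ℓ * s^(ℓ-1) - τ)]
    have h6 : ((1/2:ℝ)^ℓ)^2 ≤ |σ * ℓ * s^(ℓ-1) - τ|^2 := by gcongr
    have : 0 < 1/Λ := by positivity
    linarith
  calc ∫ s in (1/2:ℝ)..2, PP ℓ σ Λ τ s ≤ ∫ s in (1/2:ℝ)..2, (4:ℝ)^ℓ :=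
        intervalIntegral.integral_mono_on (by norm_num) ((PP_cont hΛ).intervalIntegrable _ _)
          (by simp) key
    _ = (3/2) * 4^ℓ := by rw [intervalIntegral.integral_const]; norm_num
    _ ≤ _ := by have : (0:ℝ) < 4^ℓ := by positivity
                linarith

lemma osc1 {ℓ : ℕ} (hℓ : 2 ≤ ℓ) {σ Λ τ : ℝ} (hσ : |σ| = 1) (hΛ : 0 < Λ) {β β' : ℝ → ℂ}
    (hβ : ∀ s, HasDerivAt β (β' s) s) (hβ' : Continuous β') (h1 : β (1/2) = 0) (h2 : β 2 = 0)
    {B : ℝ} (hB : ∀ s, ‖β s‖ ≤ B) (hB' : ∀ s, ‖β' s‖ ≤ B) :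
    Λ * ‖∫ s in (1/2:ℝ)..2, Complex.exp (Complex.I * ((Λ * (σ * s^ℓ - τ * s) : ℝ):ℂ)) * β s‖ ≤
      (B * (2 + ℓ * ℓ * 2^ℓ)) * (2 + ∫ s in (1/2:ℝ)..2, PP ℓ σ Λ τ s) := by
  have hB0 : 0 ≤ B := (norm_nonneg _).trans (hB 0)
  set ph : ℝ → ℝ := fun s => σ * ℓ * s^(ℓ-1) - τ with hph
  set ph2 : ℝ → ℝ := fun s => σ * ℓ * (((ℓ-1:ℕ):ℝ) * s^(ℓ-1-1)) with hph2
  set P := PP ℓ σ Λ τ with hP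
  have hPd : ∀ s, P s = (1/Λ + ph s^2)⁻¹ := fun s => rfl
  have hpos : ∀ s, 0 < 1/Λ + ph s^2 := fun s => PP_pos hΛ
  have hphd : ∀ s, HasDerivAt ph (ph2 s) s := fun s =>
    ((hasDerivAt_pow (ℓ-1) s).const_mul (σ * ℓ)).sub_const τ
  set E : ℝ → ℂ := fun s => Complex.exp (Complex.I * ((Λ * (σ * s^ℓ - τ * s) : ℝ):ℂ)) with hE
  have hEn : ∀ s, ‖E s‖ = 1 := fun s => by
    simp only [hE]; rw [mul_comm]; exact Complex.norm_exp_ofReal_mul_I _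
  have hEd : ∀ s, HasDerivAt E (E s * (Complex.I * ((Λ * ph s : ℝ):ℂ))) s := by
    intro s
    have e1 : HasDerivAt (fun s : ℝ => Λ * (σ * s^ℓ - τ * s)) (Λ * ph s) s := by
      have := (((hasDerivAt_pow ℓ s).const_mul σ).sub ((hasDerivAt_id s).const_mul τ)).const_mul Λ
      refine this.congr_deriv ?_
      simp only [hph]; ring
    exact (e1.ofReal_comp.const_mul Complex.I).cexp
  have hq : ∀ s, HasDerivAt (fun s => ph s * P s) (ph2 s * P s - 2 * ph s^2 * P s^2 * ph2 s) s := by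
    intro s
    have e1 : HasDerivAt (fun s => 1/Λ + ph s^2) (2 * ph s * ph2 s) s := by
      have := ((hphd s).pow 2).const_add (1/Λ)
      refine this.congr_deriv ?_
      ring
    have e2 := (hphd s).mul (e1.inv (hpos s).ne')
    refine e2.congr_deriv ?_
    rw [hPd]
    simp only [Pi.inv_apply]
    have := (hpos s).ne'
    field_simp
    ring
  have hΨ : ∀ s, HasDerivAt (fun s => E s * β s * ((ph s * P s : ℝ):ℂ))
      ((E s * (Complex.I * ((Λ * ph s : ℝ):ℂ)) * β s + E s * β' s) * ((ph s * P s : ℝ):ℂ) +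
        E s * β s * ((ph2 s * P s - 2 * ph s^2 * P s^2 * ph2 s : ℝ):ℂ)) s := fun s =>
    ((hEd s).mul (hβ s)).mul (hq s).ofReal_comp
  set X : ℝ → ℂ := fun s => E s * (Complex.I * (P s:ℂ) * β s - β' s * ((ph s * P s : ℝ):ℂ) -
    β s * ((ph2 s * P s - 2 * ph s^2 * P s^2 * ph2 s : ℝ):ℂ)) with hX
  have hΨ' : ∀ s, HasDerivAt (fun s => E s * β s * ((ph s * P s : ℝ):ℂ))
      (Complex.I * Λ * (E s * β s) - X s) s := by
    intro s
    refine (hΨ s).congr_deriv ?_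
    have e : Λ * ph s * (ph s * P s) = Λ - P s := by
      rw [hPd]
      have := (hpos s).ne'
      field_simp
      ring
    have e' : ((Λ * ph s : ℝ):ℂ) * ((ph s * P s : ℝ):ℂ) = Λ - P s := by
      rw [← Complex.ofReal_mul, e]; push_cast; ring
    simp only [hX]
    linear_combination (E s * Complex.I * β s) * e'
  have hPc : Continuous P := PP_cont hΛ
  have hβc : Continuous β := continuous_iff_continuousAt.2 fun s => (hβ s).continuousAt
  have hphc : Continuous ph := by fun_prop
  have hph2c : Continuous ph2 := by fun_prop
  have hEc : Continuous E := by fun_prop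
  have hXc : Continuous X := by fun_prop
  have c1 : Continuous (fun s => Complex.I * Λ * (E s * β s)) := by fun_prop
  have hI := intervalIntegral.integral_eq_sub_of_hasDerivAt (a := 1/2) (b := 2) (fun s _ => hΨ' s)
    ((c1.sub hXc).intervalIntegrable _ _)
  rw [h1, h2, intervalIntegral.integral_sub (c1.intervalIntegrable _ _) (hXc.intervalIntegrable _ _),
    intervalIntegral.integral_const_mul] at hI
  have hI2 : Complex.I * Λ * ∫ s in (1/2:ℝ)..2, E s * β s = ∫ s in (1/2:ℝ)..2, X s := by
    have : (Complex.I * Λ * ∫ s in (1/2:ℝ)..2, E s * β s) - ∫ s in (1/2:ℝ)..2, X s = 0 := by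
      rw [hI]; simp
    exact sub_eq_zero.1 this
  have hn : Λ * ‖∫ s in (1/2:ℝ)..2, E s * β s‖ = ‖∫ s in (1/2:ℝ)..2, X s‖ := by
    rw [← hI2, norm_mul, norm_mul]; simp [abs_of_pos hΛ]
  rw [hn]
  set D : ℝ := 2 + ℓ * ℓ * 2^ℓ with hD
  have hbd : ∀ s ∈ Ioc (1/2:ℝ) 2, ‖X s‖ ≤ B * D * (P s + 1) := by
    intro s hs
    have hP0 : 0 < P s := by rw [hPd]; exact inv_pos.2 (hpos s)
    have ht : ph s^2 * P s ≤ 1 := by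
      rw [hPd, ← div_eq_mul_inv, div_le_one (hpos s)]
      have : 0 < 1/Λ := by positivity
      linarith
    have a1 : |ph s * P s| ≤ P s + 1 := by
      rw [abs_mul, abs_of_pos hP0]
      have : |ph s| ≤ 1 + ph s^2 := by rw [← sq_abs]; nlinarith [sq_nonneg (|ph s| - 1)]
      nlinarith
    have a2 : |ph2 s| ≤ ℓ * ℓ * 2^ℓ := by
      have hs0 : 0 ≤ s := by linarith [hs.1]
      simp only [hph2]
      rw [abs_mul, abs_mul, hσ, abs_of_nonneg (by positivity : 0 ≤ (((ℓ-1:ℕ):ℝ) * s^(ℓ-1-1))), one_mul,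
        Nat.abs_cast, mul_assoc]
      have b1 : ((ℓ-1:ℕ):ℝ) ≤ ℓ := by exact_mod_cast Nat.sub_le _ _
      have b2 : s^(ℓ-1-1) ≤ 2^ℓ := by
        calc s^(ℓ-1-1) ≤ 2^(ℓ-1-1) := pow_le_pow_left₀ hs0 hs.2 _
          _ ≤ 2^ℓ := pow_le_pow_right₀ (by norm_num) (by omega)
      gcongr
    have a3 : |ph2 s * P s - 2 * ph s^2 * P s^2 * ph2 s| ≤ ℓ * ℓ * 2^ℓ * P s := by
      have : ph2 s * P s - 2 * ph s^2 * P s^2 * ph2 s = ph2 s * P s * (1 - 2 * (ph s^2 * P s)) := by ring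
      rw [this, abs_mul, abs_mul, abs_of_pos hP0]
      have h7 : |1 - 2 * (ph s^2 * P s)| ≤ 1 := by
        have : 0 ≤ ph s^2 * P s := by positivity
        rw [abs_le]; constructor <;> linarith
      calc |ph2 s| * P s * |1 - 2 * (ph s^2 * P s)| ≤ (ℓ * ℓ * 2^ℓ) * P s * 1 := by gcongr
        _ = _ := by ring
    simp only [hX]
    rw [norm_mul, hEn, one_mul]
    calc _ ≤ ‖Complex.I * (P s:ℂ) * β s‖ + ‖β' s * ((ph s * P s : ℝ):ℂ)‖ +
          ‖β s * ((ph2 s * P s - 2 * ph s^2 * P s^2 * ph2 s : ℝ):ℂ)‖ :=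
          (norm_sub_le _ _).trans (add_le_add_left (norm_sub_le _ _) _)
      _ ≤ P s * B + B * (P s + 1) + B * (ℓ * ℓ * 2^ℓ * P s) := by
          rw [norm_mul, norm_mul, norm_mul, norm_mul, Complex.norm_I, Complex.norm_real, Complex.norm_real,
            Complex.norm_real, Real.norm_eq_abs, Real.norm_eq_abs, Real.norm_eq_abs, abs_of_pos hP0, one_mul]
          gcongr
          · exact hB s
          · exact hB' s
          · exact hB s
      _ ≤ _ := by
          rw [hD]
          have : (0:ℝ) ≤ B * (ℓ * ℓ * 2^ℓ) := by positivity
          nlinarith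
  calc ‖∫ s in (1/2:ℝ)..2, X s‖ ≤ ∫ s in (1/2:ℝ)..2, B * D * (P s + 1) :=
        intervalIntegral.norm_integral_le_of_norm_le (by norm_num) (Filter.Eventually.of_forall hbd)
          (((hPc.add continuous_const).const_mul _).intervalIntegrable _ _)
    _ = B * D * ((∫ s in (1/2:ℝ)..2, P s) + 3/2) := by
        rw [intervalIntegral.integral_const_mul, intervalIntegral.integral_add (hPc.intervalIntegrable _ _) (by simp)]
        congr 2
        rw [intervalIntegral.integral_const]; norm_num
    _ ≤ B * D * (2 + ∫ s in (1/2:ℝ)..2, P s) := by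
        have : 0 ≤ B * D := by positivity
        exact mul_le_mul_of_nonneg_left (by linarith) this

open scoped FourierTransform ContDiff

lemma Ann.bdd {β : ℝ → ℂ} (h : Ann β) : ∃ B : ℝ, 0 ≤ B ∧ (∀ s, ‖β s‖ ≤ B) ∧ (∀ s, ‖deriv β s‖ ≤ B) := by
  have hc : HasCompactSupport β := by
    apply HasCompactSupport.intro (isCompact_Icc (a := -2) (b := 2))
    intro x hx
    apply h.2.2
    by_contra hlt
    push Not at hlt
    exact hx ⟨by linarith [(abs_lt.1 hlt).1], by linarith [(abs_lt.1 hlt).2]⟩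
  have hd : Continuous (deriv β) := h.1.continuous_deriv (by simp)
  obtain ⟨B1, hB1⟩ := h.1.continuous.bounded_above_of_compact_support hc
  obtain ⟨B2, hB2⟩ := hd.bounded_above_of_compact_support hc.deriv
  refine ⟨max B1 B2, (norm_nonneg _).trans ((hB1 0).trans (le_max_left _ _)), fun s => (hB1 s).trans (le_max_left _ _), fun s => (hB2 s).trans (le_max_right _ _)⟩

lemma osc2 {ℓ : ℕ} (hℓ : 2 ≤ ℓ) {β : ℝ → ℂ} (h : Ann β) : ∃ C : ℝ, 0 ≤ C ∧ ∀ Λ τ : ℝ, 1 ≤ Λ →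
    (Λ * ‖∫ s, Complex.exp (Complex.I * ((Λ * (s^ℓ - τ * s) : ℝ):ℂ)) * β s‖ ≤ C * √Λ) ∧
    ((|τ| ≤ ℓ * (1/2)^ℓ ∨ ℓ * 2^ℓ ≤ |τ|) →
      Λ * ‖∫ s, Complex.exp (Complex.I * ((Λ * (s^ℓ - τ * s) : ℝ):ℂ)) * β s‖ ≤ C) := by
  obtain ⟨B, hB0, hB, hB'⟩ := h.bdd
  set D : ℝ := B * (2 + ℓ * ℓ * 2^ℓ) with hD
  have hD0 : 0 ≤ D := by positivity
  refine ⟨2 * (D * (2 + 2^ℓ * π + 2 * 4^ℓ)), by positivity, fun Λ τ hΛ => ?_⟩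
  have hΛ0 : 0 < Λ := by linarith
  have hβd : ∀ s, HasDerivAt β (deriv β s) s := fun s =>
    (h.1.differentiable (by simp) s).hasDerivAt
  have hd : Continuous (deriv β) := h.1.continuous_deriv (by simp)
  set g : ℝ → ℂ := fun s => Complex.exp (Complex.I * ((Λ * (s^ℓ - τ * s) : ℝ):ℂ)) * β s with hg
  have hgc : Continuous g := by
    have := h.1.continuous
    fun_prop
  have hsplit : ∫ s, g s = (∫ s in (1/2:ℝ)..2, g (-s)) + ∫ s in (1/2:ℝ)..2, g s := by
    have e1 : ∫ s, g s = ∫ s in (-2:ℝ)..2, g s := by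
      rw [intervalIntegral.integral_of_le (by norm_num)]
      symm
      apply setIntegral_eq_integral_of_forall_compl_eq_zero
      intro s hs
      have : 2 ≤ |s| := by
        by_contra hlt
        push Not at hlt
        exact hs ⟨(abs_lt.1 hlt).1, (abs_lt.1 hlt).2.le⟩
      simp [hg, h.2.2 s this]
    have e2 : ∫ s in (-(1/2):ℝ)..(1/2), g s = 0 := by
      apply intervalIntegral.integral_zero_ae
      apply Filter.Eventually.of_forall
      intro s hs
      rw [uIoc_of_le (by norm_num)] at hs
      simp [hg, h.2.1 s (abs_le.2 ⟨hs.1.le, hs.2⟩)]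
    have e3 : ∫ s in (-2:ℝ)..(-(1/2)), g s = ∫ s in (1/2:ℝ)..2, g (-s) := by
      rw [intervalIntegral.integral_comp_neg]
    have i := fun a b => hgc.intervalIntegrable (μ := volume) a b
    rw [e1, ← intervalIntegral.integral_add_adjacent_intervals (i (-2) (-(1/2))) (i _ 2),
      ← intervalIntegral.integral_add_adjacent_intervals (i (-(1/2)) (1/2)) (i _ 2), e2, e3, zero_add]
  have hA := osc1 hℓ (σ := 1) (Λ := Λ) (τ := τ) (by simp) hΛ0 hβd hd
    (h.2.1 _ (by rw [abs_of_pos] <;> norm_num)) (h.2.2 _ (by simp)) hB hB'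
  have hβn : ∀ s, HasDerivAt (fun s => β (-s)) (-(deriv β (-s))) s := by
    intro s
    have := (hβd (-s)).scomp s (hasDerivAt_neg s)
    refine this.congr_deriv ?_
    simp
  have hN := osc1 hℓ (σ := (-1)^ℓ) (Λ := Λ) (τ := -τ) (by simp) hΛ0 hβn (by fun_prop)
    (h.2.1 _ (by rw [abs_neg, abs_of_pos] <;> norm_num)) (h.2.2 _ (by simp)) (fun s => hB (-s)) (fun s => by rw [norm_neg]; exact hB' (-s))
  have eA : (∫ s in (1/2:ℝ)..2, Complex.exp (Complex.I * ((Λ * (1 * s^ℓ - τ * s) : ℝ):ℂ)) * β s) = ∫ s in (1/2:ℝ)..2, g s := by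
    simp only [hg, one_mul]
  have eN : (∫ s in (1/2:ℝ)..2, Complex.exp (Complex.I * ((Λ * ((-1)^ℓ * s^ℓ - (-τ) * s) : ℝ):ℂ)) * β (-s)) = ∫ s in (1/2:ℝ)..2, g (-s) := by
    apply intervalIntegral.integral_congr
    intro s _
    simp only [hg]
    rw [neg_pow s ℓ]
    ring_nf
  rw [eA] at hA
  rw [eN] at hN
  have htot : Λ * ‖∫ s, g s‖ ≤ Λ * ‖∫ s in (1/2:ℝ)..2, g (-s)‖ + Λ * ‖∫ s in (1/2:ℝ)..2, g s‖ := by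
    rw [hsplit, ← mul_add]
    gcongr
    exact norm_add_le _ _
  have hsq : 1 ≤ √Λ := Real.one_le_sqrt.2 hΛ
  have hp4 : (0:ℝ) ≤ 2 * 4^ℓ := by positivity
  have hp2 : (0:ℝ) ≤ 2^ℓ * π := by positivity
  constructor
  · have j1 := J_all hℓ (σ := 1) (Λ := Λ) (τ := τ) (by simp) hΛ0
    have j2 := J_all hℓ (σ := (-1)^ℓ) (Λ := Λ) (τ := -τ) (by rw [← pow_mul, mul_comm, pow_mul]; simp) hΛ0
    have k : ∀ J, J ≤ 2^ℓ * (π * √Λ) → D * (2 + J) ≤ D * (2 + 2^ℓ * π + 2 * 4^ℓ) * √Λ := by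
      intro J hJ
      rw [mul_assoc D]
      apply mul_le_mul_of_nonneg_left _ hD0
      nlinarith
    have := k _ j1
    have := k _ j2
    linarith
  · intro hτ
    have j1 := J_off hℓ (σ := 1) (Λ := Λ) (τ := τ) (by simp) hΛ0 hτ
    have j2 := J_off hℓ (σ := (-1)^ℓ) (Λ := Λ) (τ := -τ) (by simp) hΛ0 (by rwa [abs_neg])
    have k : ∀ J, J ≤ 2 * 4^ℓ → D * (2 + J) ≤ D * (2 + 2^ℓ * π + 2 * 4^ℓ) := by
      intro J hJ
      apply mul_le_mul_of_nonneg_left _ hD0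
      linarith
    have := k _ j1
    have := k _ j2
    linarith

lemma norm_fourier_kern {ℓ : ℕ} (hℓ : 2 ≤ ℓ) (β : ℝ → ℂ) {R : ℝ} (hR : 0 < R) (ξ : ℝ) :
    ‖𝓕 (kern ℓ β R) ξ‖ = R * ‖∫ s, Complex.exp (Complex.I * ((R^ℓ * (s^ℓ - (2 * π * ξ / R^(ℓ-1)) * s) : ℝ):ℂ)) * β s‖ := by
  rw [Real.fourier_eq']
  have e1 := Measure.integral_comp_mul_left (fun x : ℝ => Complex.exp ((↑(-2 * π * inner ℝ x ξ) * Complex.I)) • kern ℓ β R x) R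
  rw [abs_of_pos (inv_pos.2 hR)] at e1
  have e2 : ∫ x : ℝ, Complex.exp ((↑(-2 * π * inner ℝ x ξ) * Complex.I)) • kern ℓ β R x =
     R • ∫ s, Complex.exp (Complex.I * ((R^ℓ * (s^ℓ - (2 * π * ξ / R^(ℓ-1)) * s) : ℝ):ℂ)) * β s := by
    have e3 : (∫ s, Complex.exp (Complex.I * ((R^ℓ * (s^ℓ - (2 * π * ξ / R^(ℓ-1)) * s) : ℝ):ℂ)) * β s) =
      ∫ s, (fun x : ℝ => Complex.exp ((↑(-2 * π * inner ℝ x ξ) * Complex.I)) • kern ℓ β R x) (R * s) := by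
      apply integral_congr_ae
      apply Filter.Eventually.of_forall
      intro s
      simp only [kern, smul_eq_mul]
      rw [mul_div_cancel_left₀ _ hR.ne', ← mul_assoc, ← Complex.exp_add]
      congr 2
      obtain ⟨m, rfl⟩ : ∃ m, ℓ = m + 1 := ⟨ℓ-1, by omega⟩
      have hr : R^(m+1) * (s^(m+1) - (2 * π * ξ / R^(m+1-1)) * s) = R^(m+1) * s^(m+1) - 2 * π * ξ * (R * s) := by
        rw [Nat.add_sub_cancel]
        field_simp
        ring
      rw [hr]
      have : inner ℝ (R * s) ξ = ξ * (R * s) := by simp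
      rw [this]
      push_cast
      ring
    rw [e3, e1, smul_smul, mul_inv_cancel₀ hR.ne', one_smul]
  rw [e2, norm_smul, Real.norm_of_nonneg hR.le]

lemma four_sum {ℓ : ℕ} (hℓ : 2 ≤ ℓ) {β : ℝ → ℂ} (h : Ann β) : ∃ C : ℝ, 0 ≤ C ∧ ∀ (K : ℕ) (ξ : ℝ),
    ∑ k ∈ Finset.range K, (2:ℝ)^(k*(ℓ-2)) * ‖𝓕 (kern ℓ β (2^k)) ξ‖^2 ≤ C := by
  obtain ⟨C, hC0, hC⟩ := osc2 hℓ h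
  refine ⟨C^2 * (2 + 2 * ℓ), by positivity, fun K ξ => ?_⟩
  set τ : ℕ → ℝ := fun k => 2 * π * ξ / (2^k)^(ℓ-1) with hτ
  set bad : ℕ → Prop := fun k => ¬ (|τ k| ≤ ℓ * (1/2)^ℓ ∨ ℓ * 2^ℓ ≤ |τ k|) with hbad
  classical
  have hterm : ∀ k, (2:ℝ)^(k*(ℓ-2)) * ‖𝓕 (kern ℓ β (2^k)) ξ‖^2 ≤ C^2 * ((1/2)^k + if bad k then 1 else 0) := by
    intro k
    have hR : (0:ℝ) < 2^k := by positivity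
    rw [norm_fourier_kern hℓ β hR]
    set Λ : ℝ := (2^k)^ℓ with hΛ
    have hΛ1 : 1 ≤ Λ := one_le_pow₀ (one_le_pow₀ (by norm_num))
    set I := ‖∫ s, Complex.exp (Complex.I * ((Λ * (s^ℓ - (2 * π * ξ / (2^k)^(ℓ-1)) * s) : ℝ):ℂ)) * β s‖ with hI
    have e : (2:ℝ)^(k*(ℓ-2)) * (2^k * I)^2 = Λ * I^2 := by
      rw [mul_pow, ← mul_assoc, hΛ, pow_mul, ← pow_add]
      congr 2; omega
    rw [e]
    obtain ⟨h1, h2⟩ := hC Λ (τ k) hΛ1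
    have hI0 : 0 ≤ I := norm_nonneg _
    have hΛ0 : 0 < Λ := by linarith
    change Λ * I ≤ _ at h1
    change _ → Λ * I ≤ _ at h2
    by_cases hb : bad k
    · rw [if_pos hb]
      have h3 : (Λ * I)^2 ≤ (C * √Λ)^2 := by gcongr
      rw [mul_pow, mul_pow, Real.sq_sqrt hΛ0.le] at h3
      have h4 : Λ * I^2 ≤ C^2 := by
        have : Λ * (Λ * I^2) ≤ Λ * C^2 := by nlinarith
        exact le_of_mul_le_mul_left this hΛ0
      have : 0 ≤ C^2 * (1/2)^k := by positivity
      nlinarith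
    · rw [if_neg hb, add_zero]
      have h3 := h2 (not_not.1 hb)
      have h4 : (Λ * I)^2 ≤ C^2 := by gcongr
      have h5 : (1/2:ℝ)^k * Λ ≥ 1 := by
        rw [hΛ]
        calc (1/2:ℝ)^k * (2^k)^ℓ ≥ (1/2:ℝ)^k * (2^k)^1 := by
              gcongr
              · exact one_le_pow₀ (by norm_num)
              · omega
          _ = 1 := by rw [pow_one, ← mul_pow]; norm_num
      calc Λ * I^2 ≤ ((1/2:ℝ)^k * Λ) * (Λ * I^2) := le_mul_of_one_le_left (by positivity) h5
        _ = (Λ * I)^2 * (1/2)^k := by ring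
        _ ≤ C^2 * (1/2)^k := by gcongr
  have hcard : ((Finset.range K).filter bad).card ≤ 2 * ℓ := by
    rcases ((Finset.range K).filter bad).eq_empty_or_nonempty with he | hne
    · rw [he]; simp
    · set m := ((Finset.range K).filter bad).min' hne with hm
      have hmb : bad m := (Finset.mem_filter.1 (Finset.min'_mem _ hne)).2
      have : (Finset.range K).filter bad ⊆ Finset.Ico m (m + 2 * ℓ) := by
        intro k hk
        have hmk : m ≤ k := Finset.min'_le _ _ hk
        have hkb : bad k := (Finset.mem_filter.1 hk).2
        rw [Finset.mem_Ico]
        refine ⟨hmk, ?_⟩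
        by_contra hlt
        push Not at hlt
        simp only [hbad] at hmb hkb
        push Not at hmb hkb
        have hl : (0:ℝ) < ℓ := by exact_mod_cast (by omega : 0 < ℓ)
        have h1 : |τ m| = (2^(k-m))^(ℓ-1) * |τ k| := by
          simp only [hτ]
          have : (2:ℝ)^k = 2^(k-m) * 2^m := by rw [← pow_add]; congr 1; omega
          rw [this, mul_pow, abs_div, abs_div, abs_of_pos (by positivity : (0:ℝ) < (2^m)^(ℓ-1)),
            abs_of_pos (by positivity : (0:ℝ) < (2^(k-m))^(ℓ-1) * (2^m)^(ℓ-1))]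
          field_simp
        have h2 : (2:ℝ)^(2*ℓ) ≤ (2^(k-m))^(ℓ-1) := by
          rw [← pow_mul]
          apply pow_le_pow_right₀ (by norm_num)
          calc 2 * ℓ ≤ (k - m) * 1 := by omega
            _ ≤ _ := Nat.mul_le_mul_left _ (by omega)
        have h3 : (2:ℝ)^(2*ℓ) * (ℓ * (1/2)^ℓ) ≤ (2^(k-m))^(ℓ-1) * |τ k| := by
          gcongr
          exact hkb.1.le
        have h4 : (2:ℝ)^(2*ℓ) * (ℓ * (1/2)^ℓ) = ℓ * 2^ℓ := by
          have : (2:ℝ)^ℓ * (1/2)^ℓ = 1 := by rw [← mul_pow]; norm_num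
          rw [two_mul, pow_add]
          linear_combination (2:ℝ)^ℓ * ℓ * this
        rw [h4, ← h1] at h3
        linarith [hmb.2]
      calc _ ≤ _ := Finset.card_le_card this
        _ = 2 * ℓ := by simp
  calc _ ≤ ∑ k ∈ Finset.range K, C^2 * ((1/2)^k + if bad k then 1 else 0) := Finset.sum_le_sum fun k _ => hterm k
    _ = C^2 * ((∑ k ∈ Finset.range K, (1/2:ℝ)^k) + ((Finset.range K).filter bad).card) := by
        rw [← Finset.mul_sum, Finset.sum_add_distrib, Finset.sum_boole]
    _ ≤ C^2 * (2 + 2 * ℓ) := by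
        have h1 : ∑ k ∈ Finset.range K, (1/2:ℝ)^k ≤ 2 := by
          have := Summable.sum_le_tsum (Finset.range K) (fun k _ => by positivity) summable_geometric_two
          rwa [tsum_geometric_two] at this
        have h2 : (((Finset.range K).filter bad).card : ℝ) ≤ 2 * ℓ := by exact_mod_cast hcard
        gcongr

open scoped FourierTransform ContDiff

lemma Ann.cs {β : ℝ → ℂ} (h : Ann β) : HasCompactSupport β := by
  apply HasCompactSupport.intro (isCompact_Icc (a := -2) (b := 2))
  intro x hx
  apply h.2.2
  by_contra hlt
  push Not at hlt
  exact hx ⟨by linarith [(abs_lt.1 hlt).1], by linarith [(abs_lt.1 hlt).2]⟩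

lemma kern_smooth (ℓ : ℕ) {β : ℝ → ℂ} (h : ContDiff ℝ ∞ β) (R : ℝ) : ContDiff ℝ ∞ (kern ℓ β R) := by
  unfold kern
  have h1 : ContDiff ℝ ∞ (fun x : ℝ => β (x / R)) := h.comp (contDiff_id.div_const R)
  have h2 : ContDiff ℝ ∞ (fun x : ℝ => (x:ℂ)) := Complex.ofRealCLM.contDiff
  exact ((contDiff_const.mul (h2.pow ℓ)).cexp).mul h1

lemma kern_cs (ℓ : ℕ) {β : ℝ → ℂ} (h : HasCompactSupport β) {R : ℝ} (hR : R ≠ 0) :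
    HasCompactSupport (kern ℓ β R) := by
  have h1 : HasCompactSupport (fun x : ℝ => β (x / R)) := by
    have := h.comp_homeomorph (Homeomorph.mulRight₀ R⁻¹ (inv_ne_zero hR))
    simp only [div_eq_mul_inv]
    exact this
  exact h1.mul_left

/-- the squared norm of a piece -/
def qq (ℓ : ℕ) (β : ℝ → ℂ) (F : ℝ → ℂ) (k : ℕ) : ℝ≥0∞ := ∫⁻ x, ‖cv F (kern ℓ β (2^k)) x‖ₑ^2

lemma qq_sum {ℓ : ℕ} (hℓ : 2 ≤ ℓ) {β : ℝ → ℂ} (h : Ann β) : ∃ C : ℝ≥0∞, C ≠ ⊤ ∧ ∀ F, MemLp F 2 →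
    ∀ K, ∑ k ∈ Finset.range K, 2^(k*(ℓ-2)) * qq ℓ β F k ≤ C * ∫⁻ x, ‖F x‖ₑ^2 := by
  obtain ⟨C, hC0, hC⟩ := four_sum hℓ h
  refine ⟨ENNReal.ofReal C, ENNReal.ofReal_ne_top, fun F hF K => ?_⟩
  refine mult (Finset.range K) (fun k => kern ℓ β (2^k)) (fun k _ => kern_cs ℓ h.cs (by positivity))
    (fun k _ => kern_smooth ℓ h.1 _) (fun k => 2^(k*(ℓ-2))) (fun k => by simp) _ ENNReal.ofReal_ne_top ?_ F hF
  intro ξ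
  refine le_trans (le_of_eq ?_) (ENNReal.ofReal_le_ofReal (hC K ξ))
  rw [ENNReal.ofReal_sum_of_nonneg (fun k _ => by positivity)]
  apply Finset.sum_congr rfl
  intro k _
  rw [ENNReal.ofReal_mul (by positivity), ← enorm_sq_eq, ENNReal.ofReal_pow (by norm_num)]
  simp

lemma single {A : ℝ → ℂ} (hA : HasCompactSupport A) (hA' : ContDiff ℝ ∞ A) : ∃ C : ℝ≥0∞, C ≠ ⊤ ∧ ∀ F, MemLp F 2 →
    ∫⁻ x, ‖cv F A x‖ₑ^2 ≤ C * ∫⁻ x, ‖F x‖ₑ^2 := by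
  have hi : Integrable A := hA'.continuous.integrable_of_hasCompactSupport hA
  refine ⟨(∫⁻ x, ‖A x‖ₑ)^2, ENNReal.pow_ne_top hi.2.ne, fun F hF => ?_⟩
  have := mult (Finset.range 1) (fun _ => A) (fun _ _ => hA) (fun _ _ => hA') (fun _ => 1) (by simp)
    ((∫⁻ x, ‖A x‖ₑ)^2) (ENNReal.pow_ne_top hi.2.ne) ?_ F hF
  · simpa using this
  · intro ξ
    simp only [Finset.range_one, Finset.sum_singleton, one_mul]
    gcongr
    rw [Real.fourier_eq']
    refine (enorm_integral_le_lintegral_enorm _).trans (le_of_eq ?_)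
    apply lintegral_congr
    intro x
    rw [enorm_smul]
    have : ‖Complex.exp ((↑(-2 * π * inner ℝ x ξ) * Complex.I))‖ₑ = 1 := by
      rw [← ofReal_norm, Complex.norm_exp_ofReal_mul_I]; simp
    rw [this, one_mul]

lemma cv_deriv {F A : ℝ → ℂ} (hF : MemLp F 2) (hA : HasCompactSupport A) (hA' : ContDiff ℝ ∞ A) (x : ℝ) :
    HasDerivAt (cv F A) (cv F (deriv A) x) x := by
  have hl : LocallyIntegrable F volume := hF.locallyIntegrable (by norm_num)
  exact hA.hasDerivAt_convolution_right (ContinuousLinearMap.mul ℝ ℂ) hl (hA'.of_le (by simp)) x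

lemma cv_cont {F A : ℝ → ℂ} (hF : MemLp F 2) (hA : HasCompactSupport A) (hA' : ContDiff ℝ ∞ A) :
    Continuous (cv F A) :=
  continuous_iff_continuousAt.2 fun x => (cv_deriv hF hA hA' x).continuousAt

lemma cv_lin {F A B : ℝ → ℂ} (hF : MemLp F 2) (hA : HasCompactSupport A) (hA' : Continuous A)
    (hB : HasCompactSupport B) (hB' : Continuous B) (c d : ℂ) (x : ℝ) :
    cv F (fun y => c * A y + d * B y) x = c * cv F A x + d * cv F B x := by
  have key : ∀ A : ℝ → ℂ, HasCompactSupport A → Continuous A → Integrable (fun t => F t * A (x - t)) := by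
    intro A hA hA'
    have h1 : Continuous (fun t => A (x - t)) := by fun_prop
    have h2 : HasCompactSupport (fun t => A (x - t)) :=
      hA.comp_homeomorph (Homeomorph.subLeft x)
    have h3 : MemLp (fun t => A (x - t)) 2 := h1.memLp_of_hasCompactSupport h2
    exact hF.integrable_mul h3
  unfold cv
  rw [← integral_const_mul, ← integral_const_mul, ← integral_add ((key A hA hA').const_mul _) ((key B hB hB').const_mul _)]
  apply integral_congr_ae
  apply Filter.Eventually.of_forall
  intro t
  simp only
  ring

/-- multiplication by the phase derivative -/
def XX (ℓ : ℕ) (β : ℝ → ℂ) (s : ℝ) : ℂ := (Complex.I * ℓ * (s:ℂ)^(ℓ-1)) * β s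

lemma Ann.XX {ℓ : ℕ} {β : ℝ → ℂ} (h : Ann β) : Ann (XX ℓ β) := by
  refine ⟨?_, fun s hs => by simp [_root_.XX, h.2.1 s hs], fun s hs => by simp [_root_.XX, h.2.2 s hs]⟩
  have h2 : ContDiff ℝ ∞ (fun x : ℝ => (x:ℂ)) := Complex.ofRealCLM.contDiff
  exact (contDiff_const.mul (h2.pow _)).mul h.1

lemma Ann.deriv {β : ℝ → ℂ} (h : Ann β) : Ann (deriv β) := by
  refine ⟨?_, ?_, ?_⟩
  · have := h.1
    exact (contDiff_infty_iff_deriv.1 h.1).2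
  · have hc : Continuous (_root_.deriv β) := h.1.continuous_deriv (by simp)
    have h1 : EqOn (_root_.deriv β) 0 (Ioo (-(1/2)) (1/2)) := by
      intro s hs
      have : β =ᶠ[nhds s] fun _ => 0 := by
        filter_upwards [Ioo_mem_nhds hs.1 hs.2] with t ht
        exact h.2.1 t (abs_le.2 ⟨ht.1.le, ht.2.le⟩)
      rw [this.deriv_eq]; simp
    have h2 := h1.closure hc continuous_zero
    rw [closure_Ioo (by norm_num)] at h2
    intro s hs
    exact h2 ⟨(abs_le.1 hs).1, (abs_le.1 hs).2⟩
  · have hc : Continuous (_root_.deriv β) := h.1.continuous_deriv (by simp)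
    have h1 : EqOn (_root_.deriv β) 0 (Ioi 2) := by
      intro s hs
      have : β =ᶠ[nhds s] fun _ => 0 := by
        filter_upwards [Ioi_mem_nhds hs] with t ht
        exact h.2.2 t (le_trans (le_of_lt ht) (le_abs_self _))
      rw [this.deriv_eq]; simp
    have h1' : EqOn (_root_.deriv β) 0 (Iio (-2)) := by
      intro s hs
      have : β =ᶠ[nhds s] fun _ => 0 := by
        filter_upwards [Iio_mem_nhds hs] with t ht
        exact h.2.2 t (le_trans (by linarith [mem_Iio.1 ht]) (neg_le_abs _))
      rw [this.deriv_eq]; simp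
    have h2 := h1.closure hc continuous_zero
    have h2' := h1'.closure hc continuous_zero
    rw [closure_Ioi] at h2
    rw [closure_Iio] at h2'
    intro s hs
    rcases le_abs.1 hs with h | h
    · exact h2 h
    · exact h2' (by simp; linarith)

lemma kern_deriv {ℓ : ℕ} (hℓ : 2 ≤ ℓ) {β : ℝ → ℂ} (h : Ann β) (k : ℕ) :
    deriv (kern ℓ β (2^k)) = fun x => ((2:ℂ)^(k*(ℓ-1))) * kern ℓ (XX ℓ β) (2^k) x +
      ((2:ℂ)^k)⁻¹ * kern ℓ (deriv β) (2^k) x := by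
  ext x
  have h1 : HasDerivAt (fun x : ℝ => Complex.exp (Complex.I * (x:ℂ)^ℓ))
      (Complex.exp (Complex.I * (x:ℂ)^ℓ) * (Complex.I * (ℓ * (x:ℂ)^(ℓ-1)))) x := by
    have := ((hasDerivAt_pow ℓ (x:ℂ)).const_mul Complex.I).cexp.comp_ofReal
    exact this
  have hβd : HasDerivAt β (deriv β (x/2^k)) (x/2^k) :=
    (h.1.differentiable (by simp) _).hasDerivAt
  have h2 : HasDerivAt (fun x : ℝ => β (x/2^k)) (((1/2^k : ℝ)) • deriv β (x/2^k)) x :=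
    HasDerivAt.scomp x hβd ((hasDerivAt_id x).div_const (2^k))
  have h3 := (h1.mul h2).deriv
  refine Eq.trans h3 ?_
  simp only [kern, XX]
  rw [Complex.real_smul]
  push_cast
  rw [div_pow, ← pow_mul]
  have : (2:ℂ)^(k*(ℓ-1)) ≠ 0 := pow_ne_zero _ two_ne_zero
  field_simp

lemma qq_deriv {ℓ : ℕ} (hℓ : 2 ≤ ℓ) {β : ℝ → ℂ} (h : Ann β) {F : ℝ → ℂ} (hF : MemLp F 2) (k : ℕ) :
    ∫⁻ x, ‖cv F (deriv (kern ℓ β (2^k))) x‖ₑ^2 ≤ 4 * ((2^(k*(ℓ-1)))^2 * qq ℓ (XX ℓ β) F k + qq ℓ (deriv β) F k) := by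
  have hk : (2:ℝ)^k ≠ 0 := by positivity
  have hm : ∀ β, Ann β → Measurable (fun x => ‖cv F (kern ℓ β (2^k)) x‖ₑ^2) := fun β hβ =>
    (cv_cont hF (kern_cs ℓ hβ.cs hk) (kern_smooth ℓ hβ.1 _)).measurable.enorm.pow_const 2
  have hpt : ∀ x, ‖cv F (deriv (kern ℓ β (2^k))) x‖ₑ^2 ≤ 4 * ((2^(k*(ℓ-1)))^2 * ‖cv F (kern ℓ (XX ℓ β) (2^k)) x‖ₑ^2 +
      ‖cv F (kern ℓ (deriv β) (2^k)) x‖ₑ^2) := by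
    intro x
    rw [kern_deriv hℓ h, cv_lin hF (kern_cs ℓ h.XX.cs hk) (kern_smooth ℓ h.XX.1 _).continuous
      (kern_cs ℓ h.deriv.cs hk) (kern_smooth ℓ h.deriv.1 _).continuous]
    refine (pow_le_pow_left' (enorm_add_le _ _) 2).trans ?_
    refine (sq_add_le _ _).trans ?_
    rw [enorm_mul, enorm_mul, mul_pow, mul_pow]
    have e1 : ‖(2:ℂ)^(k*(ℓ-1))‖ₑ = 2^(k*(ℓ-1)) := by
      rw [enorm_pow]; congr 1
      rw [← ofReal_norm]; simp
    have e2 : ‖((2:ℂ)^k)⁻¹‖ₑ ≤ 1 := by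
      rw [← ofReal_norm, ← ENNReal.ofReal_one]
      apply ENNReal.ofReal_le_ofReal
      rw [norm_inv, norm_pow]
      apply inv_le_one_of_one_le₀
      apply one_le_pow₀; simp
    rw [e1]
    gcongr
    calc _ ≤ 1^2 * ‖cv F (kern ℓ (deriv β) (2^k)) x‖ₑ^2 := by gcongr
      _ = _ := by simp
  have hm2 : Measurable (fun x => (2^(k*(ℓ-1)))^2 * ‖cv F (kern ℓ (XX ℓ β) (2^k)) x‖ₑ^2) := (hm _ h.XX).const_mul _
  calc _ ≤ ∫⁻ x, 4 * ((2^(k*(ℓ-1)))^2 * ‖cv F (kern ℓ (XX ℓ β) (2^k)) x‖ₑ^2 +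
      ‖cv F (kern ℓ (deriv β) (2^k)) x‖ₑ^2) := lintegral_mono hpt
    _ = _ := by
      rw [lintegral_const_mul' _ _ (by simp), lintegral_add_left hm2, lintegral_const_mul _ (hm _ h.XX)]
      rfl

open scoped FourierTransform ContDiff

lemma EG_lin {g h : ℝ → ℂ} (hg : LocallyIntegrable g) (hh : LocallyIntegrable h) (n : ℕ) (c d : ℂ) (x : ℝ) :
    EG n (fun y => c * g y + d * h y) x = c * EG n g x + d * EG n h x := by
  rw [EG, EG, EG, integral_add ((integrableOn_dI hg n x).const_mul c) ((integrableOn_dI hh n x).const_mul d),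
    integral_const_mul, integral_const_mul]
  ring

lemma qq_EG {ℓ : ℕ} (hℓ : 2 ≤ ℓ) {a b : ℝ → ℂ} (ha : Ann a) (hb : Ann b) (hab : XX ℓ b = a) {F : ℝ → ℂ}
    (hF : MemLp F 2) {n k : ℕ} (hn : n ≤ k*(ℓ-1)) :
    ∫⁻ x, ‖EG n (cv F (kern ℓ a (2^k))) x‖ₑ^2 ≤
      5000 * (2⁻¹)^(k*(ℓ-1)-n) * (qq ℓ a F k + qq ℓ b F k + qq ℓ (deriv b) F k) := by
  set κ := k*(ℓ-1) with hκ
  have hk : (2:ℝ)^k ≠ 0 := by positivity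
  set g := cv F (kern ℓ a (2^k)) with hg
  set h := cv F (kern ℓ b (2^k)) with hh
  set r := cv F (kern ℓ (deriv b) (2^k)) with hr
  have hc : ∀ β, Ann β → Continuous (cv F (kern ℓ β (2^k))) := fun β hβ =>
    (cv_cont hF (kern_cs ℓ hβ.cs hk) (kern_smooth ℓ hβ.1 _))
  have hgc := hc a ha
  have hrc := hc _ hb.deriv
  set h' := cv F (deriv (kern ℓ b (2^k))) with hh'
  have e : ∀ x, h' x = (2:ℂ)^κ * g x + ((2:ℂ)^k)⁻¹ * r x := by
    intro x
    rw [hh', kern_deriv hℓ hb, cv_lin hF (kern_cs ℓ hb.XX.cs hk) (kern_smooth ℓ hb.XX.1 _).continuous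
      (kern_cs ℓ hb.deriv.cs hk) (kern_smooth ℓ hb.deriv.1 _).continuous, hab]
  have hd : ∀ x, HasDerivAt h (h' x) x := fun x => cv_deriv hF (kern_cs ℓ hb.cs hk) (kern_smooth ℓ hb.1 _) x
  have hh'c : Continuous h' := by
    have : h' = fun x => (2:ℂ)^κ * g x + ((2:ℂ)^k)⁻¹ * r x := funext e
    rw [this]; fun_prop
  have hL2 := L2 hd hh'c hn
  have hq := qq_deriv hℓ hb hF k
  rw [hab] at hq
  have hinv : ((2:ℝ≥0∞)^κ)⁻¹^2 * (2^κ)^2 = 1 := by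
    rw [← mul_pow, ENNReal.inv_mul_cancel (by simp) (by simp), one_pow]
  have hinv1 : ((2:ℝ≥0∞)^κ)⁻¹^2 ≤ 1 := by
    apply pow_le_one'
    rw [ENNReal.inv_le_one]
    exact one_le_pow₀ (by norm_num)
  set Q := qq ℓ a F k + qq ℓ b F k + qq ℓ (deriv b) F k with hQ
  have ha' : qq ℓ a F k ≤ Q := le_self_add.trans le_self_add
  have hb' : qq ℓ b F k ≤ Q := le_add_self.trans le_self_add
  have hdb' : qq ℓ (deriv b) F k ≤ Q := le_add_self
  have h2 : ∫⁻ x, ‖EG n h' x‖ₑ^2 ≤ 32 * 2^(n+κ) * (9 * Q) := by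
    refine hL2.trans ?_
    gcongr 32 * 2^(n+κ) * ?_
    calc (∫⁻ x, ‖h x‖ₑ^2) + ((2^κ)⁻¹)^2 * ∫⁻ x, ‖h' x‖ₑ^2
        ≤ Q + ((2^κ)⁻¹)^2 * (4 * ((2^κ)^2 * qq ℓ a F k + qq ℓ (deriv b) F k)) := by
          gcongr ?_ + _ * ?_
          exact hb'
      _ = Q + 4 * ((((2:ℝ≥0∞)^κ)⁻¹^2 * (2^κ)^2) * qq ℓ a F k + ((2:ℝ≥0∞)^κ)⁻¹^2 * qq ℓ (deriv b) F k) := by ring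
      _ ≤ Q + 4 * (1 * Q + 1 * Q) := by rw [hinv]; gcongr
      _ = 9 * Q := by ring
  have hr2 : ∫⁻ x, ‖EG n r x‖ₑ^2 ≤ Q := (L0 hrc.measurable.aemeasurable n).trans hdb'
  have hpt : ∀ x, ‖EG n g x‖ₑ^2 ≤ ((2:ℝ≥0∞)^κ)⁻¹^2 * (4 * (‖EG n h' x‖ₑ^2 + ‖EG n r x‖ₑ^2)) := by
    intro x
    have e1 : EG n g x = ((2:ℂ)^κ)⁻¹ * (EG n h' x - ((2:ℂ)^k)⁻¹ * EG n r x) := by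
      have : EG n h' x = (2:ℂ)^κ * EG n g x + ((2:ℂ)^k)⁻¹ * EG n r x := by
        rw [← EG_lin hgc.locallyIntegrable hrc.locallyIntegrable]
        congr 1; exact funext e
      rw [this]
      have : (2:ℂ)^κ ≠ 0 := pow_ne_zero _ two_ne_zero
      field_simp
      ring
    have e3 : ‖((2:ℂ)^κ)⁻¹‖ₑ = (2^κ)⁻¹ := by
      rw [enorm_inv (pow_ne_zero _ two_ne_zero), enorm_pow]; congr 2
      rw [← ofReal_norm]; simp
    have e2 : ‖((2:ℂ)^k)⁻¹‖ₑ ≤ 1 := by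
      rw [← ofReal_norm, ← ENNReal.ofReal_one]
      apply ENNReal.ofReal_le_ofReal
      rw [norm_inv, norm_pow]
      apply inv_le_one_of_one_le₀
      apply one_le_pow₀; simp
    rw [e1, enorm_mul, mul_pow, e3]
    gcongr
    refine le_trans ?_ (sq_add_le _ _)
    gcongr
    refine (enorm_sub_le).trans ?_
    gcongr
    rw [enorm_mul]
    exact mul_le_of_le_one_left' e2
  have hm1 : Measurable (fun x => ‖EG n h' x‖ₑ^2) := (Lev.EG.measurable).enorm.pow_const 2
  calc _ ≤ ∫⁻ x, ((2:ℝ≥0∞)^κ)⁻¹^2 * (4 * (‖EG n h' x‖ₑ^2 + ‖EG n r x‖ₑ^2)) := lintegral_mono hpt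
    _ = ((2:ℝ≥0∞)^κ)⁻¹^2 * (4 * ((∫⁻ x, ‖EG n h' x‖ₑ^2) + ∫⁻ x, ‖EG n r x‖ₑ^2)) := by
        rw [lintegral_const_mul' _ _ (by simp), lintegral_const_mul' _ _ (by simp), lintegral_add_left hm1]
    _ ≤ ((2:ℝ≥0∞)^κ)⁻¹^2 * (4 * ((32 * 2^(n+κ) * (9 * Q)) + 2^(n+κ) * Q)) := by
        gcongr ((2:ℝ≥0∞)^κ)⁻¹^2 * (4 * (?_ + ?_))
        · refine hr2.trans ?_
          exact le_mul_of_one_le_left' (one_le_pow₀ (by norm_num))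
    _ = 1156 * (((2:ℝ≥0∞)^κ)⁻¹^2 * 2^(n+κ)) * Q := by ring
    _ ≤ 5000 * (2⁻¹)^(κ-n) * Q := by
        gcongr
        · norm_num
        · have : κ = (κ - n) + n := by omega
          rw [← ENNReal.inv_pow]
          set m := κ - n
          rw [this, show n + (m + n) = m + 2 * n by ring, ENNReal.inv_pow, ENNReal.inv_pow, ← pow_mul]
          have h6 : ∀ j : ℕ, (2:ℝ≥0∞)⁻¹^j * 2^j = 1 := fun j => by
            rw [← mul_pow, ENNReal.inv_mul_cancel (by simp) (by simp), one_pow]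
          calc (2⁻¹:ℝ≥0∞)^((m+n)*2) * 2^(m + 2 * n) = 2⁻¹^m * (2⁻¹^(m+2*n) * 2^(m+2*n)) := by
                rw [← mul_assoc, ← pow_add]; congr 2; ring
            _ ≤ _ := by rw [h6, mul_one]

lemma qq_DD {ℓ : ℕ} (hℓ : 2 ≤ ℓ) {a b : ℝ → ℂ} (ha : Ann a) (hb : Ann b) (hab : XX ℓ b = a) {F : ℝ → ℂ}
    (hF : MemLp F 2) (n k : ℕ) :
    2^(n - k*(ℓ-1)) * ∫⁻ x, ‖DD (cv F (kern ℓ a (2^k))) n x‖ₑ^2 ≤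
      40000 * (2⁻¹)^((n - k*(ℓ-1)) + (k*(ℓ-1)-n)) *
        (qq ℓ a F k + qq ℓ b F k + qq ℓ (deriv b) F k + qq ℓ (XX ℓ a) F k + qq ℓ (deriv a) F k) := by
  set κ := k*(ℓ-1) with hκ
  have hk : (2:ℝ)^k ≠ 0 := by positivity
  set g := cv F (kern ℓ a (2^k)) with hg
  set Q := qq ℓ a F k + qq ℓ b F k + qq ℓ (deriv b) F k with hQ
  set Q' := Q + qq ℓ (XX ℓ a) F k + qq ℓ (deriv a) F k with hQ'
  have hQQ : Q ≤ Q' := le_self_add.trans le_self_add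
  rcases le_or_gt n κ with h | h
  · have h0 : n - κ = 0 := by omega
    rw [h0, pow_zero, one_mul, zero_add]
    rcases n with _ | m
    · change ∫⁻ x, ‖EG 0 g x‖ₑ^2 ≤ _
      refine (qq_EG hℓ ha hb hab hF h).trans ?_
      gcongr
      norm_num
    · have h1 := qq_EG hℓ ha hb hab hF h
      have h2 := qq_EG hℓ ha hb hab hF (n := m) (k := k) (by omega)
      have hm1 : Measurable (fun x => ‖EG (m+1) g x‖ₑ^2) := (Lev.EG.measurable).enorm.pow_const 2
      have h3 : (2⁻¹:ℝ≥0∞)^(κ-m) ≤ 2⁻¹^(κ-(m+1)) :=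
        pow_le_pow_right_of_le_one' (by rw [ENNReal.inv_le_one]; norm_num) (by omega)
      calc _ ≤ ∫⁻ x, 4 * (‖EG (m+1) g x‖ₑ^2 + ‖EG m g x‖ₑ^2) := by
            apply lintegral_mono
            intro x
            change ‖EG (m+1) g x - EG m g x‖ₑ^2 ≤ _
            exact (pow_le_pow_left' enorm_sub_le 2).trans (sq_add_le _ _)
        _ = 4 * ((∫⁻ x, ‖EG (m+1) g x‖ₑ^2) + ∫⁻ x, ‖EG m g x‖ₑ^2) := by
            rw [lintegral_const_mul' _ _ (by simp), lintegral_add_left hm1]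
        _ ≤ 4 * (5000 * 2⁻¹^(κ-(m+1)) * Q + 5000 * 2⁻¹^(κ-m) * Q) := by
            gcongr 4 * (?_ + ?_)
        _ ≤ 4 * (5000 * 2⁻¹^(κ-(m+1)) * Q + 5000 * 2⁻¹^(κ-(m+1)) * Q) := by gcongr
        _ = 40000 * 2⁻¹^(κ-(m+1)) * Q := by ring
        _ ≤ _ := by gcongr
  · obtain ⟨m, rfl⟩ : ∃ m, n = (κ + m) + 1 := ⟨n - κ - 1, by omega⟩
    have hd : ∀ x, HasDerivAt g (cv F (deriv (kern ℓ a (2^k))) x) x := fun x =>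
      cv_deriv hF (kern_cs ℓ ha.cs hk) (kern_smooth ℓ ha.1 _) x
    have hc : Continuous (cv F (deriv (kern ℓ a (2^k)))) := by
      refine cv_cont hF (kern_cs ℓ ha.cs hk).deriv ?_
      exact (contDiff_infty_iff_deriv.1 (kern_smooth ℓ ha.1 _)).2
    have h1 := L1 hd hc (κ + m)
    have h2 := qq_deriv hℓ ha hF k
    have e1 : κ + m + 1 - κ = m + 1 := by omega
    have e2 : κ - (κ + m + 1) = 0 := by omega
    rw [e1, e2, add_zero]
    have hS : ((2:ℝ≥0∞)^κ)^2 * qq ℓ (XX ℓ a) F k + qq ℓ (deriv a) F k ≤ (2^κ)^2 * (2 * Q') := by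
      have h3 : qq ℓ (XX ℓ a) F k ≤ Q' := le_add_self.trans le_self_add
      have h4 : qq ℓ (deriv a) F k ≤ Q' := le_add_self
      have h5 : (1:ℝ≥0∞) ≤ (2^κ)^2 := one_le_pow₀ (one_le_pow₀ (by norm_num))
      calc _ ≤ (2^κ)^2 * Q' + (2^κ)^2 * Q' := by
            gcongr
            exact h4.trans (le_mul_of_one_le_left' h5)
        _ = _ := by ring
    calc _ ≤ 2^(m+1) * (4 * ((2^(κ+m))⁻¹)^2 * (4 * ((2^κ)^2 * (2 * Q')))) := by
          gcongr 2^(m+1) * ?_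
          refine h1.trans ?_
          gcongr 4 * ((2^(κ+m))⁻¹)^2 * ?_
          refine h2.trans ?_
          gcongr 4 * ?_
      _ ≤ 40000 * 2⁻¹^(m+1) * Q' := by
          rw [ENNReal.inv_pow]
          have : (2:ℝ≥0∞)⁻¹ * 2 = 1 := ENNReal.inv_mul_cancel (by simp) (by simp)
          have h6 : ∀ j : ℕ, (2:ℝ≥0∞)⁻¹^j * 2^j = 1 := fun j => by rw [← mul_pow, this, one_pow]
          calc _ = 32 * (2⁻¹^κ * 2^κ)^2 * (2⁻¹^m * 2^m) * 2⁻¹^m * 2 * Q' := by ring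
            _ = 64 * 2⁻¹^m * Q' * (2⁻¹ * 2) := by rw [h6, h6, this]; ring
            _ = 128 * 2⁻¹^(m+1) * Q' := by ring
            _ ≤ _ := by gcongr; norm_num

open scoped FourierTransform ContDiff

/-- a smooth cutoff -/
def chiB : ContDiffBump (0:ℝ) := ⟨1, 2, by norm_num, by norm_num⟩

/-- complex version -/
def chi (s : ℝ) : ℂ := ((chiB s : ℝ) : ℂ)

lemma chi_one {s : ℝ} (h : |s| ≤ 1) : chi s = 1 := by
  have : chiB s = 1 := chiB.one_of_mem_closedBall (by simpa [chiB] using h)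
  simp [chi, this]

lemma chi_zero {s : ℝ} (h : 2 ≤ |s|) : chi s = 0 := by
  have : chiB s = 0 := chiB.zero_of_le_dist (by simpa [chiB] using h)
  simp [chi, this]

lemma chi_smooth : ContDiff ℝ ∞ chi := Complex.ofRealCLM.contDiff.comp chiB.contDiff

lemma chi_cs : HasCompactSupport chi := by
  apply HasCompactSupport.intro (isCompact_Icc (a := -2) (b := 2))
  intro x hx
  apply chi_zero
  by_contra hlt
  push Not at hlt
  exact hx ⟨by linarith [(abs_lt.1 hlt).1], by linarith [(abs_lt.1 hlt).2]⟩

/-- the annular cutoff -/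
def aa (s : ℝ) : ℂ := chi s - chi (2 * s)

lemma aa_ann : Ann aa := by
  refine ⟨?_, ?_, ?_⟩
  · exact chi_smooth.sub (chi_smooth.comp (contDiff_const.mul contDiff_id))
  · intro s hs
    rw [aa, chi_one (by linarith), chi_one (by rw [abs_mul, abs_two]; linarith), sub_self]
  · intro s hs
    rw [aa, chi_zero hs, chi_zero (by rw [abs_mul, abs_two]; linarith), sub_self]

/-- the antiderivative cutoff -/
def bb (ℓ : ℕ) (s : ℝ) : ℂ := aa s / (Complex.I * ℓ * (s:ℂ)^(ℓ-1))

lemma bb_ann {ℓ : ℕ} (hℓ : 2 ≤ ℓ) : Ann (bb ℓ) := by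
  refine ⟨?_, fun s hs => by simp [bb, aa_ann.2.1 s hs], fun s hs => by simp [bb, aa_ann.2.2 s hs]⟩
  rw [contDiff_iff_contDiffAt]
  intro s
  by_cases hs : s = 0
  · have : bb ℓ =ᶠ[nhds s] fun _ => 0 := by
      subst hs
      filter_upwards [Ioo_mem_nhds (a := -(1/2:ℝ)) (b := 1/2) (by norm_num) (by norm_num)] with t ht
      simp [bb, aa_ann.2.1 t (abs_le.2 ⟨ht.1.le, ht.2.le⟩)]
    exact contDiffAt_const.congr_of_eventuallyEq this
  · have h2 : ContDiff ℝ ∞ (fun x : ℝ => (x:ℂ)) := Complex.ofRealCLM.contDiff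
    have h3 : ContDiff ℝ ∞ (fun x : ℝ => Complex.I * ℓ * (x:ℂ)^(ℓ-1)) := contDiff_const.mul (h2.pow _)
    have e : bb ℓ = fun x => aa x * (Complex.I * ℓ * (x:ℂ)^(ℓ-1))⁻¹ := by
      ext x; rw [bb, div_eq_mul_inv]
    rw [e]
    refine aa_ann.1.contDiffAt.mul (h3.contDiffAt.inv ?_)
    have h4 : (ℓ:ℂ) ≠ 0 := by exact_mod_cast (by omega : ℓ ≠ 0)
    have h5 : (s:ℂ) ≠ 0 := by exact_mod_cast hs
    exact mul_ne_zero (mul_ne_zero Complex.I_ne_zero h4) (pow_ne_zero _ h5)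

lemma XX_bb {ℓ : ℕ} (hℓ : 2 ≤ ℓ) : XX ℓ (bb ℓ) = aa := by
  ext s
  rw [XX, bb]
  by_cases hs : s = 0
  · subst hs
    have : aa 0 = 0 := aa_ann.2.1 0 (by norm_num)
    simp [this]
  · have h4 : (ℓ:ℂ) ≠ 0 := by exact_mod_cast (by omega : ℓ ≠ 0)
    have h5 : (s:ℂ) ≠ 0 := by exact_mod_cast hs
    exact mul_div_cancel₀ _ (mul_ne_zero (mul_ne_zero Complex.I_ne_zero h4) (pow_ne_zero _ h5))

/-- dyadic pieces of the kernel -/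
def Kp (ℓ : ℕ) : ℕ → ℝ → ℂ
  | 0 => kern ℓ chi 1
  | (k+1) => kern ℓ aa (2^(k+1))

lemma Kp_sum (ℓ κ : ℕ) (x : ℝ) : ∑ k ∈ Finset.range (κ+1), Kp ℓ k x = kern ℓ chi (2^κ) x := by
  induction κ with
  | zero => simp [Kp]
  | succ n ih =>
    rw [Finset.sum_range_succ, ih]
    simp only [Kp, kern, aa]
    have : 2 * (x / 2^(n+1)) = x / 2^n := by field_simp; ring
    rw [this]; ring

lemma Kp_cs (ℓ k : ℕ) : HasCompactSupport (Kp ℓ k) := by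
  cases k with
  | zero => exact kern_cs ℓ chi_cs one_ne_zero
  | succ k => exact kern_cs ℓ aa_ann.cs (by positivity)

lemma Kp_smooth (ℓ k : ℕ) : ContDiff ℝ ∞ (Kp ℓ k) := by
  cases k with
  | zero => exact kern_smooth ℓ chi_smooth _
  | succ k => exact kern_smooth ℓ aa_ann.1 _

lemma Kp_zero (ℓ k : ℕ) {x : ℝ} (h : 2 * 2^k ≤ |x|) : Kp ℓ k x = 0 := by
  cases k with
  | zero => simp only [Kp, kern]; rw [chi_zero (by simpa using h), mul_zero]
  | succ k =>
    simp only [Kp, kern]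
    rw [aa_ann.2.2, mul_zero]
    rw [abs_div, abs_of_pos (by positivity : (0:ℝ) < 2^(k+1)), le_div_iff₀ (by positivity)]
    exact h

/-- sum of squared norms -/
def QQ (ℓ : ℕ) (F : ℝ → ℂ) (k : ℕ) : ℝ≥0∞ :=
  qq ℓ aa F k + qq ℓ (bb ℓ) F k + qq ℓ (deriv (bb ℓ)) F k + qq ℓ (XX ℓ aa) F k + qq ℓ (deriv aa) F k

lemma QQ_sum {ℓ : ℕ} (hℓ : 2 ≤ ℓ) : ∃ C : ℝ≥0∞, C ≠ ⊤ ∧ ∀ F, MemLp F 2 →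
    ∀ K, ∑ k ∈ Finset.range K, 2^(k*(ℓ-2)) * QQ ℓ F k ≤ C * ∫⁻ x, ‖F x‖ₑ^2 := by
  obtain ⟨C1, t1, h1⟩ := qq_sum hℓ aa_ann
  obtain ⟨C2, t2, h2⟩ := qq_sum hℓ (bb_ann hℓ)
  obtain ⟨C3, t3, h3⟩ := qq_sum hℓ (bb_ann hℓ).deriv
  obtain ⟨C4, t4, h4⟩ := qq_sum hℓ (aa_ann.XX (ℓ := ℓ))
  obtain ⟨C5, t5, h5⟩ := qq_sum hℓ aa_ann.deriv
  refine ⟨C1 + C2 + C3 + C4 + C5, by finiteness, fun F hF K => ?_⟩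
  simp only [QQ, mul_add, add_mul, Finset.sum_add_distrib]
  gcongr ?_ + ?_ + ?_ + ?_ + ?_
  · exact h1 F hF K
  · exact h2 F hF K
  · exact h3 F hF K
  · exact h4 F hF K
  · exact h5 F hF K

lemma piece {ℓ : ℕ} (hℓ : 2 ≤ ℓ) : ∃ C : ℝ≥0∞, C ≠ ⊤ ∧ ∀ F, MemLp F 2 → ∃ Q : ℕ → ℝ≥0∞,
    (∀ K, ∑ k ∈ Finset.range K, 2^(k*(ℓ-2)) * Q k ≤ C * ∫⁻ x, ‖F x‖ₑ^2) ∧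
    ∀ n k, 2^(n - k*(ℓ-1)) * ∫⁻ x, ‖DD (cv F (Kp ℓ k)) n x‖ₑ^2 ≤
      C * (2⁻¹)^((n - k*(ℓ-1)) + (k*(ℓ-1)-n)) * Q k := by
  obtain ⟨C1, t1, h1⟩ := QQ_sum hℓ
  have hs := Kp_smooth ℓ 0
  have hc := Kp_cs ℓ 0
  have hs' : ContDiff ℝ ∞ (deriv (Kp ℓ 0)) := (contDiff_infty_iff_deriv.1 hs).2
  obtain ⟨C2, t2, h2⟩ := single hc hs
  obtain ⟨C3, t3, h3⟩ := single hc.deriv hs'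
  refine ⟨C1 + C2 + C3 + 40000, by finiteness, fun F hF =>
    ⟨fun k => (if k = 0 then (∫⁻ x, ‖cv F (Kp ℓ 0) x‖ₑ^2) + (∫⁻ x, ‖cv F (deriv (Kp ℓ 0)) x‖ₑ^2) else 0) + QQ ℓ F k, ?_, ?_⟩⟩
  · intro K
    simp only [mul_add, Finset.sum_add_distrib]
    have e1 : ∑ k ∈ Finset.range K, 2^(k*(ℓ-2)) * (if k = 0 then (∫⁻ x, ‖cv F (Kp ℓ 0) x‖ₑ^2) + (∫⁻ x, ‖cv F (deriv (Kp ℓ 0)) x‖ₑ^2) else 0)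
        ≤ (C2 + C3) * ∫⁻ x, ‖F x‖ₑ^2 := by
      simp only [mul_ite, mul_zero, Finset.sum_ite_eq', Finset.mem_range]
      split_ifs
      · simp only [zero_mul, pow_zero, one_mul, add_mul]
        exact add_le_add (h2 F hF) (h3 F hF)
      · exact zero_le
    calc _ ≤ (C2 + C3) * (∫⁻ x, ‖F x‖ₑ^2) + C1 * ∫⁻ x, ‖F x‖ₑ^2 := add_le_add e1 (h1 F hF K)
      _ = (C1 + C2 + C3) * ∫⁻ x, ‖F x‖ₑ^2 := by ring
      _ ≤ _ := by gcongr ?_ * _; exact le_self_add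
  · intro n k
    have h4 : (40000:ℝ≥0∞) ≤ C1 + C2 + C3 + 40000 := le_add_self
    cases k with
    | succ k =>
      refine (qq_DD hℓ aa_ann (bb_ann hℓ) (XX_bb hℓ) hF n (k+1)).trans ?_
      gcongr
      simp [QQ]
    | zero =>
      simp only [zero_mul, Nat.sub_zero, Nat.zero_sub, add_zero, if_true]
      have hQ : (∫⁻ x, ‖cv F (Kp ℓ 0) x‖ₑ^2) ≤ ((∫⁻ x, ‖cv F (Kp ℓ 0) x‖ₑ^2) + (∫⁻ x, ‖cv F (deriv (Kp ℓ 0)) x‖ₑ^2)) + QQ ℓ F 0 :=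
        le_self_add.trans le_self_add
      have hQ' : (∫⁻ x, ‖cv F (deriv (Kp ℓ 0)) x‖ₑ^2) ≤ ((∫⁻ x, ‖cv F (Kp ℓ 0) x‖ₑ^2) + (∫⁻ x, ‖cv F (deriv (Kp ℓ 0)) x‖ₑ^2)) + QQ ℓ F 0 :=
        le_add_self.trans le_self_add
      set Q := ((∫⁻ x, ‖cv F (Kp ℓ 0) x‖ₑ^2) + (∫⁻ x, ‖cv F (deriv (Kp ℓ 0)) x‖ₑ^2)) + QQ ℓ F 0
      cases n with
      | zero =>
        simp only [pow_zero, one_mul, mul_one]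
        refine (L0 (cv_cont hF hc hs).measurable.aemeasurable 0).trans (hQ.trans ?_)
        refine le_mul_of_one_le_left' (le_trans ?_ h4)
        norm_num
      | succ m =>
        have h5 := L1 (fun x => cv_deriv hF hc hs x) (cv_cont hF hc.deriv hs') m
        have : (2:ℝ≥0∞)⁻¹ * 2 = 1 := ENNReal.inv_mul_cancel (by simp) (by simp)
        have h6 : ∀ j : ℕ, (2:ℝ≥0∞)⁻¹^j * 2^j = 1 := fun j => by rw [← mul_pow, this, one_pow]
        calc _ ≤ 2^(m+1) * (4 * ((2^m)⁻¹)^2 * Q) := by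
              gcongr 2^(m+1) * ?_
              refine h5.trans ?_
              gcongr 4 * ((2^m)⁻¹)^2 * ?_
          _ = 8 * (2⁻¹^m * 2^m) * 2⁻¹^m * Q := by rw [ENNReal.inv_pow]; ring
          _ = 8 * 2⁻¹^m * Q * (2⁻¹ * 2) := by rw [h6, this]; ring
          _ = 16 * 2⁻¹^(m+1) * Q := by ring
          _ ≤ _ := by
            gcongr
            exact le_trans (by norm_num) h4

/-- the weight -/
def wt (n κ : ℕ) : ℝ≥0∞ := ENNReal.ofReal ((1 + |(((κ:ℤ) - (n:ℤ) : ℤ):ℝ)|)^2)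

lemma wt_sum : ∃ C : ℝ≥0∞, C ≠ ⊤ ∧ ∀ κ N, ∑ n ∈ Finset.range N, wt n κ * (2⁻¹)^((n - κ) + (κ-n)) ≤ C := by
  set G : ℤ → ℝ := fun z => (1 + |(z:ℝ)|)^2 * (1/2)^z.natAbs with hG
  have hsn : Summable (fun n : ℕ => (1 + (n:ℝ))^2 * (1/2)^n) := by
    have h := fun j => summable_pow_mul_geometric_of_norm_lt_one (R := ℝ) j (r := 1/2) (by norm_num)
    have := ((h 0).add ((h 1).mul_left 2)).add (h 2)
    refine this.congr fun n => ?_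
    ring
  have hsG : Summable G := by
    apply Summable.of_nat_of_neg
    · simpa [hG] using hsn
    · simpa [hG] using hsn
  refine ⟨ENNReal.ofReal (∑' z, G z), ENNReal.ofReal_ne_top, fun κ N => ?_⟩
  have hG0 : ∀ z, 0 ≤ G z := fun z => by positivity
  rw [ENNReal.ofReal_tsum_of_nonneg hG0 hsG]
  have e : ∀ n, wt n κ * (2⁻¹)^((n - κ) + (κ-n)) = ENNReal.ofReal (G ((κ:ℤ) - n)) := by
    intro n
    rw [wt, hG, ENNReal.ofReal_mul (by positivity), ENNReal.ofReal_pow (by positivity) (_ : ℕ)]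
    congr 1
    · have : (n - κ) + (κ-n) = ((κ:ℤ) - n).natAbs := by omega
      rw [this, ENNReal.ofReal_pow (by positivity)]
      congr 1
      rw [one_div, ENNReal.ofReal_inv_of_pos (by norm_num)]; simp
  simp only [e]
  refine (ENNReal.sum_le_tsum _).trans ?_
  exact ENNReal.tsum_comp_le_tsum_of_injective (f := fun n : ℕ => (κ:ℤ) - n) (fun a b h => by simpa using h) (fun z => ENNReal.ofReal (G z))

theorem star {ℓ : ℕ} (hℓ : 2 ≤ ℓ) : ∃ C : ℝ≥0∞, C ≠ ⊤ ∧ ∀ F, MemLp F 2 → ∀ K N,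
    ∑ k ∈ Finset.range K, ∑ n ∈ Finset.range N, wt n (k*(ℓ-1)) *
      (2^((n - k*(ℓ-1)) + k*(ℓ-2)) * ∫⁻ x, ‖DD (cv F (Kp ℓ k)) n x‖ₑ^2) ≤ C * ∫⁻ x, ‖F x‖ₑ^2 := by
  obtain ⟨C1, t1, h1⟩ := piece hℓ
  obtain ⟨C2, t2, h2⟩ := wt_sum
  refine ⟨C1 * C2 * C1, by finiteness, fun F hF K N => ?_⟩
  obtain ⟨Q, hQ, hQ'⟩ := h1 F hF
  calc _ ≤ ∑ k ∈ Finset.range K, ∑ n ∈ Finset.range N, (C1 * (2^(k*(ℓ-2)) * Q k)) *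
        (wt n (k*(ℓ-1)) * (2⁻¹)^((n - k*(ℓ-1)) + (k*(ℓ-1)-n))) := by
        apply Finset.sum_le_sum
        intro k _
        apply Finset.sum_le_sum
        intro n _
        calc _ = wt n (k*(ℓ-1)) * 2^(k*(ℓ-2)) * (2^(n - k*(ℓ-1)) * ∫⁻ x, ‖DD (cv F (Kp ℓ k)) n x‖ₑ^2) := by
              rw [pow_add]; ring
          _ ≤ wt n (k*(ℓ-1)) * 2^(k*(ℓ-2)) * (C1 * (2⁻¹)^((n - k*(ℓ-1)) + (k*(ℓ-1)-n)) * Q k) :=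
              mul_le_mul_right (hQ' n k) _
          _ = _ := by ring
    _ = ∑ k ∈ Finset.range K, (C1 * (2^(k*(ℓ-2)) * Q k)) * ∑ n ∈ Finset.range N,
        (wt n (k*(ℓ-1)) * (2⁻¹)^((n - k*(ℓ-1)) + (k*(ℓ-1)-n))) := by
        simp only [Finset.mul_sum]
    _ ≤ ∑ k ∈ Finset.range K, (C1 * (2^(k*(ℓ-2)) * Q k)) * C2 :=
        Finset.sum_le_sum fun k _ => mul_le_mul_right (h2 _ _) _
    _ = C1 * C2 * ∑ k ∈ Finset.range K, 2^(k*(ℓ-2)) * Q k := by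
        rw [Finset.mul_sum]; exact Finset.sum_congr rfl fun k _ => by ring
    _ ≤ C1 * C2 * (C1 * ∫⁻ x, ‖F x‖ₑ^2) := mul_le_mul_right (hQ K) _
    _ = _ := by ring

open scoped FourierTransform ContDiff

lemma HLM_mono {u v : ℝ → ℝ≥0∞} (h : ∀ x, u x ≤ v x) (x : ℝ) : HLM u x ≤ HLM v x := by
  unfold HLM
  gcongr with r hr y
  exact h y

lemma MoscT_mono (ℓ : ℕ) {u v : ℝ → ℝ≥0∞} (h : ∀ x, u x ≤ v x) (x : ℝ) : MoscT ℓ u x ≤ MoscT ℓ v x := by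
  unfold MoscT
  gcongr with r hr y
  exact h y

lemma HLM_le_mul {u v : ℝ → ℝ≥0∞} {c : ℝ≥0∞} (hc : c ≠ ⊤) (h : ∀ x, u x ≤ c * v x) (x : ℝ) :
    HLM u x ≤ c * HLM v x := by
  unfold HLM
  refine iSup₂_le fun r hr => ?_
  calc _ ≤ (ENNReal.ofReal (2 * r))⁻¹ * ∫⁻ y in {y | |x - y| < r}, c * v y := by
        gcongr with y; exact h y
    _ = c * ((ENNReal.ofReal (2 * r))⁻¹ * ∫⁻ y in {y | |x - y| < r}, v y) := by
        rw [lintegral_const_mul' _ _ hc]; ring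
    _ ≤ _ := by
        gcongr c * ?_
        exact le_iSup₂ (f := fun r (_ : 0 < r) => (ENNReal.ofReal (2 * r))⁻¹ * ∫⁻ y in {y | |x - y| < r}, v y) r hr

lemma le_MoscT (ℓ : ℕ) (u : ℝ → ℝ≥0∞) (x z r : ℝ) (h : 0 < r ∧ r ≤ 1 ∧ |z - x| ≤ r ^ (-1 / ((ℓ : ℝ) - 1))) :
    ENNReal.ofReal (r ^ (-1 / ((ℓ : ℝ) - 1))) * ∫⁻ y' in {y' | |z - y'| ≤ r}, u y' ≤ MoscT ℓ u x := by
  unfold MoscT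
  exact le_iSup₂ (f := fun (yr : ℝ × ℝ) (_ : 0 < yr.2 ∧ yr.2 ≤ 1 ∧ |yr.1 - x| ≤ yr.2 ^ (-1 / ((ℓ : ℝ) - 1))) =>
    ENNReal.ofReal (yr.2 ^ (-1 / ((ℓ : ℝ) - 1))) * ∫⁻ y' in {y' | |yr.1 - y'| ≤ yr.2}, u y') (z, r) h

lemma le_HLM (u : ℝ → ℝ≥0∞) (x r : ℝ) (hr : 0 < r) :
    (ENNReal.ofReal (2 * r))⁻¹ * (∫⁻ y in {y | |x - y| < r}, u y) ≤ HLM u x := by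
  unfold HLM
  exact le_iSup₂ (f := fun r (_ : 0 < r) => (ENNReal.ofReal (2 * r))⁻¹ * ∫⁻ y in {y | |x - y| < r}, u y) r hr

lemma MoscT_le_mul (ℓ : ℕ) {u v : ℝ → ℝ≥0∞} {c : ℝ≥0∞} (hc : c ≠ ⊤) (h : ∀ x, u x ≤ c * v x) (x : ℝ) :
    MoscT ℓ u x ≤ c * MoscT ℓ v x := by
  rw [MoscT]
  refine iSup₂_le fun yr hr => ?_
  calc _ ≤ ENNReal.ofReal (yr.2 ^ (-1 / ((ℓ : ℝ) - 1))) * ∫⁻ y in {y' | |yr.1 - y'| ≤ yr.2}, c * v y := by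
        gcongr with y; exact h y
    _ = c * (ENNReal.ofReal (yr.2 ^ (-1 / ((ℓ : ℝ) - 1))) * ∫⁻ y in {y' | |yr.1 - y'| ≤ yr.2}, v y) := by
        rw [lintegral_const_mul' _ _ hc]; ring
    _ ≤ _ := by
        gcongr c * ?_
        exact le_MoscT ℓ v x _ _ hr

lemma inv_two_mul_ofReal {r : ℝ} (hr : 0 < r) :
    (ENNReal.ofReal (2 * r))⁻¹ * ENNReal.ofReal r = 2⁻¹ := by
  rw [ENNReal.ofReal_mul (by norm_num), ENNReal.mul_inv (by simp) (by simp), mul_assoc,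
    ENNReal.inv_mul_cancel (by simpa using hr) (by simp), mul_one]
  simp

lemma HLM_ge {u : ℝ → ℝ≥0∞} {x r a : ℝ} {c : ℝ≥0∞} (hr : 0 < r) (ha : a = x ∨ a = x - r)
    (h : ∀ y ∈ Ioo a (a + r), c ≤ u y) : c ≤ 2 * HLM u x := by
  have h1 : c * ENNReal.ofReal r ≤ ∫⁻ y in {y | |x - y| < r}, u y := by
    calc c * ENNReal.ofReal r = ∫⁻ y in Ioo a (a+r), c := by
          rw [setLIntegral_const, Real.volume_Ioo]; congr 2; ring
      _ ≤ ∫⁻ y in Ioo a (a+r), u y := setLIntegral_mono' measurableSet_Ioo h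
      _ ≤ _ := by
          apply lintegral_mono_set
          intro y hy
          simp only [Set.mem_ofPred_eq]
          rw [abs_lt]
          rcases ha with rfl | rfl <;> constructor <;> linarith [hy.1, hy.2]
  calc c = 2 * (2⁻¹ * c) := by rw [← mul_assoc, ENNReal.mul_inv_cancel (by simp) (by simp), one_mul]
    _ = 2 * ((ENNReal.ofReal (2 * r))⁻¹ * (c * ENNReal.ofReal r)) := by
        rw [← inv_two_mul_ofReal hr]; ring
    _ ≤ 2 * ((ENNReal.ofReal (2 * r))⁻¹ * (∫⁻ y in {y | |x - y| < r}, u y)) := by gcongr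
    _ ≤ _ := by gcongr 2 * ?_; exact le_HLM u x r hr

lemma HLM_le_HLM (u : ℝ → ℝ≥0∞) (x : ℝ) : HLM u x ≤ 4 * HLM (HLM u) x := by
  rw [HLM]
  refine iSup₂_le fun r hr => ?_
  set A := ∫⁻ y in {y | |x - y| < r}, u y
  have := HLM_ge (u := HLM u) (x := x) (a := x) (c := (ENNReal.ofReal (2 * (2 * r)))⁻¹ * A) hr (Or.inl rfl) ?_
  · calc (ENNReal.ofReal (2 * r))⁻¹ * A = (2 * 2⁻¹) * ((ENNReal.ofReal (2 * r))⁻¹ * A) := by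
          rw [ENNReal.mul_inv_cancel (by simp) (by simp), one_mul]
      _ = 2 * ((ENNReal.ofReal (2 * (2 * r)))⁻¹ * A) := by
          rw [ENNReal.ofReal_mul (p := 2) (q := 2 * r) (by norm_num), ENNReal.mul_inv (by simp) (by simp)]
          simp; ring
      _ ≤ 2 * (2 * HLM (HLM u) x) := by gcongr
      _ = _ := by ring
  · intro y hy
    refine le_trans ?_ (le_HLM u y (2 * r) (by linarith))
    gcongr
    apply lintegral_mono_set
    intro z hz
    simp only [Set.mem_ofPred_eq, abs_lt] at hz ⊢
    constructor <;> linarith [hy.1, hy.2]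

lemma MoscT_le_HLM (ℓ : ℕ) (u : ℝ → ℝ≥0∞) (x : ℝ) : MoscT ℓ u x ≤ 2 * HLM (MoscT ℓ u) x := by
  rw [MoscT]
  refine iSup₂_le fun yr hr => ?_
  obtain ⟨z, r⟩ := yr
  obtain ⟨h1, h2, h3⟩ := hr
  simp only at h1 h2 h3 ⊢
  have hR : 0 < r ^ (-1 / ((ℓ : ℝ) - 1)) := by positivity
  rcases le_total x z with hz | hz
  · refine HLM_ge hR (Or.inl rfl) fun y hy => le_MoscT ℓ u y z r ⟨h1, h2, ?_⟩
    rw [abs_le] at h3 ⊢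
    constructor <;> linarith [hy.1, hy.2]
  · refine HLM_ge hR (Or.inr rfl) fun y hy => le_MoscT ℓ u y z r ⟨h1, h2, ?_⟩
    rw [abs_le] at h3 ⊢
    constructor <;> linarith [hy.1, hy.2]

lemma final_weight (ℓ : ℕ) (u : ℝ → ℝ≥0∞) (x : ℝ) :
    MoscT ℓ (HLM (HLM u)) x ≤ 128 * (HLM^[2] (MoscT ℓ (HLM^[4] u))) x := by
  simp only [Function.iterate_succ, Function.iterate_zero, Function.comp, id]
  have h1 : ∀ x, HLM (HLM u) x ≤ 16 * HLM (HLM (HLM (HLM u))) x := fun x =>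
    calc _ ≤ 4 * HLM (HLM (HLM u)) x := HLM_le_HLM _ x
      _ ≤ 4 * (4 * HLM (HLM (HLM (HLM u))) x) := by gcongr; exact HLM_le_HLM _ x
      _ = _ := by ring
  set u4 := HLM (HLM (HLM (HLM u)))
  calc _ ≤ 16 * MoscT ℓ u4 x := MoscT_le_mul ℓ (by simp) h1 x
    _ ≤ 16 * (2 * HLM (MoscT ℓ u4) x) := by gcongr; exact MoscT_le_HLM _ _ x
    _ ≤ 16 * (2 * (4 * HLM (HLM (MoscT ℓ u4)) x)) := by gcongr; exact HLM_le_HLM _ x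
    _ = _ := by ring

lemma EE_le_HLM (n : ℕ) (u : ℝ → ℝ≥0∞) (x : ℝ) : EE n u x ≤ 2 * HLM u x := by
  have hp : (0:ℝ) < (2^n)⁻¹ := by positivity
  calc EE n u x ≤ 2^n * ∫⁻ y in {y | |x - y| < (2^n)⁻¹}, u y := by
        rw [EE]; exact mul_le_mul_right (lintegral_mono_set fun y hy => abs_lt_of_mem_dI hy) _
    _ = 2 * ((ENNReal.ofReal (2 * (2^n)⁻¹))⁻¹ * ∫⁻ y in {y | |x - y| < (2^n)⁻¹}, u y) := by
        rw [← mul_assoc]; congr 1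
        rw [ENNReal.ofReal_mul (by norm_num), ENNReal.mul_inv (by simp) (by simp), ← mul_assoc,
          ENNReal.ofReal_ofNat, ENNReal.mul_inv_cancel (by simp) (by simp), one_mul,
          ENNReal.ofReal_inv_of_pos (by positivity), inv_inv, ENNReal.ofReal_pow (by norm_num)]
        simp
    _ ≤ _ := by gcongr 2 * ?_; exact le_HLM u x _ hp

lemma Mx_le_HLM (n : ℕ) (u : ℝ → ℝ≥0∞) (x : ℝ) : Mx n u x ≤ 2 * HLM u x :=
  Mx_le fun m _ => EE_le_HLM m u x

lemma v_le (N : ℕ) {u : ℝ → ℝ≥0∞} (hu : AEMeasurable u) (x : ℝ) :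
    Mx N (Mx N (EE N u)) x ≤ 4 * HLM (HLM u) x := by
  have h1 : ∀ x, Mx N (EE N u) x ≤ 2 * HLM u x := fun x => by
    refine Mx_le fun m hm => ?_
    rw [EE_EE hm hu]
    exact EE_le_HLM m u x
  calc _ ≤ 2 * HLM (Mx N (EE N u)) x := Mx_le_HLM N _ x
    _ ≤ 2 * (2 * HLM (HLM u) x) := by gcongr; exact HLM_le_mul (by simp) h1 x
    _ = _ := by ring

/-- exponent of the comparison -/
def mu (ℓ n k : ℕ) : ℝ≥0∞ := 2^((n - k*(ℓ-1)) + k*(ℓ-2))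

lemma EE_le_MoscT {ℓ : ℕ} (hℓ : 2 ≤ ℓ) (k : ℕ) (v : ℝ → ℝ≥0∞) {y z : ℝ} (h : |z - y| ≤ 2^k) :
    EE (k*(ℓ-1)) v z ≤ 2^(k*(ℓ-2)) * MoscT ℓ v y := by
  set r : ℝ := (2^(k*(ℓ-1)))⁻¹ with hr
  have hr0 : 0 < r := by positivity
  have hr1 : r ≤ 1 := inv_le_one_of_one_le₀ (one_le_pow₀ (by norm_num))
  have hl : (0:ℝ) < (ℓ:ℝ) - 1 := by
    have : (2:ℝ) ≤ ℓ := by exact_mod_cast hℓ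
    linarith
  have hR : r ^ (-1 / ((ℓ : ℝ) - 1)) = 2^k := by
    have e : r = (2:ℝ)^(-((k:ℝ) * ((ℓ:ℝ)-1))) := by
      rw [hr, Real.rpow_neg (by norm_num), ← Real.rpow_natCast]
      push_cast [Nat.cast_sub (by omega : 1 ≤ ℓ)]
      rfl
    rw [e, ← Real.rpow_mul (by norm_num), ← Real.rpow_natCast]
    congr 1
    field_simp
  have := le_MoscT ℓ v y z r ⟨hr0, hr1, by rwa [hR]⟩
  rw [hR] at this
  calc EE (k*(ℓ-1)) v z ≤ 2^(k*(ℓ-1)) * ∫⁻ y' in {y' | |z - y'| ≤ r}, v y' := by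
        rw [EE]; exact mul_le_mul_right (lintegral_mono_set fun y hy => (abs_lt_of_mem_dI hy).le) _
    _ = 2^(k*(ℓ-2)) * (ENNReal.ofReal (2^k) * ∫⁻ y' in {y' | |z - y'| ≤ r}, v y') := by
        rw [← mul_assoc]; congr 1
        rw [ENNReal.ofReal_pow (by norm_num), ENNReal.ofReal_ofNat, ← pow_add]
        congr 1
        obtain ⟨m, rfl⟩ := Nat.exists_eq_add_of_le hℓ
        rw [show 2 + m - 1 = m + 1 by omega, show 2 + m - 2 = m by omega]; ring
    _ ≤ _ := by gcongr 2^(k*(ℓ-2)) * ?_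

lemma geom {ℓ : ℕ} (hℓ : 2 ≤ ℓ) (n k : ℕ) {v : ℝ → ℝ≥0∞} (hv : Measurable v) {x y : ℝ} (h : |x - y| < 4 * 2^k) :
    Mx (n-1) v x ≤ 2^(3*(ℓ-2)) * mu ℓ n k * MoscT ℓ v y := by
  have hK : ∀ z, |x - z| < 1 → EE ((k+3)*(ℓ-1)) v z ≤ 2^((k+3)*(ℓ-2)) * MoscT ℓ v y := by
    intro z hz
    apply EE_le_MoscT hℓ
    have h1 : (1:ℝ) ≤ 2^k := one_le_pow₀ (by norm_num)
    rw [pow_add]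
    rw [abs_lt] at h hz
    rw [abs_le]
    constructor <;> nlinarith
  have e : (2:ℝ≥0∞)^(3*(ℓ-2)) * mu ℓ n k = 2^(n - k*(ℓ-1)) * 2^((k+3)*(ℓ-2)) := by
    rw [mu, ← pow_add, ← pow_add]; congr 1; ring
  rw [e]
  refine Mx_le fun p hp => ?_
  rcases le_total p ((k+3)*(ℓ-1)) with hpk | hpk
  · rw [← EE_EE hpk hv.aemeasurable]
    apply EE_le_of_le
    intro z hz
    have hz1 : |x - z| < 1 := (abs_lt_of_mem_dI hz).trans_le (inv_le_one_of_one_le₀ (one_le_pow₀ (by norm_num)))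
    refine (hK z hz1).trans ?_
    gcongr ?_ * _
    exact le_mul_of_one_le_left' (one_le_pow₀ (by norm_num))
  · refine (EE_le_pow _ _ hpk v x).trans ?_
    rw [mul_assoc]
    refine mul_le_mul' (pow_le_pow_right₀ (by norm_num) ?_) ?_
    · have : k*(ℓ-1) ≤ (k+3)*(ℓ-1) := Nat.mul_le_mul_right _ (by omega)
      omega
    · exact hK x (by simp)

lemma layer_up (y : ℝ≥0∞) : ∑' j : ℤ, (if lz j ≤ y then lz j else 0) ≤ 2 * y := by
  rw [ENNReal.tsum_eq_iSup_sum]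
  refine iSup_le fun S => ?_
  obtain ⟨m, hm⟩ : ∃ m : ℕ, ∀ i ∈ S, 0 ≤ i + m := by
    refine ⟨∑ i ∈ S, i.natAbs, fun i hi => ?_⟩
    have := Finset.single_le_sum (f := fun i : ℤ => i.natAbs) (fun _ _ => Nat.zero_le _) hi
    omega
  have h1 : ∑ j ∈ S, (if lz j ≤ y then lz j else 0) =
      ∑ p ∈ S.image (fun i : ℤ => (i + m).toNat), (if 2^p * lz (-m) ≤ y then 2^p * lz (-m) else 0) := by
    rw [Finset.sum_image]
    · apply Finset.sum_congr rfl
      intro i hi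
      rw [← lz_add_nat]
      have : (-(m:ℤ) + ((i + m).toNat : ℕ)) = i := by have := hm i hi; omega
      rw [this]
    · intro a ha b hb hab
      have := hm a ha; have := hm b hb
      have hab' : (a + m).toNat = (b + m).toNat := hab
      omega
  rw [h1]
  exact (ENNReal.sum_le_tsum _).trans (layer1 _ y)

lemma layer_lo (y : ℝ≥0∞) : y ≤ 2 * ∑' j : ℤ, (if lz j ≤ y then lz j else 0) := by
  by_cases h0 : y = 0
  · simp [h0]
  by_cases ht : y = ⊤
  · subst ht
    simp only [le_top, if_true]
    have : ∑' j : ℤ, lz j = ⊤ := by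
      refine ENNReal.eq_top_of_forall_nnreal_le fun r => le_of_lt ?_
      obtain ⟨n, hn⟩ := pow_unbounded_of_one_lt (r:ℝ) (one_lt_two)
      refine lt_of_lt_of_le ?_ (ENNReal.le_tsum (n:ℤ))
      rw [lz, ENNReal.lt_ofReal_iff_toReal_lt (by simp)]
      simpa using hn
    rw [this]; simp
  · obtain ⟨h1, h2⟩ := lz_log h0 ht
    refine h2.le.trans ?_
    gcongr
    refine le_trans ?_ (ENNReal.le_tsum (Int.log 2 y.toReal))
    rw [if_pos h1]

open scoped FourierTransform ContDiff

lemma EG_congr {G G' : ℝ → ℂ} {n : ℕ} {x : ℝ} (h : ∀ z, |x - z| < 1 → G z = G' z) : EG n G x = EG n G' x := by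
  rw [EG, EG]
  congr 1
  refine setIntegral_congr_fun (measurableSet_dI n x) fun z hz => h z ?_
  exact (abs_lt_of_mem_dI hz).trans_le (inv_le_one_of_one_le₀ (one_le_pow₀ (by norm_num)))

lemma DD_congr {G G' : ℝ → ℂ} {n : ℕ} {x : ℝ} (h : ∀ z, |x - z| < 1 → G z = G' z) : DD G n x = DD G' n x := by
  cases n with
  | zero => exact EG_congr h
  | succ n => simp only [DD]; rw [EG_congr h, EG_congr h]

lemma EG_sum {ι : Type*} (S : Finset ι) {g : ι → ℝ → ℂ} (hg : ∀ i, LocallyIntegrable (g i)) (n : ℕ) (x : ℝ) :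
    EG n (fun y => ∑ i ∈ S, g i y) x = ∑ i ∈ S, EG n (g i) x := by
  simp only [EG]
  rw [integral_finsetSum _ (fun i _ => integrableOn_dI (hg i) n x), Finset.mul_sum]

lemma DD_sum {ι : Type*} (S : Finset ι) {g : ι → ℝ → ℂ} (hg : ∀ i, LocallyIntegrable (g i)) (n : ℕ) (x : ℝ) :
    DD (fun y => ∑ i ∈ S, g i y) n x = ∑ i ∈ S, DD (g i) n x := by
  cases n with
  | zero => exact EG_sum S hg 0 x
  | succ n => simp only [DD]; rw [EG_sum S hg, EG_sum S hg, Finset.sum_sub_distrib]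

/-- the open superlevel-type set -/
def Om (ℓ : ℕ) (v : ℝ → ℝ≥0∞) (j : ℤ) : Set ℝ :=
  {y | ∃ n k : ℕ, ∃ x : ℝ, |x - y| < 4 * 2^k ∧ lz j * mu ℓ n k ≤ Mx (n-1) v x}

lemma Om_open (ℓ : ℕ) (v : ℝ → ℝ≥0∞) (j : ℤ) : IsOpen (Om ℓ v j) := by
  rw [isOpen_iff_mem_nhds]
  rintro y ⟨n, k, x, h1, h2⟩
  have hc : Continuous (fun y : ℝ => |x - y|) := by fun_prop
  filter_upwards [hc.continuousAt.eventually_lt continuousAt_const h1] with z hz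
  exact ⟨n, k, x, hz, h2⟩

lemma mu_ne_zero (ℓ n k : ℕ) : mu ℓ n k ≠ 0 := by unfold mu; positivity
lemma mu_ne_top (ℓ n k : ℕ) : mu ℓ n k ≠ ⊤ := by unfold mu; finiteness

lemma Om_le {ℓ : ℕ} (hℓ : 2 ≤ ℓ) {v : ℝ → ℝ≥0∞} (hv : Measurable v) {j : ℤ} {y : ℝ} (h : y ∈ Om ℓ v j) :
    lz j ≤ 2^(3*(ℓ-2)) * MoscT ℓ v y := by
  obtain ⟨n, k, x, h1, h2⟩ := h
  have h3 := h2.trans (geom hℓ n k hv h1)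
  have h4 : lz j * mu ℓ n k ≤ (2^(3*(ℓ-2)) * MoscT ℓ v y) * mu ℓ n k := h3.trans (le_of_eq (by ring))
  exact (ENNReal.mul_le_mul_iff_left (mu_ne_zero _ _ _) (mu_ne_top _ _ _)).1 h4

lemma loc {ℓ : ℕ} (f : ℝ → ℂ) {v : ℝ → ℝ≥0∞} {j : ℤ} {n k : ℕ} {x : ℝ}
    (h : lz j * mu ℓ n k ≤ Mx (n-1) v x) :
    DD (cv f (Kp ℓ k)) n x = DD (cv ((Om ℓ v j).indicator f) (Kp ℓ k)) n x := by
  apply DD_congr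
  intro z hz
  rw [cv, cv]
  congr 1
  ext t
  by_cases ht : 2 * 2^k ≤ |z - t|
  · rw [Kp_zero ℓ k ht, mul_zero, mul_zero]
  · push Not at ht
    have : t ∈ Om ℓ v j := by
      refine ⟨n, k, x, ?_, h⟩
      have h1 : (1:ℝ) ≤ 2^k := one_le_pow₀ (by norm_num)
      rw [abs_lt] at *
      constructor <;> linarith [hz.1, hz.2, ht.1, ht.2]
    rw [indicator_of_mem this]

lemma one_kn {ℓ : ℕ} (f : ℝ → ℂ) (v : ℝ → ℝ≥0∞) (n k : ℕ) :
    ∫⁻ x, ‖DD (cv f (Kp ℓ k)) n x‖ₑ^2 * Mx (n-1) v x ≤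
      ∑' j : ℤ, 2 * lz j * (mu ℓ n k * ∫⁻ x, ‖DD (cv ((Om ℓ v j).indicator f) (Kp ℓ k)) n x‖ₑ^2) := by
  have hm : ∀ j : ℤ, Measurable (fun x => 2 * lz j * mu ℓ n k * ‖DD (cv ((Om ℓ v j).indicator f) (Kp ℓ k)) n x‖ₑ^2) := by
    intro j
    exact (((Lev.DD (n := n)).measurable).enorm.pow_const 2).const_mul _
  calc _ ≤ ∫⁻ x, ∑' j : ℤ, 2 * lz j * mu ℓ n k * ‖DD (cv ((Om ℓ v j).indicator f) (Kp ℓ k)) n x‖ₑ^2 := by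
        apply lintegral_mono
        intro x
        simp only
        set M := Mx (n-1) v x with hM
        set D := ‖DD (cv f (Kp ℓ k)) n x‖ₑ^2 with hD
        have h1 := layer_lo (M / mu ℓ n k)
        have h2 : M = mu ℓ n k * (M / mu ℓ n k) := (ENNReal.mul_div_cancel (mu_ne_zero _ _ _) (mu_ne_top _ _ _)).symm
        calc D * M = D * (mu ℓ n k * (M / mu ℓ n k)) := by rw [← h2]
          _ ≤ D * (mu ℓ n k * (2 * ∑' j : ℤ, (if lz j ≤ M / mu ℓ n k then lz j else 0))) := by gcongr D * (mu ℓ n k * ?_)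
          _ = ∑' j : ℤ, (D * mu ℓ n k * 2) * (if lz j ≤ M / mu ℓ n k then lz j else 0) := by
              rw [ENNReal.tsum_mul_left]; ring
          _ ≤ _ := by
              apply ENNReal.tsum_le_tsum
              intro j
              split_ifs with hj
              · rw [ENNReal.le_div_iff_mul_le (Or.inl (mu_ne_zero _ _ _)) (Or.inl (mu_ne_top _ _ _))] at hj
                rw [hD, loc f hj]
                exact le_of_eq (by ring)
              · rw [mul_zero]; exact zero_le
    _ = _ := by
        rw [lintegral_tsum fun j => (hm j).aemeasurable]
        apply tsum_congr
        intro j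
        rw [lintegral_const_mul' _ _ (by have := mu_ne_top ℓ n k; unfold lz; finiteness), mul_assoc]

lemma core {ℓ : ℕ} (hℓ : 2 ≤ ℓ) : ∃ C : ℝ≥0∞, C ≠ ⊤ ∧ ∀ f : ℝ → ℂ, MemLp f 2 → Measurable f →
    ∀ v : ℝ → ℝ≥0∞, Measurable v → ∀ K N,
    ∑ k ∈ Finset.range K, ∑ n ∈ Finset.range N, wt n (k*(ℓ-1)) *
      ∫⁻ x, ‖DD (cv f (Kp ℓ k)) n x‖ₑ^2 * Mx (n-1) v x ≤ C * ∫⁻ x, ‖f x‖ₑ^2 * MoscT ℓ v x := by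
  obtain ⟨C, hC, hstar⟩ := star hℓ
  refine ⟨2 * C * (2 * 2^(3*(ℓ-2))), by finiteness, fun f hf hfm v hv K N => ?_⟩
  have hF : ∀ j, MemLp ((Om ℓ v j).indicator f) 2 := fun j => hf.indicator (Om_open ℓ v j).measurableSet
  have hmj : ∀ j : ℤ, Measurable (fun x => lz j * ‖(Om ℓ v j).indicator f x‖ₑ^2) := fun j =>
    ((hfm.indicator (Om_open ℓ v j).measurableSet).enorm.pow_const 2).const_mul _
  calc _ ≤ ∑ k ∈ Finset.range K, ∑ n ∈ Finset.range N, ∑' j : ℤ, 2 * lz j * (wt n (k*(ℓ-1)) *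
        (mu ℓ n k * ∫⁻ x, ‖DD (cv ((Om ℓ v j).indicator f) (Kp ℓ k)) n x‖ₑ^2)) := by
        apply Finset.sum_le_sum
        intro k _
        apply Finset.sum_le_sum
        intro n _
        refine (mul_le_mul_right (one_kn f v n k) _).trans ?_
        rw [← ENNReal.tsum_mul_left]
        apply ENNReal.tsum_le_tsum
        intro j
        exact le_of_eq (by ring)
    _ = ∑' j : ℤ, 2 * lz j * ∑ k ∈ Finset.range K, ∑ n ∈ Finset.range N, (wt n (k*(ℓ-1)) *
        (mu ℓ n k * ∫⁻ x, ‖DD (cv ((Om ℓ v j).indicator f) (Kp ℓ k)) n x‖ₑ^2)) := by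
        simp only [Finset.mul_sum]
        rw [Summable.tsum_finsetSum fun _ _ => ENNReal.summable]
        apply Finset.sum_congr rfl
        intro k _
        rw [Summable.tsum_finsetSum fun _ _ => ENNReal.summable]
    _ ≤ ∑' j : ℤ, 2 * lz j * (C * ∫⁻ x, ‖(Om ℓ v j).indicator f x‖ₑ^2) := by
        apply ENNReal.tsum_le_tsum
        intro j
        exact mul_le_mul_right (hstar _ (hF j) K N) _
    _ = 2 * C * ∑' j : ℤ, ∫⁻ x, lz j * ‖(Om ℓ v j).indicator f x‖ₑ^2 := by
        rw [← ENNReal.tsum_mul_left]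
        apply tsum_congr
        intro j
        rw [lintegral_const_mul' _ _ (by unfold lz; finiteness)]; ring
    _ = 2 * C * ∫⁻ x, ∑' j : ℤ, lz j * ‖(Om ℓ v j).indicator f x‖ₑ^2 := by
        rw [lintegral_tsum fun j => (hmj j).aemeasurable]
    _ ≤ 2 * C * ∫⁻ x, (2 * 2^(3*(ℓ-2))) * (‖f x‖ₑ^2 * MoscT ℓ v x) := by
        gcongr 2 * C * ?_
        apply lintegral_mono
        intro x
        simp only
        calc _ ≤ ∑' j : ℤ, (if lz j ≤ 2^(3*(ℓ-2)) * MoscT ℓ v x then lz j else 0) * ‖f x‖ₑ^2 := by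
              apply ENNReal.tsum_le_tsum
              intro j
              by_cases hx : x ∈ Om ℓ v j
              · rw [indicator_of_mem hx, if_pos (Om_le hℓ hv hx)]
              · rw [indicator_of_notMem hx]; simp
          _ = (∑' j : ℤ, (if lz j ≤ 2^(3*(ℓ-2)) * MoscT ℓ v x then lz j else 0)) * ‖f x‖ₑ^2 := ENNReal.tsum_mul_right
          _ ≤ (2 * (2^(3*(ℓ-2)) * MoscT ℓ v x)) * ‖f x‖ₑ^2 := mul_le_mul_left (layer_up _) _
          _ = _ := by ring
    _ = _ := by
        rw [lintegral_const_mul' _ _ (by finiteness)]; ring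

lemma cv_kern_sum {ℓ : ℕ} {f : ℝ → ℂ} (hf : Continuous f) (hc : HasCompactSupport f) (κ : ℕ) :
    cv f (kern ℓ chi (2^κ)) = fun x => ∑ k ∈ Finset.range (κ+1), cv f (Kp ℓ k) x := by
  ext x
  simp only [cv]
  rw [← integral_finsetSum]
  · congr 1
    ext t
    rw [← Finset.mul_sum, Kp_sum]
  · intro k _
    have h1 := (Kp_smooth ℓ k).continuous
    exact (Continuous.mul hf (by fun_prop)).integrable_of_hasCompactSupport hc.mul_right

lemma main_bound {ℓ : ℕ} (hℓ : 2 ≤ ℓ) : ∃ C : ℝ≥0∞, C ≠ ⊤ ∧ ∀ f : ℝ → ℂ, Continuous f → HasCompactSupport f →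
    ∀ w : ℝ → ℝ≥0∞, AEMeasurable w → (∀ x, EE 0 w x ≠ ⊤) → ∀ κ N,
    ∫⁻ x, ‖EG N (cv f (kern ℓ chi (2^κ))) x‖ₑ^2 * w x ≤
      C * ∫⁻ x, ‖f x‖ₑ^2 * (HLM^[2] (MoscT ℓ (HLM^[4] w))) x := by
  obtain ⟨C, hC, hcore⟩ := core hℓ
  refine ⟨ENNReal.ofReal cZ * 1200 * (ENNReal.ofReal cZ * C * 512), by finiteness, fun f hf hc w hw hwt κ N => ?_⟩
  have hf2 : MemLp f 2 := hf.memLp_of_hasCompactSupport hc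
  have hcont : ∀ k, Continuous (cv f (Kp ℓ k)) := fun k => cv_cont hf2 (Kp_cs ℓ k) (Kp_smooth ℓ k)
  have hli : ∀ k, LocallyIntegrable (cv f (Kp ℓ k)) := fun k => (hcont k).locallyIntegrable
  have hG : LocallyIntegrable (cv f (kern ℓ chi (2^κ))) := by
    rw [cv_kern_sum hf hc]
    exact (continuous_finsetSum _ fun k _ => hcont k).locallyIntegrable
  set v := Mx N (Mx N (EE N w)) with hv
  have hvm : Measurable v := (Lev.Mx (N := N)).measurable
  have hMm : ∀ m, Measurable (Mx m v) := fun m => (Lev.Mx (N := m)).measurable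
  have hDm : ∀ n k, Measurable (fun x => ‖DD (cv f (Kp ℓ k)) n x‖ₑ^2 * Mx (n-1) v x) := fun n k =>
    ((Lev.DD (n := n)).measurable.enorm.pow_const 2).mul (hMm _)
  have hstep : ∀ n, ∫⁻ x, ‖DD (cv f (kern ℓ chi (2^κ))) n x‖ₑ^2 * Mx (n-1) v x ≤
      ENNReal.ofReal cZ * ∑ k ∈ Finset.range (κ+1), wt n (k*(ℓ-1)) *
        ∫⁻ x, ‖DD (cv f (Kp ℓ k)) n x‖ₑ^2 * Mx (n-1) v x := by
    intro n
    calc _ ≤ ∫⁻ x, ENNReal.ofReal cZ * ∑ k ∈ Finset.range (κ+1), wt n (k*(ℓ-1)) *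
        (‖DD (cv f (Kp ℓ k)) n x‖ₑ^2 * Mx (n-1) v x) := by
          apply lintegral_mono
          intro x
          simp only
          rw [cv_kern_sum hf hc, DD_sum _ hli]
          have hinj : Set.InjOn (fun k : ℕ => ((k*(ℓ-1) : ℕ) : ℤ)) (Finset.range (κ+1)) := by
            intro a _ b _ hab
            have hab' : a*(ℓ-1) = b*(ℓ-1) := Int.ofNat_inj.1 hab
            exact Nat.eq_of_mul_eq_mul_right (by omega) hab'
          refine (mul_le_mul_left (CS (Finset.range (κ+1)) (fun k => DD (cv f (Kp ℓ k)) n x) _ hinj (n:ℤ)) _).trans ?_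
          rw [mul_assoc, Finset.sum_mul]
          refine mul_le_mul_right (Finset.sum_le_sum fun k _ => ?_) _
          rw [mul_assoc]; rfl
      _ = _ := by
          rw [lintegral_const_mul' _ _ (by finiteness), lintegral_finsetSum]
          · congr 1
            apply Finset.sum_congr rfl
            intro k _
            rw [lintegral_const_mul _ (hDm n k)]
          · intro k _
            exact (hDm n k).const_mul _
  calc _ ≤ ENNReal.ofReal cZ * 1200 * ∑ n ∈ Finset.range (N+1),
      ∫⁻ x, ‖DD (cv f (kern ℓ chi (2^κ))) n x‖ₑ^2 * Mx (n-1) v x := reverse_ineq hG hw hwt N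
    _ ≤ ENNReal.ofReal cZ * 1200 * ∑ n ∈ Finset.range (N+1), ENNReal.ofReal cZ * ∑ k ∈ Finset.range (κ+1), wt n (k*(ℓ-1)) *
        ∫⁻ x, ‖DD (cv f (Kp ℓ k)) n x‖ₑ^2 * Mx (n-1) v x :=
        mul_le_mul_right (Finset.sum_le_sum fun n _ => hstep n) _
    _ = ENNReal.ofReal cZ * 1200 * (ENNReal.ofReal cZ * ∑ k ∈ Finset.range (κ+1), ∑ n ∈ Finset.range (N+1), wt n (k*(ℓ-1)) *
        ∫⁻ x, ‖DD (cv f (Kp ℓ k)) n x‖ₑ^2 * Mx (n-1) v x) := by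
        rw [← Finset.mul_sum, Finset.sum_comm]
    _ ≤ ENNReal.ofReal cZ * 1200 * (ENNReal.ofReal cZ * (C * ∫⁻ x, ‖f x‖ₑ^2 * MoscT ℓ v x)) :=
        mul_le_mul_right (mul_le_mul_right (hcore f hf2 hf.measurable v hvm _ _) _) _
    _ ≤ ENNReal.ofReal cZ * 1200 * (ENNReal.ofReal cZ * (C * ∫⁻ x, 512 * (‖f x‖ₑ^2 * (HLM^[2] (MoscT ℓ (HLM^[4] w))) x))) := by
        refine mul_le_mul_right (mul_le_mul_right (mul_le_mul_right (lintegral_mono fun x => ?_) _) _) _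
        simp only
        calc _ ≤ ‖f x‖ₑ^2 * (4 * (128 * (HLM^[2] (MoscT ℓ (HLM^[4] w))) x)) :=
              mul_le_mul_right ((MoscT_le_mul ℓ (by simp) (fun y => v_le N hw y) x).trans
                (mul_le_mul_right (final_weight ℓ w x) _)) _
          _ = _ := by ring
    _ = _ := by
        rw [lintegral_const_mul' _ _ (by finiteness)]; ring

lemma fatou {g : ℕ → ℝ → ℝ≥0∞} {h : ℝ → ℝ≥0∞} {B : ℝ≥0∞} (hg : ∀ N, AEMeasurable (g N))
    (ht : ∀ x, Filter.Tendsto (fun N => g N x) Filter.atTop (nhds (h x))) (hB : ∀ N, ∫⁻ x, g N x ≤ B) :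
    ∫⁻ x, h x ≤ B := by
  calc ∫⁻ x, h x = ∫⁻ x, Filter.liminf (fun N => g N x) Filter.atTop := by
        congr 1; ext x; exact (ht x).liminf_eq.symm
    _ ≤ Filter.liminf (fun N => ∫⁻ x, g N x) Filter.atTop := lintegral_liminf_le' hg
    _ ≤ B := by
        refine (Filter.liminf_le_liminf (v := fun _ => B) (Filter.Eventually.of_forall hB)).trans ?_
        simp

lemma EG_tendsto {G : ℝ → ℂ} (hG : Continuous G) (x : ℝ) :
    Filter.Tendsto (fun N => EG N G x) Filter.atTop (nhds (G x)) := by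
  rw [Metric.tendsto_atTop]
  intro ε hε
  obtain ⟨δ, hδ, h⟩ := Metric.continuous_iff.1 hG x (ε/2) (by linarith)
  obtain ⟨n, hn⟩ := exists_pow_lt_of_lt_one hδ (show (2:ℝ)⁻¹ < 1 by norm_num)
  refine ⟨n, fun N hN => ?_⟩
  rw [dist_eq_norm, EG_sub_const hG.locallyIntegrable]
  have h1 : ‖EG N (fun y => G y - G x) x‖ₑ ≤ ENNReal.ofReal (ε/2) := by
    refine (enorm_EG_le _ _ _).trans (EE_le_of_le _ _ _ _ fun y hy => ?_)
    rw [← ofReal_norm_eq_enorm]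
    apply ENNReal.ofReal_le_ofReal
    rw [← dist_eq_norm]
    refine (h y ?_).le
    rw [dist_comm, Real.dist_eq]
    refine (abs_lt_of_mem_dI hy).trans (lt_of_le_of_lt ?_ hn)
    rw [inv_pow]
    gcongr
    norm_num
  rw [← ofReal_norm_eq_enorm, ENNReal.ofReal_le_ofReal_iff (by linarith)] at h1
  linarith

lemma cv_eventually (ℓ : ℕ) {f : ℝ → ℂ} (hc : HasCompactSupport f) (x : ℝ) :
    ∀ᶠ κ : ℕ in Filter.atTop, cv f (kern ℓ chi (2^κ)) x = ∫ y : ℝ, Complex.exp (Complex.I * ((x - y : ℝ) : ℂ) ^ ℓ) * f y := by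
  obtain ⟨R, hR⟩ := hc.isCompact.isBounded.subset_closedBall x
  obtain ⟨n, hn⟩ := pow_unbounded_of_one_lt R (one_lt_two)
  filter_upwards [Filter.eventually_ge_atTop n] with κ hκ
  rw [cv]
  congr 1
  ext t
  by_cases ht : f t = 0
  · simp [ht]
  · have h1 := hR (subset_tsupport f ht)
    rw [Metric.mem_closedBall, Real.dist_eq, abs_sub_comm] at h1
    have h2 : R ≤ 2^κ := hn.le.trans (pow_le_pow_right₀ (by norm_num) hκ)
    rw [kern, chi_one, mul_one, mul_comm]
    rw [abs_div, abs_of_pos (by positivity : (0:ℝ) < 2^κ), div_le_one (by positivity)]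
    exact h1.trans h2

lemma final_lem {ℓ : ℕ} (hℓ : 2 ≤ ℓ) : ∃ C : ℝ≥0∞, C ≠ ⊤ ∧ ∀ f : ℝ → ℂ, Continuous f → HasCompactSupport f →
    ∀ w : ℝ → ℝ≥0∞, AEMeasurable w → (∀ x, EE 0 w x ≠ ⊤) → (∀ x, w x ≠ ⊤) →
    ∫⁻ x, ‖∫ y : ℝ, Complex.exp (Complex.I * ((x - y : ℝ) : ℂ) ^ ℓ) * f y‖ₑ^2 * w x ≤
      C * ∫⁻ x, ‖f x‖ₑ^2 * (HLM^[2] (MoscT ℓ (HLM^[4] w))) x := by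
  obtain ⟨C, hC, h⟩ := main_bound hℓ
  refine ⟨C, hC, fun f hf hc w hw hwt hwf => ?_⟩
  have hf2 : MemLp f 2 := hf.memLp_of_hasCompactSupport hc
  have hcont : ∀ κ : ℕ, Continuous (cv f (kern ℓ chi (2^κ))) := fun κ => by
    rw [cv_kern_sum hf hc]
    exact continuous_finsetSum _ fun k _ => cv_cont hf2 (Kp_cs ℓ k) (Kp_smooth ℓ k)
  have hT : ∀ {a : ℕ → ℂ} {b : ℂ} (x : ℝ), Filter.Tendsto a Filter.atTop (nhds b) →
      Filter.Tendsto (fun n => ‖a n‖ₑ^2 * w x) Filter.atTop (nhds (‖b‖ₑ^2 * w x)) := fun x hab =>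
    ENNReal.Tendsto.mul_const (ENNReal.Tendsto.pow hab.enorm) (Or.inr (hwf x))
  refine fatou (g := fun κ x => ‖cv f (kern ℓ chi (2^κ)) x‖ₑ^2 * w x) ?_ ?_ ?_
  · intro κ
    exact ((hcont κ).measurable.enorm.pow_const 2).aemeasurable.mul hw
  · intro x
    exact hT x (tendsto_const_nhds.congr' ((cv_eventually ℓ hc x).mono fun κ hκ => hκ.symm))
  · intro κ
    refine fatou (g := fun N x => ‖EG N (cv f (kern ℓ chi (2^κ))) x‖ₑ^2 * w x) ?_ ?_ ?_
    · intro N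
      exact ((Lev.EG (n := N)).measurable.enorm.pow_const 2).aemeasurable.mul hw
    · intro x
      exact hT x (EG_tendsto (hcont κ) x)
    · intro N
      exact h f hf hc w hw hwt κ N

/-- For every integer `ℓ ≥ 2` there is `C > 0` such that for every weight `w` and every
continuous compactly supported `f : ℝ → ℂ`,
`∫ |(e^{i(·)^ℓ} * f)(x)|² w(x) dx ≤ C ∫ |f(x)|² (M² 𝓜̃_ℓ M⁴ w)(x) dx`. -/
theorem stmt4 (ℓ : ℕ) (hℓ : 2 ≤ ℓ) :
    ∃ C : ℝ, 0 < C ∧ ∀ (w : ℝ → ℝ), (∀ x, 0 ≤ w x) → LocallyIntegrable w volume →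
      ∀ f : ℝ → ℂ, Continuous f → HasCompactSupport f →
      ∫⁻ x : ℝ,
          (‖∫ y : ℝ, Complex.exp (Complex.I * ((x - y : ℝ) : ℂ) ^ ℓ) * f y‖₊ : ℝ≥0∞) ^ 2 *
            ENNReal.ofReal (w x) ≤
        ENNReal.ofReal C * ∫⁻ x : ℝ, (‖f x‖₊ : ℝ≥0∞) ^ 2 *
          (HLM^[2] (MoscT ℓ (HLM^[4] (fun t => ENNReal.ofReal (w t))))) x := by
  obtain ⟨C, hC, h⟩ := final_lem hℓ
  refine ⟨C.toReal + 1, by positivity, fun w hw hwi f hf hc => ?_⟩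
  have hwm : AEMeasurable (fun t => ENNReal.ofReal (w t)) :=
    hwi.aestronglyMeasurable.aemeasurable.ennreal_ofReal
  have hwt : ∀ x, EE 0 (fun t => ENNReal.ofReal (w t)) x ≠ ⊤ := by
    intro x
    have hi : IntegrableOn w (dI 0 x) := by
      rw [dI_eq_Ico]
      exact (hwi.integrableOn_isCompact isCompact_Icc).mono_set Ico_subset_Icc_self
    rw [EE, pow_zero, one_mul]
    exact hi.lintegral_lt_top.ne
  have := h f hf hc _ hwm hwt (fun x => ENNReal.ofReal_ne_top)
  simp only [← enorm_eq_nnnorm]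
  refine this.trans ?_
  gcongr ?_ * _
  rw [← ENNReal.ofReal_toReal hC]
  exact ENNReal.ofReal_le_ofReal (by simp)
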